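/- Let φ be a conformal mapping from the unit disk Δ onto a Jordan domain Ω ⊂ ℂ. Assume ∂Ω is a quasicircle (it satisfies the Ahlfors three-point condition) and Ω satisfies the Bishop–Jones condition. Then the pull-back operator φ* is well-defined from CM₀(Ω) to CM₀(Δ): for every vanishing Carleson measure μ on Ω, the pull-back measure φ*μ, defined by (φ*μ)(A) = ∫_{φ(A)} |(φ⁻¹)′(w)| dμ(w) for Borel sets A ⊂ Δ, is a vanishing Carleson measure on Δ. -/

import Mathlib

open MeasureTheory Metric Set
open scoped ENNReal NNReal

/-- The open unit disk `Δ` in the complex plane. -/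
def unitDisk : Set ℂ := Metric.ball (0 : ℂ) 1

/-- The Carleson "norm" `‖μ‖_* = sup { μ(Ω ∩ D(z,r))/r : z ∈ ∂Ω, 0 < r < diam ∂Ω }`
of a positive Borel measure relative to a domain `Ω`. -/
noncomputable def carlesonNorm (Ω : Set ℂ) (μ : Measure ℂ) : ℝ≥0∞ :=
  ⨆ z ∈ frontier Ω, ⨆ r : ℝ,
    ⨆ (_ : 0 < r ∧ ENNReal.ofReal r < EMetric.diam (frontier Ω)),
      μ (Ω ∩ Metric.ball z r) / ENNReal.ofReal r

/-- `μ` is a Carleson measure on `Ω`. -/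
def IsCarleson (Ω : Set ℂ) (μ : Measure ℂ) : Prop :=
  carlesonNorm Ω μ < ⊤

/-- The push-forward `(φ⁻¹)* ν` of a measure `ν` on `D` under a conformal map `φ` of `D`:
the measure `A ↦ ∫_{φ⁻¹(A)} |φ′| dν`. -/
noncomputable def pushForward (D : Set ℂ) (φ : ℂ → ℂ) (ν : Measure ℂ) : Measure ℂ :=
  Measure.map φ ((ν.restrict D).withDensity fun z => (‖deriv φ z‖₊ : ℝ≥0∞))

/-- `μ` is a vanishing Carleson measure on `Ω`. -/
def IsVanishingCarleson (Ω : Set ℂ) (μ : Measure ℂ) : Prop :=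
  IsCarleson Ω μ ∧
    ∀ ε : ℝ, 0 < ε → ∃ δ : ℝ, 0 < δ ∧ ∀ z ∈ frontier Ω, ∀ r : ℝ, 0 < r → r < δ →
      μ (Ω ∩ Metric.ball z r) ≤ ENNReal.ofReal (ε * r)

/-- `Γ` is a Jordan curve: a homeomorphic (continuous injective) image of the unit circle. -/
def IsJordanCurve (Γ : Set ℂ) : Prop :=
  ∃ f : ℂ → ℂ, ContinuousOn f (Metric.sphere (0 : ℂ) 1) ∧
    Set.InjOn f (Metric.sphere (0 : ℂ) 1) ∧ f '' Metric.sphere (0 : ℂ) 1 = Γ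

/-- The length `ℓ_Γ(z₁,z₂)` of the shorter arc of `Γ` joining `z₁` and `z₂`, i.e. the
least one-dimensional Hausdorff measure of a connected component of `Γ \ {z₁, z₂}`. -/
noncomputable def shortArcLength (Γ : Set ℂ) (z₁ z₂ : ℂ) : ℝ≥0∞ :=
  ⨅ z ∈ Γ \ {z₁, z₂}, μH[1] (connectedComponentIn (Γ \ {z₁, z₂}) z)

/-- `Γ` is a chord-arc curve with constant (at most) `k`:  a rectifiable Jordan curve with
`ℓ_Γ(z₁,z₂) ≤ k |z₁ - z₂|` for all `z₁ z₂ ∈ Γ`. -/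
def IsChordArcWith (Γ : Set ℂ) (k : ℝ) : Prop :=
  IsJordanCurve Γ ∧ μH[1] Γ < ⊤ ∧
    ∀ z₁ ∈ Γ, ∀ z₂ ∈ Γ, z₁ ≠ z₂ →
      shortArcLength Γ z₁ z₂ ≤ ENNReal.ofReal (k * dist z₁ z₂)

/-- `Γ` satisfies the Ahlfors three-point condition (i.e. it is a quasicircle): there is
`K ≥ 1` such that whenever `z₂` lies on the arc of `Γ` between `z₁` and `z₃` of smaller
diameter, `|z₁ - z₂| + |z₂ - z₃| ≤ K |z₁ - z₃|`. -/
def AhlforsThreePoint (Γ : Set ℂ) : Prop :=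
  ∃ K : ℝ, 1 ≤ K ∧ ∀ z₁ ∈ Γ, ∀ z₃ ∈ Γ, ∀ z₂ ∈ Γ \ {z₁, z₃},
    EMetric.diam (connectedComponentIn (Γ \ {z₁, z₃}) z₂) ≤
        EMetric.diam ((Γ \ {z₁, z₃}) \ connectedComponentIn (Γ \ {z₁, z₃}) z₂) →
      dist z₁ z₂ + dist z₂ z₃ ≤ K * dist z₁ z₃

/-- `Ω` satisfies the Bishop–Jones condition: every `z ∈ Ω` lies in a chord-arc subdomain
`Ω_z ⊆ Ω` of uniformly bounded norm, of diameter comparable to `dist(z, ∂Ω)`, with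
`Λ¹(∂Ω ∩ ∂Ω_z) ≥ c · dist(z, ∂Ω)`. -/
def BishopJones (Ω : Set ℂ) : Prop :=
  ∃ k : ℝ, 1 < k ∧ ∃ c : ℝ, 0 < c ∧ ∃ c₁ : ℝ, 0 < c₁ ∧ ∃ c₂ : ℝ, 0 < c₂ ∧
    ∀ z ∈ Ω, ∃ Ωz : Set ℂ, Ωz ⊆ Ω ∧ z ∈ Ωz ∧ IsOpen Ωz ∧ IsConnected Ωz ∧
      IsChordArcWith (frontier Ωz) k ∧
      c₁ * Metric.infDist z (frontier Ω) ≤ Metric.diam Ωz ∧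
      Metric.diam Ωz ≤ c₂ * Metric.infDist z (frontier Ω) ∧
      ENNReal.ofReal (c * Metric.infDist z (frontier Ω)) ≤
        μH[1] (frontier Ω ∩ frontier Ωz)

/-! ### Continuous logarithms and separation in the plane -/

theorem exists_continuous_log {H : ℂ → ℂ} (hH : Continuous H) (h0 : ∀ z, H z ≠ 0) :
    ∃ G : ℂ → ℂ, Continuous G ∧ ∀ z, Complex.exp (G z) = H z := by
  have hsc : IsSimplyConnected (univ : Set ℂ) :=
    (Homeomorph.Set.univ ℂ).toHomotopyEquiv.simplyConnectedSpace
  obtain ⟨G, hG, hGe⟩ := Complex.exists_continuousOn_eqOn_exp_comp hsc isOpen_univ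
    hH.continuousOn (by rintro ⟨z, -, hz⟩; exact h0 z hz)
  exact ⟨G, continuousOn_univ.1 hG, fun z => hGe (mem_univ z)⟩

/-- Two continuous logarithms of the same function on a preconnected set differ by a constant. -/
theorem eq_add_of_exp_eq {X : Type*} [TopologicalSpace X] {S : Set X} (hS : IsPreconnected S)
    {L M : X → ℂ} (hL : ContinuousOn L S) (hM : ContinuousOn M S)
    (h : ∀ z ∈ S, Complex.exp (L z) = Complex.exp (M z)) {a b : X} (ha : a ∈ S) (hb : b ∈ S) :
    L a - M a = L b - M b := by
  have h2 : ∀ z ∈ S, ∃ n : ℤ, L z - M z = n * (2 * Real.pi * Complex.I) := by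
    intro z hz
    obtain ⟨n, hn⟩ := Complex.exp_eq_exp_iff_exists_int.1 (h z hz)
    exact ⟨n, by rw [hn]; ring⟩
  have hc : ContinuousOn (fun z => ((L z - M z) / (2 * Real.pi * Complex.I)).re) S :=
    Complex.continuous_re.comp_continuousOn ((hL.sub hM).div_const _)
  have hpi : (2 * Real.pi * Complex.I : ℂ) ≠ 0 := Complex.two_pi_I_ne_zero
  have hint : ∀ z ∈ S, ∃ n : ℤ, (((L z - M z) / (2 * Real.pi * Complex.I)).re = n) ∧
      L z - M z = n * (2 * Real.pi * Complex.I) := by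
    intro z hz
    obtain ⟨n, hn⟩ := h2 z hz
    refine ⟨n, ?_, hn⟩
    rw [hn, mul_div_cancel_right₀ _ hpi]; simp
  have hpre := hS.image _ hc
  obtain ⟨m, hm, hm'⟩ := hint a ha
  obtain ⟨n, hn, hn'⟩ := hint b hb
  suffices m = n by rw [hm', hn', this]
  by_contra hne
  have hoc := hpre.ordConnected
  wlog hlt : m < n generalizing a b m n
  · exact this hb ha n hn hn' m hm hm' (Ne.symm hne) (lt_of_le_of_ne (not_lt.1 hlt) (Ne.symm hne))
  have hmem : ((m : ℝ) + 1 / 2) ∈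
      (fun z => ((L z - M z) / (2 * Real.pi * Complex.I)).re) '' S := by
    refine hoc.out (mem_image_of_mem _ ha) (mem_image_of_mem _ hb) ?_
    simp only [hm, hn]
    have : (m : ℝ) + 1 ≤ n := by exact_mod_cast hlt
    constructor <;> linarith
  obtain ⟨c, hc, hce⟩ := hmem
  obtain ⟨k, hk, -⟩ := hint c hc
  simp only at hce
  rw [hk] at hce
  have h3 : (2 * k : ℝ) = 2 * m + 1 := by linarith
  have h4 : 2 * k = 2 * m + 1 := by exact_mod_cast h3
  omega

/-- There is no nonvanishing continuous extension of `z - p` from a neighbourhood of infinity. -/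
theorem false_of_eq_sub_outside {H : ℂ → ℂ} (hH : Continuous H) (h0 : ∀ z, H z ≠ 0) (p : ℂ)
    {B : Set ℂ} (hB : Bornology.IsBounded B) (hHB : ∀ z, z ∉ B → H z = z - p) : False := by
  obtain ⟨G, hG, hGe⟩ := exists_continuous_log hH h0
  obtain ⟨R, hR0, hR⟩ := hB.subset_ball_lt 0 p
  have hc1 : Continuous fun t : ℝ => G (p + Complex.exp (Real.log R + t * Complex.I)) := by fun_prop
  have hc2 : Continuous fun t : ℝ => ((Real.log R : ℂ) + t * Complex.I) := by fun_prop
  have hR' : ∀ t : ℝ, Complex.exp (Real.log R + t * Complex.I) = R * Complex.exp (t * Complex.I) := by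
    intro t
    rw [Complex.exp_add, ← Complex.ofReal_exp, Real.exp_log hR0]
  have key := eq_add_of_exp_eq (S := (univ : Set ℝ)) isPreconnected_univ hc1.continuousOn
    hc2.continuousOn (by
      intro t _
      rw [hGe, hHB]
      · ring
      · intro h
        have := hR h
        rw [mem_ball, dist_eq_norm, add_sub_cancel_left, hR', norm_mul,
          Complex.norm_exp_ofReal_mul_I, mul_one, Complex.norm_real, Real.norm_of_nonneg hR0.le]
          at this
        exact lt_irrefl _ this) (mem_univ 0) (mem_univ (2 * Real.pi))
  have h5 : Complex.exp (Real.log R + (2 * Real.pi : ℝ) * Complex.I)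
      = Complex.exp (Real.log R + (0 : ℝ) * Complex.I) := by
    rw [hR', hR']; push_cast; rw [Complex.exp_two_pi_mul_I]; simp
  simp only [h5] at key
  have h6 : ((2 * Real.pi : ℝ) : ℂ) * Complex.I = 0 := by
    have := sub_right_inj.1 key
    have h7 := add_left_cancel this
    rw [← h7]; simp
  simp at h6

/-- If `(z - p) / (z - q)` has a continuous logarithm on the compact set `K`, then `K` does not
separate `p` from `q`. -/
theorem exists_connected_of_log {K : Set ℂ} (hK : IsCompact K) {p q : ℂ} (hp : p ∉ K) (hq : q ∉ K)
    {L : ℂ → ℂ} (hL : ContinuousOn L K)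
    (hLe : ∀ z ∈ K, Complex.exp (L z) = (z - p) / (z - q)) :
    ∃ V : Set ℂ, IsPreconnected V ∧ V ⊆ Kᶜ ∧ p ∈ V ∧ q ∈ V := by
  classical
  have hopen : IsOpen Kᶜ := hK.isClosed.isOpen_compl
  have aux : ∀ (p q : ℂ) (L : ℂ → ℂ), p ∉ K → q ∉ K → ContinuousOn L K →
      (∀ z ∈ K, Complex.exp (L z) = (z - p) / (z - q)) → q ∉ connectedComponentIn Kᶜ p →
      Bornology.IsBounded (connectedComponentIn Kᶜ p) → False := by
    intro p q L hp hq hL hLe hqV hbd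
    set V := connectedComponentIn Kᶜ p with hV
    have hVo : IsOpen V := hopen.connectedComponentIn
    have hpV : p ∈ V := mem_connectedComponentIn hp
    have hfr : frontier V ⊆ K := by
      intro z hz
      by_contra hzK
      have hzV : z ∉ V := fun h => by
        rw [hVo.frontier_eq] at hz; exact hz.2 h
      have hcl : z ∈ closure V := frontier_subset_closure hz
      have hoz : IsOpen (connectedComponentIn Kᶜ z) := hopen.connectedComponentIn
      obtain ⟨w, hw1, hw2⟩ := mem_closure_iff.1 hcl _ hoz (mem_connectedComponentIn hzK)
      have e1 := connectedComponentIn_eq hw1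
      have e2 := connectedComponentIn_eq hw2
      exact hzV (by rw [hV, e2, ← e1]; exact mem_connectedComponentIn hzK)
    obtain ⟨g, hg⟩ := ContinuousMap.exists_restrict_eq (Y := ℂ) hK.isClosed
      ⟨K.domRestrict L, continuousOn_iff_continuous_domRestrict.1 hL⟩
    have hgL : ∀ z ∈ K, g z = L z := fun z hz => by
      exact congrArg (fun u => u ⟨z, hz⟩) hg
    have hclV : closure V = V ∪ frontier V := (closure_eq_self_union_frontier V)
    refine false_of_eq_sub_outside (H := fun z => if z ∈ closure V then (z - q) * Complex.exp (g z)
      else z - p) ?_ ?_ p (B := closure V) hbd.closure ?_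
    · refine Continuous.if ?_ ?_ ?_
      · intro z hz
        have hz' : z ∈ frontier V := by
          have := frontier_closure_subset (s := V) hz
          exact this
        have hzK := hfr hz'
        rw [hgL z hzK, hLe z hzK]
        rw [mul_div_cancel₀]
        exact sub_ne_zero.2 (fun h => hq (h ▸ hzK))
      · fun_prop
      · fun_prop
    · intro z
      split_ifs with h
      · refine mul_ne_zero (sub_ne_zero.2 ?_) (Complex.exp_ne_zero _)
        rintro rfl
        rw [hclV] at h
        exact h.elim hqV fun h => hq (hfr h)
      · exact sub_ne_zero.2 fun h' => h (h' ▸ subset_closure hpV)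
    · intro z hz
      simp [hz]
  by_cases hqV : q ∈ connectedComponentIn Kᶜ p
  · exact ⟨_, isPreconnected_connectedComponentIn, connectedComponentIn_subset _ _,
      mem_connectedComponentIn hp, hqV⟩
  exfalso
  have hpV : p ∉ connectedComponentIn Kᶜ q := fun h => hqV (by
    rw [← connectedComponentIn_eq h]; exact mem_connectedComponentIn hq)
  by_cases hb1 : Bornology.IsBounded (connectedComponentIn Kᶜ p)
  · exact aux p q L hp hq hL hLe hqV hb1
  by_cases hb2 : Bornology.IsBounded (connectedComponentIn Kᶜ q)
  · refine aux q p (fun z => - L z) hq hp hL.neg (fun z hz => ?_) hpV hb2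
    rw [Complex.exp_neg, hLe z hz, inv_div]
  obtain ⟨R, hR0, hR⟩ := hK.isBounded.subset_closedBall_lt 0 (0 : ℂ)
  have hconn : IsPreconnected (closedBall (0 : ℂ) R)ᶜ := by
    have hconv : IsPreconnected {z : ℂ | Real.log R < z.re} :=
      (convex_halfSpace_re_gt _).isPreconnected
    convert hconv.image Complex.exp Complex.continuous_exp.continuousOn using 1
    ext w
    simp only [mem_compl_iff, mem_closedBall, dist_zero_right, not_le, mem_image, mem_ofPred_eq]
    constructor
    · intro hw
      refine ⟨Complex.log w, ?_, Complex.exp_log (norm_pos_iff.1 (hR0.trans hw))⟩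
      rw [Complex.log_re]
      exact Real.log_lt_log hR0 hw
    · rintro ⟨z, hz, rfl⟩
      rw [Complex.norm_exp]
      exact (Real.log_lt_iff_lt_exp hR0).1 hz
  have hsub : (closedBall (0 : ℂ) R)ᶜ ⊆ Kᶜ := compl_subset_compl.2 hR
  have meet : ∀ u : ℂ, ¬ Bornology.IsBounded (connectedComponentIn Kᶜ u) →
      ∃ w ∈ connectedComponentIn Kᶜ u, w ∈ (closedBall (0 : ℂ) R)ᶜ := by
    intro u hu
    by_contra! h
    exact hu (isBounded_closedBall.subset fun w hw => not_not.1 (h w hw))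
  obtain ⟨w1, h1, h1'⟩ := meet p hb1
  obtain ⟨w2, h2, h2'⟩ := meet q hb2
  have : w2 ∈ connectedComponentIn Kᶜ w1 :=
    hconn.subset_connectedComponentIn h1' hsub h2'
  rw [← connectedComponentIn_eq h1] at this
  have e := connectedComponentIn_eq this
  have e' := connectedComponentIn_eq h2
  exact hqV (by rw [e, ← e']; exact mem_connectedComponentIn hq)

/-- A connected open set that is disjoint from `K` consists of points `p, q` for which
`(z - p) / (z - q)` has a continuous logarithm on `K`. -/
theorem exists_log_of_connected {K U : Set ℂ} (hU : IsOpen U) (hUc : IsPreconnected U)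
    (hd : Disjoint U K) {p q : ℂ} (hp : p ∈ U) (hq : q ∈ U) :
    ∃ L : ℂ → ℂ, ContinuousOn L K ∧ ∀ z ∈ K, Complex.exp (L z) = (z - p) / (z - q) := by
  have hne : ∀ u ∈ U, ∀ z ∈ K, z - u ≠ 0 := fun u hu z hz =>
    sub_ne_zero.2 fun h => (hd.notMem_of_mem_left hu) (h ▸ hz)
  refine hUc.induction₂' (fun p q => ∃ L : ℂ → ℂ, ContinuousOn L K ∧
    ∀ z ∈ K, Complex.exp (L z) = (z - p) / (z - q)) ?_ ?_ hp hq
  · intro x hx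
    obtain ⟨ε, hε, hb⟩ := Metric.isOpen_iff.1 hU x hx
    have hloc : ∀ y ∈ ball x ε, y ∈ U → ∃ L : ℂ → ℂ, ContinuousOn L K ∧
        ∀ z ∈ K, Complex.exp (L z) = (z - y) / (z - x) := by
      intro y hy hyU
      refine ⟨fun z => Complex.log ((z - y) / (z - x)), ?_, ?_⟩
      · refine ContinuousOn.clog ?_ ?_
        · exact ContinuousOn.div (by fun_prop) (by fun_prop) (hne x hx)
        · intro z hz
          have h1 : (z - y) / (z - x) = 1 + (x - y) / (z - x) := by
            field_simp [hne x hx z hz]; ring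
          rw [h1]
          apply Complex.mem_slitPlane_of_norm_lt_one
          rw [norm_div, div_lt_one (norm_pos_iff.2 (hne x hx z hz))]
          have h2 : ε ≤ ‖z - x‖ := by
            by_contra! h
            exact (hd.notMem_of_mem_left (hb (mem_ball_iff_norm.2 h))) hz
          rw [mem_ball, dist_comm, dist_eq_norm] at hy
          linarith
      · intro z hz
        exact Complex.exp_log (div_ne_zero (hne y hyU z hz) (hne x hx z hz))
    filter_upwards [nhdsWithin_le_nhds (ball_mem_nhds x hε), self_mem_nhdsWithin] with y hy hyU
    obtain ⟨L, hL, hLe⟩ := hloc y hy hyU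
    exact ⟨⟨fun z => - L z, hL.neg, fun z hz => by
      rw [Complex.exp_neg, hLe z hz, inv_div]⟩, ⟨L, hL, hLe⟩⟩
  · rintro x y z hx hy hz ⟨L, hL, hLe⟩ ⟨M, hM, hMe⟩
    refine ⟨fun z => L z + M z, hL.add hM, fun w hw => ?_⟩
    rw [Complex.exp_add, hLe w hw, hMe w hw]
    field_simp [hne y hy w hw, hne z hz w hw]

/-! ### Arcs of Jordan curves -/

theorem IsJordanCurve.exists_param {Γ : Set ℂ} (hΓ : IsJordanCurve Γ) {a : ℂ} (ha : a ∈ Γ) :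
    ∃ h : ℝ → ℂ, Continuous h ∧ h 0 = a ∧ h 1 = a ∧ InjOn h (Ico 0 1) ∧ h '' Ico 0 1 = Γ ∧
      h '' Icc 0 1 = Γ := by
  obtain ⟨f, hf, hinj, rfl⟩ := hΓ
  obtain ⟨ζ, hζ, rfl⟩ := ha
  have hζ1 : ‖ζ‖ = 1 := by simpa using hζ
  have hζ0 : ζ ≠ 0 := by rintro rfl; simp at hζ1
  set e : ℝ → ℂ := fun t => ζ * Complex.exp ((2 * Real.pi * t : ℝ) * Complex.I) with he
  have hes : ∀ t, e t ∈ sphere (0 : ℂ) 1 := fun t => by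
    simp only [he, mem_sphere_zero_iff_norm, norm_mul, hζ1, Complex.norm_exp_ofReal_mul_I, mul_one]
  have hec : Continuous e := by simp only [he]; fun_prop
  have hinj' : InjOn (fun t => f (e t)) (Ico 0 1) := by
    intro s hs t ht hst
    have h1 := hinj (hes s) (hes t) hst
    have h2 := mul_left_cancel₀ hζ0 h1
    obtain ⟨n, hn⟩ := Complex.exp_eq_exp_iff_exists_int.1 h2
    have h3 : (s : ℂ) = t + n := by
      have h4 : (2 * Real.pi * Complex.I : ℂ) ≠ 0 := Complex.two_pi_I_ne_zero
      apply mul_left_cancel₀ h4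
      push_cast at hn
      linear_combination hn
    have h5 : s = t + n := by exact_mod_cast h3
    have h6 : n = 0 := by
      have h7 : (n : ℝ) < 1 := by linarith [hs.2, ht.1]
      have h8 : (-1 : ℝ) < n := by linarith [hs.1, ht.2]
      have h7' : n < 1 := by exact_mod_cast h7
      have h8' : -1 < n := by exact_mod_cast h8
      omega
    rw [h5, h6]; simp
  have h1e : e 1 = ζ := by
    simp only [he, mul_one]; push_cast; rw [Complex.exp_two_pi_mul_I, mul_one]
  have h0e : e 0 = ζ := by simp [he]
  have himg : (fun t => f (e t)) '' Ico 0 1 = f '' sphere (0 : ℂ) 1 := by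
    apply Subset.antisymm
    · rintro _ ⟨t, -, rfl⟩; exact mem_image_of_mem _ (hes t)
    · rintro _ ⟨w, hw, rfl⟩
      have hw1 : ‖w‖ = 1 := by simpa using hw
      refine ⟨Int.fract (Complex.arg (w / ζ) / (2 * Real.pi)), ⟨Int.fract_nonneg _,
        Int.fract_lt_one _⟩, ?_⟩
      have : e (Int.fract (Complex.arg (w / ζ) / (2 * Real.pi))) = w := by
        simp only [he, Int.fract]
        have h9 : ((2 * Real.pi * (Complex.arg (w / ζ) / (2 * Real.pi)
            - ⌊Complex.arg (w / ζ) / (2 * Real.pi)⌋) : ℝ) : ℂ) * Complex.I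
            = Complex.arg (w / ζ) * Complex.I
              - (⌊Complex.arg (w / ζ) / (2 * Real.pi)⌋ : ℤ) * (2 * Real.pi * Complex.I) := by
          rw [mul_sub, mul_div_cancel₀ _ (by positivity : (2 * Real.pi) ≠ 0)]
          push_cast; ring
        rw [h9, Complex.exp_periodic.sub_int_mul_eq]
        have h10 := Complex.norm_mul_exp_arg_mul_I (w / ζ)
        rw [norm_div, hw1, hζ1, div_one, Complex.ofReal_one, one_mul] at h10
        rw [h10, mul_div_cancel₀ _ hζ0]
      simp only [this]
  refine ⟨fun t => f (e t), ?_, by simp [h0e], by simp [h1e], hinj', himg, ?_⟩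
  · exact hf.comp_continuous hec hes
  · apply Subset.antisymm
    · rintro _ ⟨t, -, rfl⟩; exact mem_image_of_mem _ (hes t)
    · rw [← himg]; exact image_mono Ico_subset_Icc_self

theorem IsJordanCurve.isCompact {Γ : Set ℂ} (hΓ : IsJordanCurve Γ) : IsCompact Γ := by
  obtain ⟨f, hf, -, rfl⟩ := hΓ
  exact (isCompact_sphere _ _).image_of_continuousOn hf

theorem IsJordanCurve.nonempty {Γ : Set ℂ} (hΓ : IsJordanCurve Γ) : Γ.Nonempty := by
  obtain ⟨f, hf, -, rfl⟩ := hΓ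
  exact ⟨f 1, mem_image_of_mem _ (by simp)⟩

theorem IsJordanCurve.isPreconnected {Γ : Set ℂ} (hΓ : IsJordanCurve Γ) : IsPreconnected Γ := by
  obtain ⟨a, ha⟩ := hΓ.nonempty
  obtain ⟨h, hc, -, -, -, -, rfl⟩ := hΓ.exists_param ha
  exact isPreconnected_Icc.image _ hc.continuousOn

/-- `U₁`, `U₂` are the two open arcs of `Γ` with endpoints `a`, `b`. -/
structure IsArcPair (Γ : Set ℂ) (a b : ℂ) (U₁ U₂ : Set ℂ) : Prop where
  conn₁ : IsPreconnected U₁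
  conn₂ : IsPreconnected U₂
  nonempty₁ : U₁.Nonempty
  nonempty₂ : U₂.Nonempty
  union : U₁ ∪ U₂ = Γ \ {a, b}
  disj : Disjoint U₁ U₂
  closed₁ : IsClosed (U₁ ∪ {a, b})
  closed₂ : IsClosed (U₂ ∪ {a, b})
  cconn₁ : IsPreconnected (U₁ ∪ {a, b})
  cconn₂ : IsPreconnected (U₂ ∪ {a, b})

namespace IsArcPair

variable {Γ U₁ U₂ : Set ℂ} {a b : ℂ}

theorem swap (h : IsArcPair Γ a b U₁ U₂) : IsArcPair Γ a b U₂ U₁ :=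
  ⟨h.conn₂, h.conn₁, h.nonempty₂, h.nonempty₁, by rw [union_comm, h.union], h.disj.symm,
    h.closed₂, h.closed₁, h.cconn₂, h.cconn₁⟩

theorem subset_of_isPreconnected (h : IsArcPair Γ a b U₁ U₂) {T : Set ℂ} (hT : IsPreconnected T)
    (hTΓ : T ⊆ Γ \ {a, b}) (hne : (T ∩ U₁).Nonempty) : T ⊆ U₁ := by
  have hcov : T ⊆ (U₁ ∪ {a, b}) ∪ (U₂ ∪ {a, b}) := fun z hz => by
    have := hTΓ hz
    rw [← h.union] at this
    exact this.imp Or.inl Or.inl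
  intro z hz
  by_contra hzU
  have hz2 : z ∈ U₂ := by
    have := hTΓ hz
    rw [← h.union] at this
    exact this.resolve_left hzU
  obtain ⟨w, hw1, hw2⟩ := hne
  obtain ⟨v, hvT, hv1, hv2⟩ := isPreconnected_closed_iff.1 hT _ _ h.closed₁ h.closed₂ hcov
    ⟨w, hw1, Or.inl hw2⟩ ⟨z, hz, Or.inl hz2⟩
  have hvab := (hTΓ hvT).2
  exact (disjoint_left.1 h.disj) (hv1.resolve_right hvab) (hv2.resolve_right hvab)

theorem connectedComponentIn_eq (h : IsArcPair Γ a b U₁ U₂) {z : ℂ} (hz : z ∈ U₁) :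
    connectedComponentIn (Γ \ {a, b}) z = U₁ := by
  have hsub : U₁ ⊆ Γ \ {a, b} := h.union ▸ subset_union_left
  apply Subset.antisymm
  · exact h.subset_of_isPreconnected isPreconnected_connectedComponentIn
      (connectedComponentIn_subset _ _) ⟨z, mem_connectedComponentIn (hsub hz), hz⟩
  · exact h.conn₁.subset_connectedComponentIn hz hsub

theorem diff_eq (h : IsArcPair Γ a b U₁ U₂) : (Γ \ {a, b}) \ U₁ = U₂ := by
  rw [← h.union, union_sdiff_left, h.disj.symm.sdiff_eq_left]

theorem subset₁ (h : IsArcPair Γ a b U₁ U₂) : U₁ ⊆ Γ := fun _ hz =>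
  ((h.union ▸ subset_union_left : U₁ ⊆ Γ \ {a, b}) hz).1

theorem csubset₁ (h : IsArcPair Γ a b U₁ U₂) (ha : a ∈ Γ) (hb : b ∈ Γ) :
    U₁ ∪ {a, b} ⊆ Γ := by
  refine union_subset h.subset₁ ?_
  rintro z (rfl | rfl) <;> assumption

end IsArcPair

theorem isArcPair_of_param {h : ℝ → ℂ} (hc : Continuous h) (h01 : h 0 = h 1)
    (hinj : InjOn h (Ico 0 1)) {s : ℝ} (hs : s ∈ Ioo (0 : ℝ) 1) :
    IsArcPair (h '' Icc 0 1) (h 0) (h s) (h '' Ioo 0 s) (h '' Ioo s 1) := by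
  have e1 : h '' Ioo 0 s ∪ {h 0, h s} = h '' Icc 0 s := by
    rw [← Ioo_union_both hs.1.le, image_union, image_pair]
  have e2 : h '' Ioo s 1 ∪ {h 0, h s} = h '' Icc s 1 := by
    rw [← Ioo_union_both hs.2.le, image_union, image_pair, h01, pair_comm]
  have hm : ∀ {t}, t ∈ Ioo (0 : ℝ) s → t ∈ Ico (0 : ℝ) 1 := fun ht => ⟨ht.1.le, ht.2.trans hs.2⟩
  have hm' : ∀ {t}, t ∈ Ioo s (1 : ℝ) → t ∈ Ico (0 : ℝ) 1 := fun ht => ⟨(hs.1.trans ht.1).le, ht.2⟩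
  refine ⟨isPreconnected_Ioo.image _ hc.continuousOn, isPreconnected_Ioo.image _ hc.continuousOn,
    (nonempty_Ioo.2 hs.1).image _, (nonempty_Ioo.2 hs.2).image _, ?_, ?_, ?_, ?_, ?_, ?_⟩
  · apply Subset.antisymm
    · rintro _ (⟨t, ht, rfl⟩ | ⟨t, ht, rfl⟩)
      · refine ⟨mem_image_of_mem _ ⟨ht.1.le, (ht.2.trans hs.2).le⟩, ?_⟩
        rintro (h' | h')
        · exact ht.1.ne' (hinj (hm ht) ⟨le_rfl, one_pos⟩ h')
        · exact ht.2.ne (hinj (hm ht) ⟨hs.1.le, hs.2⟩ h')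
      · refine ⟨mem_image_of_mem _ ⟨(hs.1.trans ht.1).le, ht.2.le⟩, ?_⟩
        rintro (h' | h')
        · exact (hs.1.trans ht.1).ne' (hinj (hm' ht) ⟨le_rfl, one_pos⟩ h')
        · exact ht.1.ne' (hinj (hm' ht) ⟨hs.1.le, hs.2⟩ h')
    · rintro _ ⟨⟨t, ht, rfl⟩, hn⟩
      simp only [mem_insert_iff, mem_singleton_iff, not_or] at hn
      have t0 : t ≠ 0 := fun e => hn.1 (by rw [e])
      have t1 : t ≠ 1 := fun e => hn.1 (by rw [e, h01])
      have ts : t ≠ s := fun e => hn.2 (by rw [e])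
      rcases lt_or_gt_of_ne ts with h' | h'
      · exact Or.inl ⟨t, ⟨lt_of_le_of_ne ht.1 t0.symm, h'⟩, rfl⟩
      · exact Or.inr ⟨t, ⟨h', lt_of_le_of_ne ht.2 t1⟩, rfl⟩
  · rw [disjoint_left]
    rintro _ ⟨t, ht, rfl⟩ ⟨u, hu, hut⟩
    exact (ht.2.trans hu.1).ne' (hinj (hm' hu) (hm ht) hut)
  · rw [e1]; exact (isCompact_Icc.image hc).isClosed
  · rw [e2]; exact (isCompact_Icc.image hc).isClosed
  · rw [e1]; exact isPreconnected_Icc.image _ hc.continuousOn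
  · rw [e2]; exact isPreconnected_Icc.image _ hc.continuousOn

theorem IsJordanCurve.exists_arcPair {Γ : Set ℂ} (hΓ : IsJordanCurve Γ) {a b : ℂ} (ha : a ∈ Γ)
    (hb : b ∈ Γ) (hab : a ≠ b) : ∃ U₁ U₂, IsArcPair Γ a b U₁ U₂ := by
  obtain ⟨h, hc, h0, h1, hinj, himg, himg'⟩ := hΓ.exists_param ha
  rw [← himg] at hb
  obtain ⟨s, hs, rfl⟩ := hb
  have hs0 : s ≠ 0 := fun e => hab (by rw [e, h0])
  have := isArcPair_of_param hc (h0.trans h1.symm) hinj ⟨lt_of_le_of_ne hs.1 hs0.symm, hs.2⟩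
  rw [himg', h0] at this
  exact ⟨_, _, this⟩

/-- Bounded turning with constant `C`. -/
def BoundedTurning (Γ : Set ℂ) (C : ℝ) : Prop :=
  ∀ a ∈ Γ, ∀ b ∈ Γ, ∃ β ⊆ Γ, IsPreconnected β ∧ a ∈ β ∧ b ∈ β ∧ β ⊆ closedBall a (C * dist a b)

theorem AhlforsThreePoint.exists_boundedTurning {Γ : Set ℂ} (hΓ : IsJordanCurve Γ)
    (h : AhlforsThreePoint Γ) : ∃ C, 1 ≤ C ∧ BoundedTurning Γ C := by
  obtain ⟨K, hK, h⟩ := h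
  refine ⟨K, hK, fun a ha b hb => ?_⟩
  rcases eq_or_ne a b with rfl | hab
  · exact ⟨{a}, by simpa using ha, isPreconnected_singleton, rfl, rfl, by simp⟩
  obtain ⟨U₁, U₂, hU⟩ := hΓ.exists_arcPair ha hb hab
  wlog hd : Metric.ediam U₁ ≤ Metric.ediam U₂ generalizing U₁ U₂
  · exact this U₂ U₁ hU.swap (le_of_not_ge hd)
  refine ⟨U₁ ∪ {a, b}, hU.csubset₁ ha hb, hU.cconn₁, by simp, by simp, ?_⟩
  have hd0 : 0 ≤ dist a b := dist_nonneg
  rintro z (hz | rfl | rfl)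
  · have hz' : z ∈ Γ \ {a, b} := (hU.union ▸ subset_union_left : U₁ ⊆ Γ \ {a, b}) hz
    have := h a ha b hb z hz' (by rw [hU.connectedComponentIn_eq hz, hU.diff_eq]; exact hd)
    rw [mem_closedBall, dist_comm]
    linarith [dist_nonneg (x := z) (y := b)]
  · rw [mem_closedBall, dist_self]; positivity
  · rw [mem_closedBall, dist_comm]; nlinarith

/-- Points of a curve of bounded turning far away from `x` can be joined away from `x`. -/
theorem BoundedTurning.exists_avoiding {Γ : Set ℂ} (hΓ : IsJordanCurve Γ) {C : ℝ} (hC : 1 ≤ C)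
    (h : BoundedTurning Γ C) {x a b : ℂ} {r : ℝ} (hr : 0 < r) (ha : a ∈ Γ) (hb : b ∈ Γ)
    (hax : 4 * C * r < dist a x) (hbx : 4 * C * r < dist b x) :
    ∃ β ⊆ Γ, IsPreconnected β ∧ a ∈ β ∧ b ∈ β ∧ ∀ z ∈ β, r < dist z x := by
  rcases eq_or_ne a b with rfl | hab
  · exact ⟨{a}, by simpa using ha, isPreconnected_singleton, rfl, rfl, by
      rintro z rfl; nlinarith⟩
  obtain ⟨U₁, U₂, hU⟩ := hΓ.exists_arcPair ha hb hab
  have hend : ∀ z ∈ ({a, b} : Set ℂ), 4 * C * r < dist z x := by rintro z (rfl | rfl) <;> assumption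
  by_cases h1 : ∀ z ∈ U₁, r < dist z x
  · refine ⟨U₁ ∪ {a, b}, hU.csubset₁ ha hb, hU.cconn₁, by simp, by simp, ?_⟩
    rintro z (hz | hz)
    · exact h1 z hz
    · have := hend z hz; nlinarith
  by_cases h2 : ∀ z ∈ U₂, r < dist z x
  · refine ⟨U₂ ∪ {a, b}, hU.swap.csubset₁ ha hb, hU.cconn₂, by simp, by simp, ?_⟩
    rintro z (hz | hz)
    · exact h2 z hz
    · have := hend z hz; nlinarith
  push Not at h1 h2
  obtain ⟨z₁, hz₁, hd₁⟩ := h1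
  obtain ⟨z₂, hz₂, hd₂⟩ := h2
  exfalso
  obtain ⟨β, hβΓ, hβ, hz₁β, hz₂β, hβd⟩ := h z₁ (hU.subset₁ hz₁) z₂ (hU.swap.subset₁ hz₂)
  have hβd' : ∀ z ∈ β, dist z x ≤ 4 * C * r := by
    intro z hz
    have e1 := mem_closedBall.1 (hβd hz)
    have e2 := dist_triangle z z₁ x
    have e3 := dist_triangle_right z₁ z₂ x
    have e4 : C * dist z₁ z₂ ≤ C * (2 * r) := by gcongr; linarith
    nlinarith
  have hβsub : β ⊆ Γ \ {a, b} := fun z hz => ⟨hβΓ hz, fun hz' => absurd (hβd' z hz)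
    (not_le.2 (hend z hz'))⟩
  exact (disjoint_left.1 hU.disj) (hU.subset_of_isPreconnected hβ hβsub ⟨z₁, hz₁β, hz₁⟩ hz₂β) hz₂

/-! ### Linear local connectivity -/

theorem IsPreconnected.subset_of_disjoint_frontier {V W : Set ℂ} (hV : IsPreconnected V)
    (hW : IsOpen W) (hd : V ⊆ (frontier W)ᶜ) (hne : (V ∩ W).Nonempty) : V ⊆ W := by
  refine hV.subset_left_of_subset_union hW isClosed_closure.isOpen_compl
    (disjoint_left.2 fun z hz hz' => hz' (subset_closure hz)) (fun z hz => ?_) hne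
  by_contra hcon
  rw [mem_union, not_or, mem_compl_iff, not_not] at hcon
  exact hd hz (by rw [hW.frontier_eq]; exact ⟨hcon.2, hcon.1⟩)

theorem IsOpen.disjoint_frontier {W : Set ℂ} (hW : IsOpen W) : Disjoint W (frontier W) :=
  disjoint_left.2 fun z hz hz' => by rw [hW.frontier_eq] at hz'; exact hz'.2 hz

theorem exists_glued_log {Γ X Y : Set ℂ} (hΓ : IsClosed Γ) (hX : IsClosed X) (hXY : X ⊆ Y)
    {g L M : ℂ → ℂ} (hL : ContinuousOn L Γ) (hM : ContinuousOn M Y)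
    (hLe : ∀ z ∈ Γ, Complex.exp (L z) = g z) (hMe : ∀ z ∈ Y, Complex.exp (M z) = g z)
    (hβ : ∀ a ∈ Γ ∩ X, ∀ b ∈ Γ ∩ X, ∃ β ⊆ Γ ∩ Y, IsPreconnected β ∧ a ∈ β ∧ b ∈ β) :
    ∃ N : ℂ → ℂ, ContinuousOn N (Γ ∪ X) ∧ ∀ z ∈ Γ ∪ X, Complex.exp (N z) = g z := by
  classical
  obtain ⟨c, hc, hcX⟩ : ∃ c : ℂ, (∀ z ∈ Γ ∩ X, L z = M z + c) ∧ Complex.exp c = 1 := by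
    rcases (Γ ∩ X).eq_empty_or_nonempty with h | ⟨a, ha⟩
    · exact ⟨0, by simp [h], by simp⟩
    · refine ⟨L a - M a, fun z hz => ?_, ?_⟩
      · obtain ⟨β, hβs, hβc, haβ, hzβ⟩ := hβ a ha z hz
        have := eq_add_of_exp_eq hβc (hL.mono fun w hw => (hβs hw).1)
          (hM.mono fun w hw => (hβs hw).2)
          (fun w hw => by rw [hLe w (hβs hw).1, hMe w (hβs hw).2]) haβ hzβ
        rw [this]; ring
      · rw [Complex.exp_sub, hLe a ha.1, hMe a (hXY ha.2), div_self]
        rw [← hLe a ha.1]; exact Complex.exp_ne_zero _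
  refine ⟨fun z => if z ∈ X then M z + c else L z, ?_, ?_⟩
  · refine ContinuousOn.union_of_isClosed ?_ ?_ hΓ hX
    · refine hL.congr fun z hz => ?_
      split_ifs with h
      · exact (hc z ⟨hz, h⟩).symm
      · rfl
    · refine ((hM.mono hXY).add (continuousOn_const (c := c))).congr fun z hz => ?_
      simp [hz]
  · intro z hz
    dsimp only
    split_ifs with h
    · rw [Complex.exp_add, hcX, mul_one, hMe z (hXY h)]
    · exact hLe z (hz.resolve_right h)

theorem exists_log_on_ball (x p q : ℂ) {R : ℝ} (hR : 0 < R) (hp : R ≤ dist p x)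
    (hq : R ≤ dist q x) :
    ∃ M : ℂ → ℂ, ContinuousOn M (ball x R) ∧
      ∀ z ∈ ball x R, Complex.exp (M z) = (z - p) / (z - q) := by
  have key : ∀ p : ℂ, R ≤ dist p x → ∀ z ∈ ball x R, x - p ≠ 0 ∧ z - p ≠ 0 ∧
      1 + (z - x) / (x - p) ∈ Complex.slitPlane := by
    intro p hp z hz
    rw [dist_comm, dist_eq_norm] at hp
    rw [mem_ball, dist_eq_norm] at hz
    have h1 : x - p ≠ 0 := norm_pos_iff.1 (hR.trans_le hp)
    refine ⟨h1, fun h => ?_, ?_⟩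
    · have : z - x = -(x - p) := by linear_combination h
      rw [this, norm_neg] at hz; linarith
    · apply Complex.mem_slitPlane_of_norm_lt_one
      rw [norm_div, div_lt_one (norm_pos_iff.2 h1)]; linarith
  refine ⟨fun z => Complex.log (1 + (z - x) / (x - p)) - Complex.log (1 + (z - x) / (x - q))
    + Complex.log ((x - p) / (x - q)), ?_, fun z hz => ?_⟩
  · refine ContinuousOn.add (ContinuousOn.sub ?_ ?_) continuousOn_const
    · exact ContinuousOn.clog (by fun_prop) fun z hz => (key p hp z hz).2.2
    · exact ContinuousOn.clog (by fun_prop) fun z hz => (key q hq z hz).2.2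
  · obtain ⟨h1, h2, h3⟩ := key p hp z hz
    obtain ⟨h1', h2', h3'⟩ := key q hq z hz
    rw [Complex.exp_add, Complex.exp_sub, Complex.exp_log (Complex.slitPlane_ne_zero h3),
      Complex.exp_log (Complex.slitPlane_ne_zero h3'), Complex.exp_log (div_ne_zero h1 h1')]
    have e1 : 1 + (z - x) / (x - p) = (z - p) / (x - p) := by field_simp; ring
    have e2 : 1 + (z - x) / (x - q) = (z - q) / (x - q) := by field_simp; ring
    rw [e1, e2]
    field_simp

theorem exists_log_off_ball (x p q : ℂ) {R : ℝ} (hR : 0 < R) (hp : dist p x < R)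
    (hq : dist q x < R) :
    ∃ M : ℂ → ℂ, ContinuousOn M {z | R < dist z x} ∧
      ∀ z ∈ {z | R < dist z x}, Complex.exp (M z) = (z - p) / (z - q) := by
  have key : ∀ p : ℂ, dist p x < R → ∀ z ∈ {z | R < dist z x}, z - x ≠ 0 ∧ z - p ≠ 0 ∧
      1 + (x - p) / (z - x) ∈ Complex.slitPlane := by
    intro p hp z hz
    rw [dist_comm, dist_eq_norm] at hp
    have hz' : R < ‖z - x‖ := by rw [← dist_eq_norm]; exact hz
    have h1 : z - x ≠ 0 := norm_pos_iff.1 (hR.trans hz')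
    refine ⟨h1, fun h => ?_, ?_⟩
    · have : z - x = -(x - p) := by linear_combination h
      rw [this, norm_neg] at hz'; linarith
    · apply Complex.mem_slitPlane_of_norm_lt_one
      rw [norm_div, div_lt_one (norm_pos_iff.2 h1)]; linarith
  refine ⟨fun z => Complex.log (1 + (x - p) / (z - x)) - Complex.log (1 + (x - q) / (z - x)),
    ?_, fun z hz => ?_⟩
  · have hcont : ∀ p : ℂ, ContinuousOn (fun z : ℂ => 1 + (x - p) / (z - x)) {z | R < dist z x} :=
      fun p => continuousOn_const.add (continuousOn_const.div (by fun_prop)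
        fun z hz => sub_ne_zero.2 fun h => by
          have hz' : R < dist z x := hz
          rw [h, dist_self] at hz'; linarith)
    refine ContinuousOn.sub ?_ ?_
    · exact ContinuousOn.clog (hcont p) fun z hz => (key p hp z hz).2.2
    · exact ContinuousOn.clog (hcont q) fun z hz => (key q hq z hz).2.2
  · obtain ⟨h1, h2, h3⟩ := key p hp z hz
    obtain ⟨h1', h2', h3'⟩ := key q hq z hz
    rw [Complex.exp_sub, Complex.exp_log (Complex.slitPlane_ne_zero h3),
      Complex.exp_log (Complex.slitPlane_ne_zero h3')]
    have e1 : 1 + (x - p) / (z - x) = (z - p) / (z - x) := by field_simp; ring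
    have e2 : 1 + (x - q) / (z - x) = (z - q) / (z - x) := by field_simp; ring
    rw [e1, e2]
    field_simp

/-- Points of `W` far from `x` can be joined in `W` away from `x`. -/
theorem exists_connected_outside {W : Set ℂ} (hW : IsOpen W) (hWc : IsPreconnected W)
    (hΓ : IsCompact (frontier W)) {C : ℝ} (hC : 1 ≤ C) (hBT : BoundedTurning (frontier W) C)
    (x : ℂ) {r : ℝ} (hr : 0 < r) {p q : ℂ} (hp : p ∈ W) (hq : q ∈ W) (hpx : 4 * C * r ≤ dist p x)
    (hqx : 4 * C * r ≤ dist q x) :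
    ∃ V ⊆ W, IsPreconnected V ∧ p ∈ V ∧ q ∈ V ∧ ∀ z ∈ V, r < dist z x := by
  have hdisj : Disjoint W (frontier W) := hW.disjoint_frontier
  have hCr : r < 4 * C * r := by nlinarith
  obtain ⟨L, hL, hLe⟩ := exists_log_of_connected hW hWc hdisj hp hq
  obtain ⟨M, hM, hMe⟩ := exists_log_on_ball x p q (by positivity : 0 < 4 * C * r) hpx hqx
  obtain ⟨N, hN, hNe⟩ := exists_glued_log isClosed_frontier (isClosed_closedBall (x := x) (ε := r))
    (closedBall_subset_ball hCr) hL hM hLe hMe (by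
      rintro a ⟨ha, hax⟩ b ⟨hb, hbx⟩
      obtain ⟨β, hβ, hβc, haβ, hbβ, hβd⟩ := hBT a ha b hb
      refine ⟨β, fun z hz => ⟨hβ hz, ?_⟩, hβc, haβ, hbβ⟩
      have e1 := mem_closedBall.1 (hβd hz)
      rw [mem_closedBall] at hax hbx
      have e2 := dist_triangle z a x
      have e3 := dist_triangle_right a b x
      have e4 : C * dist a b ≤ C * (2 * r) := by gcongr; linarith
      rw [mem_ball]; nlinarith)
  obtain ⟨V, hV, hVK, hpV, hqV⟩ := exists_connected_of_log (hΓ.union (isCompact_closedBall x r))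
    (p := p) (q := q)
    (by
      rintro (h | h)
      · exact disjoint_left.1 hdisj hp h
      · rw [mem_closedBall] at h; linarith)
    (by
      rintro (h | h)
      · exact disjoint_left.1 hdisj hq h
      · rw [mem_closedBall] at h; linarith) hN hNe
  refine ⟨V, hV.subset_of_disjoint_frontier hW (fun z hz h => hVK hz (Or.inl h)) ⟨p, hpV, hp⟩,
    hV, hpV, hqV, fun z hz => ?_⟩
  have := fun h => hVK hz (Or.inr h)
  rw [mem_closedBall] at this
  exact not_le.1 this

/-- Points of `W` near `x` can be joined in `W` near `x`. -/
theorem exists_connected_inside {W : Set ℂ} (hW : IsOpen W) (hWc : IsPreconnected W)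
    (hΓ : IsJordanCurve (frontier W)) {C : ℝ} (hC : 1 ≤ C) (hBT : BoundedTurning (frontier W) C)
    (x : ℂ) {r : ℝ} (hr : 0 < r) {p q : ℂ} (hp : p ∈ W) (hq : q ∈ W) (hpx : dist p x < r)
    (hqx : dist q x < r) :
    ∃ V ⊆ W, IsPreconnected V ∧ p ∈ V ∧ q ∈ V ∧ ∀ z ∈ V, dist z x < 5 * C * r := by
  have hdisj : Disjoint W (frontier W) := hW.disjoint_frontier
  have hCr : r < 5 * C * r := by nlinarith
  obtain ⟨L, hL, hLe⟩ := exists_log_of_connected hW hWc hdisj hp hq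
  obtain ⟨M, hM, hMe⟩ := exists_log_off_ball x p q hr hpx hqx
  have hsph : sphere x (5 * C * r) ⊆ {z | r < dist z x} := fun z hz => by
    rw [mem_sphere] at hz; rw [mem_ofPred_eq, hz]; exact hCr
  obtain ⟨N, hN, hNe⟩ := exists_glued_log isClosed_frontier (isClosed_sphere (x := x))
    hsph hL hM hLe hMe (by
      rintro a ⟨ha, hax⟩ b ⟨hb, hbx⟩
      rw [mem_sphere] at hax hbx
      obtain ⟨β, hβ, hβc, haβ, hbβ, hβd⟩ := hBT.exists_avoiding hΓ hC (x := x) hr ha hb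
        (by rw [hax]; nlinarith) (by rw [hbx]; nlinarith)
      exact ⟨β, fun z hz => ⟨hβ hz, hβd z hz⟩, hβc, haβ, hbβ⟩)
  obtain ⟨V, hV, hVK, hpV, hqV⟩ := exists_connected_of_log
    (hΓ.isCompact.union (isCompact_sphere x (5 * C * r))) (p := p) (q := q)
    (by
      rintro (h | h)
      · exact disjoint_left.1 hdisj hp h
      · rw [mem_sphere] at h; linarith)
    (by
      rintro (h | h)
      · exact disjoint_left.1 hdisj hq h
      · rw [mem_sphere] at h; linarith) hN hNe
  refine ⟨V, hV.subset_of_disjoint_frontier hW (fun z hz h => hVK hz (Or.inl h)) ⟨p, hpV, hp⟩,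
    hV, hpV, hqV, fun z hz => ?_⟩
  refine hV.subset_of_disjoint_frontier (W := ball x (5 * C * r)) isOpen_ball (fun z hz h => ?_)
    ⟨p, hpV, mem_ball.2 (by linarith)⟩ hz
  rw [frontier_ball x (by positivity)] at h
  exact hVK hz (Or.inr h)

/-! ### Interior corkscrew points -/

theorem div_div_mem_slitPlane {v z p q : ℂ} (hp : 8 * ‖v - z‖ < ‖z - p‖)
    (hq : 8 * ‖v - z‖ < ‖z - q‖) :
    (v - p) / (v - q) / ((z - p) / (z - q)) ∈ Complex.slitPlane := by
  have hp0 : 0 < ‖z - p‖ := lt_of_le_of_lt (by positivity) hp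
  have hq0 : 0 < ‖z - q‖ := lt_of_le_of_lt (by positivity) hq
  have hzp : z - p ≠ 0 := norm_pos_iff.1 hp0
  have hzq : z - q ≠ 0 := norm_pos_iff.1 hq0
  have hvq : ‖z - q‖ * (7 / 8) < ‖v - q‖ := by
    have := norm_sub_norm_le (z - q) (z - v)
    rw [sub_sub_sub_cancel_left, norm_sub_rev z v] at this
    linarith
  have hvq0 : v - q ≠ 0 := norm_pos_iff.1 (lt_of_le_of_lt (by positivity) hvq)
  have e : (v - p) / (v - q) / ((z - p) / (z - q)) =
      1 + (v - z) * ((z - q) - (z - p)) / ((z - p) * (v - q)) := by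
    field_simp; ring
  rw [e]
  apply Complex.mem_slitPlane_of_norm_lt_one
  rw [norm_div, norm_mul, norm_mul, div_lt_one (by positivity)]
  have h1 := norm_sub_le (z - q) (z - p)
  have h2 : ‖v - z‖ * ‖z - q - (z - p)‖ ≤ ‖v - z‖ * ‖z - q‖ + ‖v - z‖ * ‖z - p‖ := by
    rw [← mul_add]; gcongr
  nlinarith [norm_nonneg (v - z)]

theorem BoundedTurning.exists_corkscrew {W : Set ℂ} (hW : IsOpen W) (hWc : IsPreconnected W)
    (hΓ : IsCompact (frontier W)) {C : ℝ} (hC : 1 ≤ C) (hBT : BoundedTurning (frontier W) C)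
    {x : ℂ} (hx : x ∈ frontier W) {r : ℝ} (hr : 0 < r) (hfar : ∃ q ∈ W, r ≤ dist q x) :
    ∃ w ∈ W, dist w x ≤ r ∧ r / (96 * C) ≤ infDist w (frontier W) := by
  by_contra! hcon
  have hC0 : 0 < C := by linarith
  set Γ := frontier W with hΓdef
  set X := sphere x (r / 2) ∩ closure W with hX
  set c := r / (96 * C) with hc
  have hc0 : 0 < c := by positivity
  have hCc : C * c = r / 96 := by rw [hc]; field_simp
  obtain ⟨q, hqW, hqx⟩ := hfar
  obtain ⟨p, hpW, hpx⟩ := Metric.mem_closure_iff.1 (frontier_subset_closure hx) (r / 8)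
    (by positivity)
  rw [dist_comm] at hpx
  have hdisj : Disjoint W Γ := hW.disjoint_frontier
  obtain ⟨L, hL, hLe⟩ := exists_log_of_connected hW hWc hdisj hpW hqW
  set g : ℂ → ℂ := fun z => (z - p) / (z - q) with hg
  have hα : ∀ z, ∃ a, (z ∈ Γ ∪ X → a ∈ Γ ∧ dist z a < c) ∧ (z ∈ Γ → a = z) := by
    intro z
    by_cases hzΓ : z ∈ Γ
    · exact ⟨z, fun _ => ⟨hzΓ, by simpa using hc0⟩, fun _ => rfl⟩
    by_cases hzX : z ∈ X
    · have hzW : z ∈ W := by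
        by_contra h
        exact hzΓ (by rw [hΓdef, hW.frontier_eq]; exact ⟨hzX.2, h⟩)
      have := hcon z hzW (by rw [mem_sphere.1 hzX.1]; linarith)
      obtain ⟨a, ha, had⟩ := (infDist_lt_iff ⟨x, hx⟩).1 this
      exact ⟨a, fun _ => ⟨ha, had⟩, fun h => absurd h hzΓ⟩
    · exact ⟨z, fun h => (h.elim hzΓ hzX).elim, fun _ => rfl⟩
  choose α hα1 hα2 using hα
  have hXp : ∀ z ∈ X, r * (3 / 8) ≤ ‖z - p‖ ∧ r * (3 / 8) ≤ ‖z - q‖ := by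
    intro z hz
    have hz1 := mem_sphere.1 hz.1
    have e1 := dist_triangle z p x
    have e2 := dist_triangle q z x
    rw [dist_comm q z] at e2
    rw [← dist_eq_norm, ← dist_eq_norm]
    constructor <;> linarith
  have hslit : ∀ z ∈ X, ∀ v, dist v z ≤ 4 * (C * c) → g v / g z ∈ Complex.slitPlane := by
    intro z hz v hv
    obtain ⟨h1, h2⟩ := hXp z hz
    rw [dist_eq_norm, hCc] at hv
    exact div_div_mem_slitPlane (by linarith) (by linarith)
  have hq0 : ∀ z ∈ Γ ∪ X, z ≠ p ∧ z ≠ q := by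
    rintro z (hz | hz)
    · exact ⟨fun h => disjoint_left.1 hdisj hpW (h ▸ hz), fun h =>
        disjoint_left.1 hdisj hqW (h ▸ hz)⟩
    · obtain ⟨h1, h2⟩ := hXp z hz
      constructor
      · rintro rfl; rw [sub_self, norm_zero] at h1; linarith
      · rintro rfl; rw [sub_self, norm_zero] at h2; linarith
  have hg0 : ∀ z ∈ Γ ∪ X, g z ≠ 0 := fun z hz =>
    div_ne_zero (sub_ne_zero.2 (hq0 z hz).1) (sub_ne_zero.2 (hq0 z hz).2)
  have hgc : ContinuousOn g (Γ ∪ X) := ContinuousOn.div (by fun_prop) (by fun_prop)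
    fun z hz => sub_ne_zero.2 (hq0 z hz).2
  have hindep : ∀ z ∈ X, ∀ a ∈ Γ, dist z a < 2 * c →
      L (α z) - Complex.log (g (α z) / g z) = L a - Complex.log (g a / g z) := by
    intro z hz a ha hza
    obtain ⟨hαΓ, hαd⟩ := hα1 z (Or.inr hz)
    obtain ⟨β, hβ, hβc, h1, h2, hβd⟩ := hBT _ hαΓ a ha
    have hball : ∀ v ∈ β, dist v z ≤ 4 * (C * c) := by
      intro v hv
      have e1 := mem_closedBall.1 (hβd hv)
      have e2 := dist_triangle v (α z) z
      have e3 := dist_triangle_left (α z) a z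
      have e4 : C * dist (α z) a ≤ C * (3 * c) := by gcongr; linarith
      rw [dist_comm (α z) z] at e2
      nlinarith
    have hM : ContinuousOn (fun v => Complex.log (g v / g z) + Complex.log (g z)) β :=
      (ContinuousOn.clog ((hgc.mono (hβ.trans subset_union_left)).div_const _)
        fun v hv => hslit z hz v (hball v hv)).add continuousOn_const
    have := eq_add_of_exp_eq hβc (hL.mono hβ) hM (fun v hv => by
      rw [hLe v (hβ hv), Complex.exp_add, Complex.exp_log (hg0 z (Or.inr hz)),
        Complex.exp_log (div_ne_zero (hg0 v (Or.inl (hβ hv))) (hg0 z (Or.inr hz))),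
        div_mul_cancel₀ _ (hg0 z (Or.inr hz))]) h1 h2
    linear_combination this
  have hΓX : IsCompact (Γ ∪ X) := hΓ.union ((isCompact_sphere _ _).inter_right isClosed_closure)
  set N : ℂ → ℂ := fun z => L (α z) - Complex.log (g (α z) / g z) with hN
  have hNΓ : ∀ z ∈ Γ, N z = L z := fun z hz => by
    simp only [hN, hα2 z hz]
    rw [div_self (hg0 z (Or.inl hz)), Complex.log_one, sub_zero]
  have hNc : ContinuousOn N (Γ ∪ X) := by
    refine ContinuousOn.union_of_isClosed (hL.congr hNΓ) ?_ isClosed_frontier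
      (isClosed_sphere.inter isClosed_closure)
    intro z hz
    obtain ⟨haΓ, had⟩ := hα1 z (Or.inr hz)
    have hga := hg0 z (Or.inr hz)
    have hslz := hslit z hz (α z) (by rw [dist_comm]; nlinarith)
    have hcz : ContinuousWithinAt (fun w => L (α z) - Complex.log (g (α z) / g w)) X z := by
      refine continuousWithinAt_const.sub (ContinuousWithinAt.clog ?_ hslz)
      exact continuousWithinAt_const.div ((hgc z (Or.inr hz)).mono subset_union_right) hga
    refine hcz.congr_of_eventuallyEq ?_ rfl
    filter_upwards [self_mem_nhdsWithin, nhdsWithin_le_nhds (ball_mem_nhds z hc0)] with w hw hwz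
    rw [mem_ball] at hwz
    exact hindep w hw (α z) haΓ (by linarith [dist_triangle w z (α z)])
  have hNe : ∀ z ∈ Γ ∪ X, Complex.exp (N z) = (z - p) / (z - q) := by
    intro z hz
    obtain ⟨haΓ, -⟩ := hα1 z hz
    have h1 := hg0 z hz
    have h2 := hg0 _ (Or.inl haΓ : α z ∈ Γ ∪ X)
    simp only [hN]
    rw [Complex.exp_sub, hLe _ haΓ, Complex.exp_log (div_ne_zero h2 h1)]
    change g (α z) / (g (α z) / g z) = g z
    field_simp
  obtain ⟨V, hV, hVK, hpV, hqV⟩ := exists_connected_of_log hΓX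
    (fun h => (hq0 p h).1 rfl) (fun h => (hq0 q h).2 rfl) hNc hNe
  have hVW : V ⊆ W := hV.subset_of_disjoint_frontier hW (fun z hz h => hVK hz (Or.inl h))
    ⟨p, hpV, hpW⟩
  have hVb : V ⊆ ball x (r / 2) := by
    refine hV.subset_of_disjoint_frontier isOpen_ball (fun z hz h => ?_)
      ⟨p, hpV, mem_ball.2 (by linarith)⟩
    rw [frontier_ball x (by positivity)] at h
    exact hVK hz (Or.inr ⟨h, subset_closure (hVW hz)⟩)
  have := mem_ball.1 (hVb hqV)
  linarith

/-! ### Length estimates on chord-arc curves -/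

theorem ofReal_le_hausdorffMeasure_of_Ioo_subset {S : Set ℂ} (x : ℂ) {r s : ℝ}
    (h : Ioo r s ⊆ (fun z => dist z x) '' S) : ENNReal.ofReal (s - r) ≤ μH[1] S := by
  have h1 : LipschitzWith 1 (fun z : ℂ => dist z x) := LipschitzWith.dist_left x
  have h2 := h1.lipschitzOnWith (s := S) |>.hausdorffMeasure_image_le (d := 1) zero_le_one
  simp only [ENNReal.coe_one, ENNReal.one_rpow, one_mul, hausdorffMeasure_real] at h2
  calc ENNReal.ofReal (s - r) = volume (Ioo r s) := by rw [Real.volume_Ioo]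
    _ ≤ _ := measure_mono h
    _ ≤ _ := h2

theorem IsPreconnected.dist_le_hausdorffMeasure {S : Set ℂ} (hS : IsPreconnected S) {a b : ℂ}
    (ha : a ∈ S) (hb : b ∈ S) : ENNReal.ofReal (dist a b) ≤ μH[1] S := by
  have hpre := hS.image (fun z => dist z a) (by fun_prop)
  have := ofReal_le_hausdorffMeasure_of_Ioo_subset (S := S) a (r := 0) (s := dist a b) (by
    refine Ioo_subset_Icc_self.trans (hpre.ordConnected.out ⟨a, ha, dist_self a⟩
      ⟨b, hb, dist_comm b a⟩))
  simpa using this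

theorem IsPreconnected.le_hausdorffMeasure_ball {S : Set ℂ} (hS : IsPreconnected S) {a b : ℂ}
    (ha : a ∈ S) (hb : b ∈ S) {r : ℝ} (hr : r ≤ dist a b) :
    ENNReal.ofReal r ≤ μH[1] (S ∩ ball a r) := by
  have hpre := hS.image (fun z => dist z a) (by fun_prop)
  have := ofReal_le_hausdorffMeasure_of_Ioo_subset (S := S ∩ ball a r) a (r := 0) (s := r) (by
    intro t ht
    obtain ⟨z, hz, hzt⟩ := hpre.ordConnected.out ⟨a, ha, dist_self a⟩ ⟨b, hb, dist_comm b a⟩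
      (⟨ht.1.le, ht.2.le.trans hr⟩ : t ∈ Icc 0 (dist a b))
    exact ⟨z, ⟨hz, mem_ball.2 (by rw [← hzt] at ht; exact ht.2)⟩, hzt⟩)
  simpa using this

instance nullSingletonClass_hausdorffMeasure_one : NullSingletonClass (μH[1] : Measure ℂ) :=
  Measure.nullSingletonClass_hausdorff ℂ one_pos

namespace IsChordArcWith

variable {Γ : Set ℂ} {k : ℝ}

theorem short_arc (hΓ : IsChordArcWith Γ k) {a b : ℂ} (ha : a ∈ Γ)
    (hb : b ∈ Γ) (hab : a ≠ b) {U₁ U₂ : Set ℂ} (hU : IsArcPair Γ a b U₁ U₂) (hk : 1 < k) :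
    μH[1] U₁ ≤ ENNReal.ofReal ((k + 1) * dist a b) ∨
      μH[1] U₂ ≤ ENNReal.ofReal ((k + 1) * dist a b) := by
  have hd := dist_pos.2 hab
  have h1 := hΓ.2.2 a ha b hb hab
  have h2 : shortArcLength Γ a b < ENNReal.ofReal ((k + 1) * dist a b) :=
    h1.trans_lt ((ENNReal.ofReal_lt_ofReal_iff (by positivity)).2 (by nlinarith))
  simp only [shortArcLength, iInf_lt_iff] at h2
  obtain ⟨z, hz, hlt⟩ := h2
  rw [← hU.union] at hz
  rcases hz with hz | hz
  · rw [hU.connectedComponentIn_eq hz] at hlt; exact Or.inl hlt.le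
  · rw [hU.swap.connectedComponentIn_eq hz] at hlt; exact Or.inr hlt.le

theorem boundedTurning (hΓ : IsChordArcWith Γ k) (hk : 1 < k) : BoundedTurning Γ (k + 1) := by
  intro a ha b hb
  rcases eq_or_ne a b with rfl | hab
  · exact ⟨{a}, by simpa using ha, isPreconnected_singleton, rfl, rfl, by simp⟩
  obtain ⟨U₁, U₂, hU⟩ := hΓ.1.exists_arcPair ha hb hab
  wlog h : μH[1] U₁ ≤ ENNReal.ofReal ((k + 1) * dist a b) generalizing U₁ U₂
  · exact this U₂ U₁ hU.swap ((hΓ.short_arc ha hb hab hU hk).resolve_left h)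
  refine ⟨U₁ ∪ {a, b}, hU.csubset₁ ha hb, hU.cconn₁, by simp, by simp, fun z hz => ?_⟩
  have h1 := hU.cconn₁.dist_le_hausdorffMeasure hz (by simp : a ∈ U₁ ∪ {a, b})
  have h2 : μH[1] (U₁ ∪ {a, b}) ≤ μH[1] U₁ := by
    refine (measure_union_le _ _).trans ?_
    rw [((finite_singleton b).insert a).measure_zero, add_zero]
  rw [mem_closedBall]
  exact (ENNReal.ofReal_le_ofReal_iff (by positivity)).1 (h1.trans (h2.trans h))

theorem _root_.measure_image_le_of_forall_Ioo (μ : Measure ℂ) [NullSingletonClass μ] (h : ℝ → ℂ)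
    {A : Set ℝ} (hA : A ⊆ Ioo 0 1) {c : ℝ≥0∞} (hc : ∀ s ∈ A, μ (h '' Ioo 0 s) ≤ c) :
    μ (h '' A) ≤ c := by
  rcases A.eq_empty_or_nonempty with rfl | hne
  · simp
  have hbdd : BddAbove A := ⟨1, fun s hs => (hA hs).2.le⟩
  obtain ⟨u, hu, hut, huA⟩ := exists_seq_tendsto_sSup hne hbdd
  have hsub : h '' A ⊆ (⋃ n, h '' Ioo 0 (u n)) ∪ {h (sSup A)} := by
    rintro _ ⟨t, ht, rfl⟩
    rcases (le_csSup hbdd ht).eq_or_lt with e | hlt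
    · exact Or.inr (by rw [e]; rfl)
    · obtain ⟨n, hn⟩ := (hut.eventually (lt_mem_nhds hlt)).exists
      exact Or.inl (mem_iUnion.2 ⟨n, mem_image_of_mem _ ⟨(hA ht).1, hn⟩⟩)
  have hmono : Monotone fun n => h '' Ioo 0 (u n) := fun i j hij =>
    image_mono (Ioo_subset_Ioo_right (hu hij))
  calc μ (h '' A) ≤ μ (⋃ n, h '' Ioo 0 (u n)) + μ {h (sSup A)} :=
        (measure_mono hsub).trans (measure_union_le _ _)
    _ = ⨆ n, μ (h '' Ioo 0 (u n)) := by rw [measure_singleton, add_zero, hmono.measure_iUnion]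
    _ ≤ c := iSup_le fun n => hc _ (huA n)

theorem measure_closedBall_le_center (hΓ : IsChordArcWith Γ k) (hk : 1 < k) {x : ℂ} (hx : x ∈ Γ) {r : ℝ}
    (hr : 0 < r) : μH[1] (Γ ∩ closedBall x r) ≤ ENNReal.ofReal (2 * (k + 1) * r) := by
  obtain ⟨h, hc, h0, h1, hinj, himg, himg'⟩ := hΓ.1.exists_param hx
  set c := ENNReal.ofReal ((k + 1) * r) with hcdef
  have hdich : ∀ s ∈ Ioo (0 : ℝ) 1, dist (h s) x ≤ r →
      μH[1] (h '' Ioo 0 s) ≤ c ∨ μH[1] (h '' Ioo s 1) ≤ c := by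
    intro s hs hsr
    have hU := isArcPair_of_param hc (h0.trans h1.symm) hinj hs
    rw [himg', h0] at hU
    have hne : x ≠ h s := fun e => hs.1.ne
      (hinj ⟨le_rfl, one_pos⟩ ⟨hs.1.le, hs.2⟩ (h0.trans e))
    have hsΓ : h s ∈ Γ := himg' ▸ mem_image_of_mem _ ⟨hs.1.le, hs.2.le⟩
    have hle : ENNReal.ofReal ((k + 1) * dist x (h s)) ≤ c :=
      ENNReal.ofReal_le_ofReal (by rw [dist_comm]; gcongr)
    exact (hΓ.short_arc hx hsΓ hne hU hk).imp (·.trans hle) (·.trans hle)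
  set A := {s ∈ Ioo (0 : ℝ) 1 | μH[1] (h '' Ioo 0 s) ≤ c} with hA
  set B := {s ∈ Ioo (0 : ℝ) 1 | μH[1] (h '' Ioo s 1) ≤ c} with hB
  have hsub : Γ ∩ closedBall x r ⊆ {x} ∪ h '' A ∪ h '' B := by
    rintro z ⟨hz, hzr⟩
    rw [← himg] at hz
    obtain ⟨s, hs, rfl⟩ := hz
    rcases hs.1.eq_or_lt with rfl | hs0
    · exact Or.inl (Or.inl h0)
    · rcases hdich s ⟨hs0, hs.2⟩ hzr with h' | h'
      · exact Or.inl (Or.inr ⟨s, ⟨⟨hs0, hs.2⟩, h'⟩, rfl⟩)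
      · exact Or.inr ⟨s, ⟨⟨hs0, hs.2⟩, h'⟩, rfl⟩
  have hAle : μH[1] (h '' A) ≤ c :=
    measure_image_le_of_forall_Ioo _ h (fun s hs => hs.1) fun s hs => hs.2
  have hBle : μH[1] (h '' B) ≤ c := by
    have := measure_image_le_of_forall_Ioo μH[1] (fun t => h (1 - t)) (A := (fun t => 1 - t) '' B)
      (c := c) (by rintro _ ⟨t, ht, rfl⟩; exact ⟨by linarith [ht.1.2], by linarith [ht.1.1]⟩) (by
        rintro _ ⟨t, ht, rfl⟩
        refine le_trans (measure_mono ?_) ht.2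
        rintro _ ⟨u, hu, rfl⟩
        exact ⟨1 - u, ⟨by linarith [hu.2], by linarith [hu.1]⟩, rfl⟩)
    rw [image_image] at this
    simpa using this
  calc μH[1] (Γ ∩ closedBall x r) ≤ μH[1] {x} + μH[1] (h '' A) + μH[1] (h '' B) :=
        (measure_mono hsub).trans ((measure_union_le _ _).trans
          (by gcongr; exact measure_union_le _ _))
    _ ≤ 0 + c + c := by gcongr; exact (measure_singleton x).le
    _ = ENNReal.ofReal (2 * (k + 1) * r) := by
        rw [zero_add, hcdef, ← ENNReal.ofReal_add (by positivity) (by positivity)]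
        congr 1; ring

theorem measure_closedBall_le (hΓ : IsChordArcWith Γ k) (hk : 1 < k) (x : ℂ) {r : ℝ}
    (hr : 0 < r) : μH[1] (Γ ∩ closedBall x r) ≤ ENNReal.ofReal (4 * (k + 1) * r) := by
  rcases (Γ ∩ closedBall x r).eq_empty_or_nonempty with he | ⟨y, hy, hyx⟩
  · simp [he]
  · refine le_trans (measure_mono (inter_subset_inter_right _ ?_))
      ((hΓ.measure_closedBall_le_center hk hy (r := 2 * r) (by positivity)).trans
        (ENNReal.ofReal_le_ofReal (by linarith)))
    apply closedBall_subset_closedBall'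
    rw [mem_closedBall, dist_comm] at hyx
    linarith

theorem le_measure_ball (hΓ : IsChordArcWith Γ k) {x y : ℂ} (hx : x ∈ Γ) (hy : y ∈ Γ) {r : ℝ}
    (hr : r ≤ dist x y) : ENNReal.ofReal r ≤ μH[1] (Γ ∩ ball x r) :=
  hΓ.1.isPreconnected.le_hausdorffMeasure_ball hx hy hr

end IsChordArcWith

/-! ### Injective holomorphic functions and their inverses -/

theorem deriv_ne_zero_of_injOn {f : ℂ → ℂ} {U : Set ℂ} (hU : IsOpen U)
    (hf : DifferentiableOn ℂ f U) (hinj : InjOn f U) {q : ℂ} (hq : q ∈ U) : deriv f q ≠ 0 := by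
  intro hd
  have hUq : U ∈ nhds q := hU.mem_nhds hq
  have ha : AnalyticAt ℂ f q := hf.analyticAt hUq
  have ha' : AnalyticAt ℂ (fun z => f z - f q) q := ha.sub analyticAt_const
  have hne : ¬ ∀ᶠ z in nhds q, f z - f q = 0 := by
    intro h
    obtain ⟨ε, hε, hb⟩ := Metric.eventually_nhds_iff_ball.1 (h.and hUq)
    have hm : q + (ε / 2 : ℝ) ∈ ball q ε := by
      rw [mem_ball, dist_eq_norm, add_sub_cancel_left, Complex.norm_real,
        Real.norm_of_nonneg (by positivity)]
      linarith
    obtain ⟨h1, h2⟩ := hb _ hm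
    have h3 := hinj h2 hq (sub_eq_zero.1 h1)
    have : ((ε / 2 : ℝ) : ℂ) = 0 := by simpa using h3
    have : ε / 2 = 0 := by exact_mod_cast this
    linarith
  obtain ⟨n, g, hg, hg0, hfg⟩ := (ha'.exists_eventuallyEq_pow_smul_nonzero_iff).2 hne
  have hfg' : ∀ᶠ z in nhds q, f z = f q + (z - q) ^ n * g z := by
    filter_upwards [hfg] with z hz
    rw [← sub_eq_iff_eq_add', hz, smul_eq_mul]
  have hn : 2 ≤ n := by
    by_contra! hn
    interval_cases n
    · have := hfg'.self_of_nhds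
      simp at this
      exact hg0 this
    · have h1 : HasDerivAt (fun z => f q + (z - q) ^ 1 * g z) (g q) q := by
        have h2 := (((hasDerivAt_id q).sub_const q).mul hg.differentiableAt.hasDerivAt).const_add
          (f q)
        simpa using h2
      have h2 : deriv f q = g q := by
        rw [Filter.EventuallyEq.deriv_eq hfg', h1.deriv]
      exact hg0 (by rw [← h2, hd])
  have hn0 : (n : ℂ) ≠ 0 := by
    have : n ≠ 0 := by omega
    exact_mod_cast this
  obtain ⟨c, hc⟩ := IsAlgClosed.exists_pow_nat_eq (g q) (by omega : 0 < n)
  have hc0 : c ≠ 0 := by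
    rintro rfl
    rw [zero_pow (by omega)] at hc
    exact hg0 hc.symm
  set r : ℂ → ℂ := fun z => c * Complex.exp (Complex.log (g z / g q) / n) with hr
  have hgd : AnalyticAt ℂ (fun z => g z / g q) q := hg.div analyticAt_const hg0
  have hra : AnalyticAt ℂ r q := by
    refine analyticAt_const.mul (AnalyticAt.cexp ?_)
    refine (hgd.clog ?_).div analyticAt_const hn0
    rw [div_self hg0]; exact Complex.one_mem_slitPlane
  have hrq : r q = c := by simp [hr, div_self hg0]
  have hrn : ∀ᶠ z in nhds q, r z ^ n = g z := by
    have : ∀ᶠ z in nhds q, g z ≠ 0 := hg.continuousAt.eventually_ne hg0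
    filter_upwards [this] with z hz
    rw [hr]
    simp only
    rw [mul_pow, ← Complex.exp_nat_mul, mul_div_cancel₀ _ hn0, Complex.exp_log
      (div_ne_zero hz hg0), hc, mul_div_cancel₀ _ hg0]
  set h : ℂ → ℂ := fun z => (z - q) * r z with hh
  have hha : AnalyticAt ℂ h q := (analyticAt_id.sub analyticAt_const).mul hra
  have hhd : deriv h q ≠ 0 := by
    have h2 := ((hasDerivAt_id q).sub_const q).mul hra.differentiableAt.hasDerivAt
    have h3 : deriv h q = c := by
      have := h2.deriv
      simp only [id, sub_self, zero_mul, one_mul, add_zero, hrq] at this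
      exact this
    rw [h3]; exact hc0
  have hstrict := hha.hasStrictDerivAt
  have hmap := hstrict.map_nhds_eq hhd
  have hhq : h q = 0 := by simp [hh]
  rw [hhq] at hmap
  obtain ⟨ε, hε, hb⟩ := Metric.eventually_nhds_iff_ball.1 ((hfg'.and hrn).and hUq)
  have himg : h '' ball q ε ∈ nhds (0 : ℂ) := by
    rw [← hmap]; exact Filter.image_mem_map (ball_mem_nhds q hε)
  obtain ⟨s, hs, hsb⟩ := Metric.mem_nhds_iff.1 himg
  have hval : ∀ z ∈ ball q ε, f z = f q + h z ^ n := by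
    intro z hz
    obtain ⟨⟨h1, h2⟩, _⟩ := hb z hz
    rw [h1, hh]
    simp only
    rw [mul_pow, h2]
  have hζ := Complex.isPrimitiveRoot_exp n (by omega)
  set ζ := Complex.exp (2 * Real.pi * Complex.I / n) with hζd
  have hζ1 : ζ ≠ 1 := hζ.ne_one (by omega)
  have hζn : ‖ζ‖ = 1 := hζ.norm'_eq_one (by omega)
  have hs2 : ‖((s / 2 : ℝ) : ℂ)‖ = s / 2 := by
    rw [Complex.norm_real, Real.norm_of_nonneg (by positivity)]
  obtain ⟨z1, hz1, e1⟩ := hsb (show ((s / 2 : ℝ) : ℂ) ∈ ball (0 : ℂ) s by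
    rw [mem_ball_zero_iff, hs2]; linarith)
  obtain ⟨z2, hz2, e2⟩ := hsb (show ζ * ((s / 2 : ℝ) : ℂ) ∈ ball (0 : ℂ) s by
    rw [mem_ball_zero_iff, norm_mul, hs2, hζn]; linarith)
  have e : f z1 = f z2 := by
    rw [hval z1 hz1, hval z2 hz2, e1, e2, mul_pow, hζ.pow_eq_one, one_mul]
  have := hinj (hb z1 hz1).2 (hb z2 hz2).2 e
  rw [this, e2] at e1
  have hs0 : ((s / 2 : ℝ) : ℂ) ≠ 0 := by
    rw [← norm_pos_iff, hs2]; positivity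
  exact hζ1 (mul_right_cancel₀ hs0 (by rw [e1, one_mul]))

theorem hasDerivAt_leftInverse {f ψ : ℂ → ℂ} {U : Set ℂ} (hU : IsOpen U)
    (hf : DifferentiableOn ℂ f U) (hψ : ∀ z ∈ U, ψ (f z) = z) {q : ℂ} (hq : q ∈ U) :
    HasDerivAt ψ (deriv f q)⁻¹ (f q) := by
  have hinj : InjOn f U := fun a ha b hb h => by rw [← hψ a ha, h, hψ b hb]
  have hd := deriv_ne_zero_of_injOn hU hf hinj hq
  have hUq : U ∈ nhds q := hU.mem_nhds hq
  have hs := (hf.analyticAt hUq).hasStrictDerivAt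
  have hmap := hs.map_nhds_eq hd
  have hleft : ∀ᶠ z in nhds q, ψ (f z) = z := by filter_upwards [hUq] with z hz using hψ z hz
  have hcont : ContinuousAt ψ (f q) := by
    rw [ContinuousAt, hψ q hq, ← hmap, Filter.tendsto_map'_iff]
    exact (Filter.tendsto_id.congr' (by filter_upwards [hleft] with z hz using hz.symm))
  have hright : ∀ᶠ w in nhds (f q), f (ψ w) = w := by
    rw [← hmap, Filter.eventually_map]
    filter_upwards [hleft] with z hz
    rw [hz]
  have := hs.hasDerivAt
  rw [← hψ q hq] at this
  have h2 := HasDerivAt.of_local_left_inverse hcont this (by rwa [hψ q hq]) hright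
  rwa [hψ q hq] at h2

theorem isOpen_image_of_injOn {f : ℂ → ℂ} {U V : Set ℂ} (hU : IsOpen U)
    (hf : DifferentiableOn ℂ f U) (hinj : InjOn f U) (hV : IsOpen V) (hVU : V ⊆ U) :
    IsOpen (f '' V) := by
  rw [isOpen_iff_mem_nhds]
  rintro _ ⟨q, hq, rfl⟩
  have hs := (hf.analyticAt (hU.mem_nhds (hVU hq))).hasStrictDerivAt
  rw [← hs.map_nhds_eq (deriv_ne_zero_of_injOn hU hf hinj (hVU hq))]
  exact Filter.image_mem_map (hV.mem_nhds hq)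

theorem ball_infDist_frontier_subset {W : Set ℂ} (hW : IsOpen W) {w : ℂ} (hw : w ∈ W) :
    ball w (infDist w (frontier W)) ⊆ W := by
  by_cases h0 : infDist w (frontier W) ≤ 0
  · rw [ball_eq_empty.2 h0]; exact empty_subset _
  refine IsPreconnected.subset_of_disjoint_frontier (convex_ball _ _).isPreconnected hW ?_
    ⟨w, mem_ball_self (not_le.1 h0), hw⟩
  intro z hz hzf
  have := infDist_le_dist_of_mem (x := w) hzf
  rw [mem_ball, dist_comm] at hz
  linarith

/-! ### Logarithms and the Koebe distortion estimate -/

theorem exists_differentiableOn_log {U : Set ℂ} (hU : IsOpen U) (hUc : Convex ℝ U)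
    (hne : U.Nonempty) {g : ℂ → ℂ} (hg : DifferentiableOn ℂ g U) (h0 : ∀ z ∈ U, g z ≠ 0) :
    ∃ h : ℂ → ℂ, DifferentiableOn ℂ h U ∧ ∀ z ∈ U, Complex.exp (h z) = g z := by
  have hsc : IsSimplyConnected U := by
    have := hUc.contractibleSpace hne
    exact (inferInstance : SimplyConnectedSpace U)
  obtain ⟨h, hh, he⟩ := Complex.exists_continuousOn_eqOn_exp_comp hsc hU hg.continuousOn
    (by rintro ⟨z, hz, hz0⟩; exact h0 z hz hz0)
  have he' : ∀ z ∈ U, Complex.exp (h z) = g z := fun z hz => he hz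
  refine ⟨h, ?_, he'⟩
  intro q hq
  have hUq := hU.mem_nhds hq
  have hcont : ContinuousAt (fun z => h z - h q) q := (hh.continuousAt hUq).sub continuousAt_const
  have hsm : ∀ᶠ z in nhds q, ‖h z - h q‖ < 1 := by
    have h3 := (hcont.norm).eventually_lt_const (u := 1) (by simp)
    exact h3
  have hev : (fun z => h q + Complex.log (g z / g q)) =ᶠ[nhds q] h := by
    filter_upwards [hsm, hUq] with z hz hzU
    have hi := (Complex.abs_im_le_norm (h z - h q)).trans_lt hz
    have hpi := Real.pi_gt_three
    rw [← he' z hzU, ← he' q hq, ← Complex.exp_sub, Complex.log_exp]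
    · ring
    · have := (abs_lt.1 hi).1; linarith
    · have := (abs_lt.1 hi).2; linarith
  refine DifferentiableAt.differentiableWithinAt ?_
  refine DifferentiableAt.congr_of_eventuallyEq ?_ hev.symm
  refine (((hg.differentiableAt hUq).div_const _).clog ?_).const_add _
  rw [div_self (h0 q hq)]
  exact Complex.one_mem_slitPlane

/-- The upper half-plane as a subset of `ℂ`. -/
def uhp : Set ℂ := {z | 0 < z.im}

theorem mem_uhp {z : ℂ} : z ∈ uhp ↔ 0 < z.im := Iff.rfl

theorem isOpen_uhp : IsOpen uhp := isOpen_lt continuous_const Complex.continuous_im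

theorem convex_uhp : Convex ℝ uhp := convex_halfSpace_im_gt 0

theorem ball_subset_uhp {q : ℂ} : ball q q.im ⊆ uhp := by
  intro z hz
  rw [mem_ball, dist_eq_norm] at hz
  have := (Complex.abs_im_le_norm (z - q)).trans_lt hz
  have := (abs_lt.1 this).1
  simp at this
  exact this

theorem deriv_eq_mul_of_exp_eq {U : Set ℂ} (hU : IsOpen U) {g h : ℂ → ℂ}
    (hh : DifferentiableOn ℂ h U) (he : ∀ z ∈ U, Complex.exp (h z) = g z) {q : ℂ} (hq : q ∈ U) :
    deriv g q = g q * deriv h q := by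
  have h1 : g =ᶠ[nhds q] fun z => Complex.exp (h z) := by
    filter_upwards [hU.mem_nhds hq] with z hz using (he z hz).symm
  rw [h1.deriv_eq, ((hh.differentiableAt (hU.mem_nhds hq)).hasDerivAt.cexp).deriv, he q hq]

/-- A holomorphic function with injective exponential has controlled derivative. -/
theorem mul_norm_deriv_le_of_injOn_exp {h : ℂ → ℂ} {q : ℂ} {R : ℝ} (hR : 0 < R)
    (hh : DifferentiableOn ℂ h (ball q R)) (hinj : InjOn (fun z => Complex.exp (h z)) (ball q R)) :
    R * ‖deriv h q‖ ≤ 96 * Real.pi := by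
  suffices H : ∀ s, 0 < s → s < R → s * ‖deriv h q‖ ≤ 96 * Real.pi by
    have hc : Filter.Tendsto (fun s => s * ‖deriv h q‖) (nhdsWithin R (Iio R))
        (nhds (R * ‖deriv h q‖)) := by
      apply Filter.Tendsto.mono_left _ nhdsWithin_le_nhds
      exact (continuous_id.mul continuous_const).tendsto R
    refine le_of_tendsto hc ?_
    have h1 : ∀ᶠ s in nhdsWithin R (Iio R), 0 < s :=
      Filter.Eventually.filter_mono nhdsWithin_le_nhds (lt_mem_nhds hR)
    filter_upwards [self_mem_nhdsWithin, h1] with s hs hs0 using H s hs0 hs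
  intro s hs0 hsR
  have hd : DifferentiableOn ℂ (deriv h) (ball q R) := hh.deriv isOpen_ball
  have hsub : closedBall q s ⊆ ball q R := closedBall_subset_ball hsR
  have hcont : ContinuousOn (fun z => (s - dist z q) * ‖deriv h z‖) (closedBall q s) := by
    refine ContinuousOn.mul (by fun_prop) ?_
    exact (hd.continuousOn.mono hsub).norm
  obtain ⟨z1, hz1, hmax⟩ := (isCompact_closedBall q s).exists_isMaxOn
    ⟨q, mem_closedBall_self hs0.le⟩ hcont
  have hmax' : ∀ z ∈ closedBall q s, (s - dist z q) * ‖deriv h z‖ ≤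
      (s - dist z1 q) * ‖deriv h z1‖ := fun z hz => hmax hz
  have hq := hmax' q (mem_closedBall_self hs0.le)
  rw [dist_self, sub_zero] at hq
  refine hq.trans ?_
  by_contra! hcon
  set a := ‖deriv h z1‖ with ha
  set ρ := (s - dist z1 q) / 2 with hρ
  have hρ2 : s - dist z1 q = 2 * ρ := by rw [hρ]; ring
  rw [hρ2] at hcon
  have hpi := Real.pi_pos
  have ha0 : 0 ≤ a := norm_nonneg _
  have hρ0 : 0 < ρ := by
    by_contra! h
    nlinarith
  have ha1 : 0 < a := by
    by_contra! h
    nlinarith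
  have hball : ball z1 ρ ⊆ closedBall q s := by
    intro z hz
    have := dist_triangle z z1 q
    rw [mem_ball] at hz
    rw [mem_closedBall]
    linarith
  have hbd : ∀ z ∈ ball z1 ρ, ‖deriv h z‖ ≤ 2 * a := by
    intro z hz
    have h1 := hmax' z (hball hz)
    have := dist_triangle z z1 q
    rw [mem_ball] at hz
    rw [hρ2] at h1
    have h3 : ρ ≤ s - dist z q := by linarith
    have h4 : ρ * ‖deriv h z‖ ≤ ρ * (2 * a) := by
      calc ρ * ‖deriv h z‖ ≤ (s - dist z q) * ‖deriv h z‖ := by gcongr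
        _ ≤ _ := by rw [ha]; linarith
    exact le_of_mul_le_mul_left h4 hρ0
  have hmaps : MapsTo (deriv h) (ball z1 ρ) (closedBall (deriv h z1) (3 * a)) := by
    intro z hz
    rw [mem_closedBall, dist_eq_norm]
    calc _ ≤ ‖deriv h z‖ + ‖deriv h z1‖ := norm_sub_le _ _
      _ ≤ 2 * a + a := by gcongr; exact hbd z hz
      _ = 3 * a := by ring
  have hschw : ∀ z ∈ ball z1 ρ, ‖deriv h z - deriv h z1‖ ≤ 3 * a / ρ * dist z z1 := by
    intro z hz
    rw [← dist_eq_norm]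
    exact Complex.dist_le_div_mul_dist_of_mapsTo_ball (hd.mono (hball.trans hsub)) hmaps hz
  have hcb : closedBall z1 (ρ / 6) ⊆ ball z1 ρ := closedBall_subset_ball (by linarith)
  have hder : ∀ z ∈ closedBall z1 (ρ / 6), ‖deriv h z - deriv h z1‖ ≤ a / 2 := by
    intro z hz
    refine (hschw z (hcb hz)).trans ?_
    rw [mem_closedBall] at hz
    calc 3 * a / ρ * dist z z1 ≤ 3 * a / ρ * (ρ / 6) := by gcongr
      _ = a / 2 := by field_simp; ring
  have hlow : ∀ z ∈ sphere z1 (ρ / 6), a * ρ / 12 ≤ ‖h z - h z1‖ := by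
    intro z hz
    have hmv := (convex_closedBall z1 (ρ / 6)).norm_image_sub_le_of_norm_hasDerivWithin_le
      (f := fun z => h z - deriv h z1 * z) (f' := fun z => deriv h z - deriv h z1) (C := a / 2)
      (by
        intro w hw
        have h5 := (hh.differentiableAt (isOpen_ball.mem_nhds
          (hsub (hball (hcb hw))))).hasDerivAt
        have h6 := h5.sub ((hasDerivAt_id w).const_mul (deriv h z1))
        simp only [mul_one] at h6
        exact h6.hasDerivWithinAt) hder
      (mem_closedBall_self (by positivity)) (sphere_subset_closedBall hz)
    have hzn : ‖z - z1‖ = ρ / 6 := by rw [← dist_eq_norm]; exact hz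
    rw [hzn] at hmv
    have e : deriv h z1 * (z - z1) = (h z - h z1) - (h z - deriv h z1 * z -
      (h z1 - deriv h z1 * z1)) := by ring
    have h7 : a * (ρ / 6) = ‖deriv h z1 * (z - z1)‖ := by rw [norm_mul, hzn]
    have h8 := norm_sub_le (h z - h z1) (h z - deriv h z1 * z - (h z1 - deriv h z1 * z1))
    rw [← e, ← h7] at h8
    linarith
  have hDC : DiffContOnCl ℂ h (ball z1 (ρ / 6)) := by
    refine DifferentiableOn.diffContOnCl ?_
    rw [closure_ball _ (by positivity)]
    exact hh.mono (hcb.trans (hball.trans hsub))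
  have himg := hDC.ball_subset_image_closedBall (r := ρ / 6) (ε := a * ρ / 12)
    (by positivity) hlow ?_
  · have hin : h z1 + 2 * Real.pi * Complex.I ∈ ball (h z1) (a * ρ / 12 / 2) := by
      rw [mem_ball, dist_eq_norm, add_sub_cancel_left]
      have : ‖(2 * Real.pi * Complex.I : ℂ)‖ = 2 * Real.pi := by
        rw [norm_mul, norm_mul, Complex.norm_I, Complex.norm_real, Real.norm_of_nonneg hpi.le]
        simp
      rw [this]; linarith
    obtain ⟨z2, hz2, e2⟩ := himg hin
    have h9 := hinj (hsub (hball (hcb hz2))) (hsub (hball (mem_ball_self hρ0)))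
      (by simp only [e2, Complex.exp_add, Complex.exp_two_pi_mul_I, mul_one])
    rw [h9] at e2
    simp at e2
  · intro hfr
    have h10 : h =ᶠ[nhds z1] fun _ => h z1 := by
      have h11 : ∀ᶠ z in nhds z1, ¬ (h z ≠ h z1) := hfr
      filter_upwards [h11] with z hz using not_not.1 hz
    have h13 := h10.deriv_eq
    rw [deriv_const] at h13
    rw [h13, norm_zero] at ha
    linarith

/-- Koebe's estimate: an injective holomorphic function on the upper half-plane omitting `x`. -/
theorem im_mul_norm_deriv_le {f : ℂ → ℂ} (hf : DifferentiableOn ℂ f uhp) (hinj : InjOn f uhp)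
    {x : ℂ} (hx : x ∉ f '' uhp) {q : ℂ} (hq : q ∈ uhp) :
    q.im * ‖deriv f q‖ ≤ 96 * Real.pi * ‖f q - x‖ := by
  obtain ⟨h, hh, he⟩ := exists_differentiableOn_log isOpen_uhp convex_uhp ⟨q, hq⟩
    (hf.sub_const x) (fun z hz h0 => hx ⟨z, hz, sub_eq_zero.1 h0⟩)
  have h1 := mul_norm_deriv_le_of_injOn_exp (mem_uhp.1 hq) (hh.mono ball_subset_uhp) (by
    intro a ha b hb hab
    have ha' := ball_subset_uhp ha
    have hb' := ball_subset_uhp hb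
    simp only [he a ha', he b hb', sub_left_inj] at hab
    exact hinj ha' hb' hab)
  have h2 := deriv_eq_mul_of_exp_eq isOpen_uhp hh he hq
  have h3 : deriv (fun z => f z - x) q = deriv f q := deriv_sub_const _
  rw [h3] at h2
  rw [h2, norm_mul]
  calc _ = ‖f q - x‖ * (q.im * ‖deriv h q‖) := by ring
    _ ≤ ‖f q - x‖ * (96 * Real.pi) := by gcongr
    _ = _ := by ring

theorem segment_subset_im_ge {p q : ℂ} {m : ℝ} (hp : m ≤ p.im) (hq : m ≤ q.im) :
    segment ℝ p q ⊆ {z | m ≤ z.im} :=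
  (convex_halfSpace_im_ge m).segment_subset hp hq

/-- Harnack-type inequality for `|f - x|`. -/
theorem norm_sub_le_exp_mul {f : ℂ → ℂ} (hf : DifferentiableOn ℂ f uhp) (hinj : InjOn f uhp)
    {x : ℂ} (hx : x ∉ f '' uhp) {p q : ℂ} {m : ℝ} (hm : 0 < m) (hp : m ≤ p.im) (hq : m ≤ q.im) :
    ‖f p - x‖ ≤ Real.exp (96 * Real.pi * dist p q / m) * ‖f q - x‖ := by
  have hqu : q ∈ uhp := hm.trans_le hq
  have hpu : p ∈ uhp := hm.trans_le hp
  obtain ⟨h, hh, he⟩ := exists_differentiableOn_log isOpen_uhp convex_uhp ⟨q, hqu⟩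
    (hf.sub_const x) (fun z hz h0 => hx ⟨z, hz, sub_eq_zero.1 h0⟩)
  have hsub : segment ℝ q p ⊆ {z | m ≤ z.im} := segment_subset_im_ge hq hp
  have hmv := (convex_segment q p).norm_image_sub_le_of_norm_deriv_le (f := h)
    (C := 96 * Real.pi / m) (fun z hz => hh.differentiableAt
      (isOpen_uhp.mem_nhds (hm.trans_le (hsub hz)))) (by
      intro z hz
      have hzm : m ≤ z.im := hsub hz
      have hzu : z ∈ uhp := hm.trans_le hzm
      have h1 := im_mul_norm_deriv_le hf hinj hx hzu
      have h2 := deriv_eq_mul_of_exp_eq isOpen_uhp hh he hzu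
      have h3 : deriv (fun z => f z - x) z = deriv f z := deriv_sub_const _
      rw [h3] at h2
      have h0 : 0 < ‖f z - x‖ := norm_pos_iff.2 fun h0 => hx ⟨z, hzu, sub_eq_zero.1 h0⟩
      rw [h2, norm_mul] at h1
      rw [le_div_iff₀ hm]
      have h4 : ‖f z - x‖ * (z.im * ‖deriv h z‖) ≤ ‖f z - x‖ * (96 * Real.pi) := by linarith
      have h5 := le_of_mul_le_mul_left h4 h0
      calc ‖deriv h z‖ * m ≤ ‖deriv h z‖ * z.im := by gcongr
        _ ≤ _ := by linarith) (left_mem_segment ℝ q p) (right_mem_segment ℝ q p)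
  have e1 : f p - x = Complex.exp (h p - h q) * (f q - x) := by
    rw [← he p hpu, ← he q hqu, ← Complex.exp_add]; ring_nf
  rw [e1, norm_mul, Complex.norm_exp]
  gcongr
  calc (h p - h q).re ≤ ‖h p - h q‖ := Complex.re_le_norm _
    _ ≤ _ := hmv
    _ = _ := by rw [dist_eq_norm]; ring

/-! ### Conformal maps of the upper half-plane -/

/-- `f` is a conformal map of the upper half-plane onto `Ω` with inverse `ψ`; the boundary of
`Ω` is nonempty. -/
structure ConformalUHP (f ψ : ℂ → ℂ) (Ω : Set ℂ) : Prop where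
  diff : DifferentiableOn ℂ f uhp
  img : f '' uhp = Ω
  left : ∀ z ∈ uhp, ψ (f z) = z
  ne : (frontier Ω).Nonempty

namespace ConformalUHP

variable {f ψ : ℂ → ℂ} {Ω : Set ℂ}

theorem injOn (h : ConformalUHP f ψ Ω) : InjOn f uhp :=
  fun a ha b hb e => by rw [← h.left a ha, e, h.left b hb]

theorem isOpen (h : ConformalUHP f ψ Ω) : IsOpen Ω := by
  rw [← h.img]; exact isOpen_image_of_injOn isOpen_uhp h.diff h.injOn isOpen_uhp Subset.rfl

theorem isPreconnected (h : ConformalUHP f ψ Ω) : IsPreconnected Ω := by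
  rw [← h.img]; exact convex_uhp.isPreconnected.image f h.diff.continuousOn

theorem mem (h : ConformalUHP f ψ Ω) {z : ℂ} (hz : z ∈ uhp) : f z ∈ Ω :=
  h.img ▸ mem_image_of_mem f hz

theorem map_mem (h : ConformalUHP f ψ Ω) {w : ℂ} (hw : w ∈ Ω) : ψ w ∈ uhp := by
  rw [← h.img] at hw
  obtain ⟨z, hz, rfl⟩ := hw
  rwa [h.left z hz]

theorem right (h : ConformalUHP f ψ Ω) {w : ℂ} (hw : w ∈ Ω) : f (ψ w) = w := by
  rw [← h.img] at hw
  obtain ⟨z, hz, rfl⟩ := hw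
  rw [h.left z hz]

theorem hasDerivAt_inv (h : ConformalUHP f ψ Ω) {q : ℂ} (hq : q ∈ uhp) :
    HasDerivAt ψ (deriv f q)⁻¹ (f q) :=
  hasDerivAt_leftInverse isOpen_uhp h.diff h.left hq

theorem diff_inv (h : ConformalUHP f ψ Ω) : DifferentiableOn ℂ ψ Ω := by
  intro w hw
  have := (h.hasDerivAt_inv (h.map_mem hw)).differentiableAt
  rw [h.right hw] at this
  exact this.differentiableWithinAt

theorem not_mem (h : ConformalUHP f ψ Ω) {x : ℂ} (hx : x ∈ frontier Ω) : x ∉ f '' uhp := by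
  rw [h.img]; exact fun h2 => disjoint_left.1 h.isOpen.disjoint_frontier h2 hx

theorem pos (h : ConformalUHP f ψ Ω) {w : ℂ} (hw : w ∈ Ω) : 0 < infDist w (frontier Ω) :=
  (isClosed_frontier.notMem_iff_infDist_pos h.ne).1
    fun h2 => disjoint_left.1 h.isOpen.disjoint_frontier hw h2

theorem exists_nearest (h : ConformalUHP f ψ Ω) (w : ℂ) :
    ∃ x ∈ frontier Ω, dist w x = infDist w (frontier Ω) := by
  obtain ⟨x, hx, e⟩ := isClosed_frontier.exists_infDist_eq_dist h.ne w
  exact ⟨x, hx, e.symm⟩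

theorem ball_subset (h : ConformalUHP f ψ Ω) {w : ℂ} (hw : w ∈ Ω) :
    ball w (infDist w (frontier Ω)) ⊆ Ω := ball_infDist_frontier_subset h.isOpen hw

theorem koebe (h : ConformalUHP f ψ Ω) {q : ℂ} (hq : q ∈ uhp) :
    q.im * ‖deriv f q‖ ≤ 96 * Real.pi * infDist (f q) (frontier Ω) := by
  obtain ⟨x, hx, e⟩ := h.exists_nearest (f q)
  rw [← e, dist_eq_norm]
  exact im_mul_norm_deriv_le h.diff h.injOn (h.not_mem hx) hq

theorem harnack_dist (h : ConformalUHP f ψ Ω) {x p q : ℂ} (hx : x ∈ frontier Ω) {m : ℝ}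
    (hm : 0 < m) (hp : m ≤ p.im) (hq : m ≤ q.im) :
    dist (f p) x ≤ Real.exp (96 * Real.pi * dist p q / m) * dist (f q) x := by
  rw [dist_eq_norm (f p), dist_eq_norm (f q)]
  exact norm_sub_le_exp_mul h.diff h.injOn (h.not_mem hx) hm hp hq

theorem harnack (h : ConformalUHP f ψ Ω) {p q : ℂ} {m : ℝ} (hm : 0 < m) (hp : m ≤ p.im)
    (hq : m ≤ q.im) : infDist (f p) (frontier Ω) ≤
      Real.exp (96 * Real.pi * dist p q / m) * infDist (f q) (frontier Ω) := by
  obtain ⟨x, hx, e⟩ := h.exists_nearest (f q)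
  rw [← e]
  exact (infDist_le_dist_of_mem hx).trans (h.harnack_dist hx hm hp hq)

theorem sub_conj_ne {z q : ℂ} (hz : z ∈ uhp) (hq : q ∈ uhp) :
    z - (starRingEnd ℂ) q ≠ 0 := by
  intro h0
  have := congrArg Complex.im h0
  rw [mem_uhp] at hz hq
  simp at this
  linarith

theorem norm_sub_lt_norm_sub_conj {z q : ℂ} (hz : z ∈ uhp) (hq : q ∈ uhp) :
    ‖z - q‖ < ‖z - (starRingEnd ℂ) q‖ := by
  rw [mem_uhp] at hz hq
  rw [Complex.norm_def, Complex.norm_def]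
  refine Real.sqrt_lt_sqrt (Complex.normSq_nonneg _) ?_
  rw [Complex.normSq_apply, Complex.normSq_apply]
  simp
  nlinarith [mul_pos hz hq]

theorem schwarz_aux (h : ConformalUHP f ψ Ω) {q : ℂ} (hq : q ∈ uhp) :
    let g : ℂ → ℂ := fun w => (ψ w - q) / (ψ w - (starRingEnd ℂ) q)
    DifferentiableOn ℂ g (ball (f q) (infDist (f q) (frontier Ω))) ∧
    MapsTo g (ball (f q) (infDist (f q) (frontier Ω))) (closedBall (g (f q)) 1) ∧
    g (f q) = 0 := by
  intro g
  have hsub := h.ball_subset (h.mem hq)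
  have hg0 : g (f q) = 0 := by simp [g, h.left q hq]
  refine ⟨?_, ?_, hg0⟩
  · have hd := h.diff_inv.mono hsub
    exact (hd.sub_const q).div (hd.sub_const _) fun w hw => sub_conj_ne (h.map_mem (hsub hw)) hq
  · intro w hw
    rw [hg0, mem_closedBall_zero_iff, norm_div]
    have hw' := h.map_mem (hsub hw)
    exact div_le_one_of_le₀ (norm_sub_lt_norm_sub_conj hw' hq).le (norm_nonneg _)

theorem schwarz (h : ConformalUHP f ψ Ω) {q w : ℂ} (hq : q ∈ uhp)
    (hw : dist w (f q) < infDist (f q) (frontier Ω)) :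
    dist (ψ w) q * (infDist (f q) (frontier Ω) - dist w (f q)) ≤ 2 * q.im * dist w (f q) := by
  obtain ⟨h1, h2, h3⟩ := h.schwarz_aux hq
  set g : ℂ → ℂ := fun w => (ψ w - q) / (ψ w - (starRingEnd ℂ) q) with hg
  have hwb : w ∈ ball (f q) (infDist (f q) (frontier Ω)) := hw
  have h4 := Complex.dist_le_div_mul_dist_of_mapsTo_ball h1 h2 hwb
  have hd0 := h.pos (h.mem hq)
  have hw' := h.map_mem (h.ball_subset (h.mem hq) hwb)
  rw [h3, dist_zero_right, hg] at h4
  simp only at h4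
  rw [norm_div, div_le_iff₀ (norm_pos_iff.2 (sub_conj_ne hw' hq))] at h4
  have h5 : ‖ψ w - (starRingEnd ℂ) q‖ ≤ ‖ψ w - q‖ + 2 * q.im := by
    have e : ψ w - (starRingEnd ℂ) q = (ψ w - q) + (2 * q.im : ℝ) * Complex.I := by
      apply Complex.ext <;> simp; ring
    rw [e]
    refine (norm_add_le _ _).trans ?_
    rw [norm_mul, Complex.norm_I, Complex.norm_real, Real.norm_of_nonneg
      (by rw [mem_uhp] at hq; positivity), mul_one]
  set d := infDist (f q) (frontier Ω) with hd
  rw [dist_eq_norm (ψ w)]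
  set e := dist w (f q)
  have he : 0 ≤ e := dist_nonneg
  have h6 : ‖ψ w - q‖ * d ≤ e * (‖ψ w - q‖ + 2 * q.im) := by
    calc ‖ψ w - q‖ * d ≤ 1 / d * e * ‖ψ w - (starRingEnd ℂ) q‖ * d := by gcongr
      _ = e * ‖ψ w - (starRingEnd ℂ) q‖ := by field_simp
      _ ≤ _ := by gcongr
  nlinarith

theorem le_deriv (h : ConformalUHP f ψ Ω) {q : ℂ} (hq : q ∈ uhp) :
    infDist (f q) (frontier Ω) ≤ 2 * q.im * ‖deriv f q‖ := by
  obtain ⟨h1, h2, h3⟩ := h.schwarz_aux hq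
  have hd0 := h.pos (h.mem hq)
  have h4 := Complex.norm_deriv_le_div_of_mapsTo_ball h1 h2 hd0
  have hψ := h.hasDerivAt_inv hq
  have hne : ψ (f q) - (starRingEnd ℂ) q ≠ 0 := by
    rw [h.left q hq]; exact sub_conj_ne hq hq
  have h5 := ((hψ.sub_const q).div (hψ.sub_const ((starRingEnd ℂ) q)) hne).deriv
  have h6 : deriv (fun w => (ψ w - q) / (ψ w - (starRingEnd ℂ) q)) (f q) =
      (deriv f q)⁻¹ / (q - (starRingEnd ℂ) q) := by
    refine h5.trans ?_
    rw [h.left q hq] at hne ⊢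
    field_simp
    ring
  rw [h6, norm_div, norm_inv, Complex.sub_conj, norm_mul, Complex.norm_I, mul_one,
    Complex.norm_real, Real.norm_of_nonneg (by rw [mem_uhp] at hq; positivity)] at h4
  have hne' := deriv_ne_zero_of_injOn isOpen_uhp h.diff h.injOn hq
  have hn : 0 < ‖deriv f q‖ := norm_pos_iff.2 hne'
  have hq' : 0 < q.im := hq
  rw [div_le_div_iff₀ (by positivity) hd0, inv_mul_le_iff₀ hn] at h4
  linarith

theorem isBounded (h : ConformalUHP f ψ Ω) (hb : Bornology.IsBounded (frontier Ω)) :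
    Bornology.IsBounded Ω := by
  obtain ⟨x, hx⟩ := h.ne
  obtain ⟨R, hR0, hR⟩ := hb.subset_ball_lt 0 x
  rw [isBounded_iff_subset_ball x]
  refine ⟨R, ?_⟩
  by_contra hcon
  obtain ⟨w, hw, hwR⟩ := not_subset.1 hcon
  rw [mem_ball, not_lt] at hwR
  set s := dist w x with hs
  have hs0 : 0 < s := hR0.trans_le hwR
  have hsph : sphere x s ⊆ Ω := by
    refine IsPreconnected.subset_of_disjoint_frontier
      (isPreconnected_sphere (by rw [Complex.rank_real_complex]; norm_num) x s) h.isOpen ?_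
      ⟨w, hs.symm, hw⟩
    intro z hz hzf
    have h1 := hR hzf
    rw [mem_sphere] at hz
    rw [mem_ball, hz] at h1
    linarith
  have hnx := h.not_mem hx
  obtain ⟨l, hl, hle⟩ := exists_differentiableOn_log isOpen_uhp convex_uhp
    ⟨Complex.I, by simp [mem_uhp]⟩ (h.diff.sub_const x)
    (fun z hz h0 => hnx ⟨z, hz, sub_eq_zero.1 h0⟩)
  have hlψ : ContinuousOn (fun w => l (ψ w)) Ω :=
    hl.continuousOn.comp h.diff_inv.continuousOn fun w hw => h.map_mem hw
  have hc : Continuous fun t : ℝ => x + s * Complex.exp (t * Complex.I) := by fun_prop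
  have hmem : ∀ t : ℝ, x + s * Complex.exp (t * Complex.I) ∈ Ω := by
    intro t
    apply hsph
    rw [mem_sphere, dist_eq_norm, add_sub_cancel_left, norm_mul,
          Complex.norm_exp_ofReal_mul_I, mul_one, Complex.norm_real, Real.norm_of_nonneg hs0.le]
  have hc1 : Continuous fun t : ℝ => l (ψ (x + s * Complex.exp (t * Complex.I))) :=
    hlψ.comp_continuous hc hmem
  have hc2 : Continuous fun t : ℝ => ((Real.log s : ℂ) + t * Complex.I) := by fun_prop
  have key := eq_add_of_exp_eq (S := (univ : Set ℝ)) isPreconnected_univ hc1.continuousOn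
    hc2.continuousOn (by
      intro t _
      have hm := hmem t
      rw [hle _ (h.map_mem hm), h.right hm, Complex.exp_add, ← Complex.ofReal_exp,
        Real.exp_log hs0]
      ring) (mem_univ 0) (mem_univ (2 * Real.pi))
  have h6 : Complex.exp ((2 * Real.pi : ℝ) * Complex.I) = Complex.exp ((0 : ℝ) * Complex.I) := by
    push_cast; rw [Complex.exp_two_pi_mul_I]; simp
  rw [h6] at key
  have h7 := add_left_cancel (sub_right_inj.1 key)
  have h8 : ((2 * Real.pi : ℝ) : ℂ) * Complex.I = 0 := by rw [← h7]; simp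
  simp at h8

end ConformalUHP

/-! ### The length–area estimate -/

theorem det_restrictScalars_toSpanSingleton (c : ℂ) :
    |(((ContinuousLinearMap.toSpanSingleton ℂ c).restrictScalars ℝ)).det| = ‖c‖ ^ 2 := by
  rw [ContinuousLinearMap.det]
  have : ((ContinuousLinearMap.toSpanSingleton ℂ c).restrictScalars ℝ : ℂ →ₗ[ℝ] ℂ) =
    ((ContinuousLinearMap.toSpanSingleton ℂ c : ℂ →ₗ[ℂ] ℂ)).restrictScalars ℝ := rfl
  rw [this, LinearMap.det_restrictScalars, Algebra.norm_complex_eq]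
  have h2 : LinearMap.det (ContinuousLinearMap.toSpanSingleton ℂ c : ℂ →ₗ[ℂ] ℂ) = c :=
    ContinuousLinearMap.det_toSpanSingleton c
  rw [h2]
  simp [Complex.normSq_eq_norm_sq]

theorem lintegral_image_holomorphic {G : ℂ → ℂ} {S : Set ℂ} (hS : MeasurableSet S)
    (hG : ∀ z ∈ S, DifferentiableAt ℂ G z) (hinj : InjOn G S) (g : ℂ → ℝ≥0∞) :
    ∫⁻ w in G '' S, g w = ∫⁻ z in S, ENNReal.ofReal (‖deriv G z‖ ^ 2) * g (G z) := by
  rw [lintegral_image_eq_lintegral_abs_det_fderiv_mul volume hS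
    (fun z hz => ((hG z hz).hasDerivAt.hasFDerivAt.restrictScalars ℝ).hasFDerivWithinAt) hinj]
  simp only [det_restrictScalars_toSpanSingleton]

theorem volume_reProdIm (s t : Set ℝ) :
    volume {z : ℂ | z.re ∈ s ∧ z.im ∈ t} = volume s * volume t := by
  have := Complex.volume_preserving_equiv_real_prod.measure_preimage_equiv (s ×ˢ t)
  rw [Measure.volume_eq_prod, Measure.prod_prod] at this
  rw [← this]
  rfl

theorem volume_le_of_injOn_exp {A : Set ℂ} (hA : MeasurableSet A)
    (hinj : InjOn Complex.exp A) {α β : ℝ} (hsub : ∀ z ∈ A, α < z.re ∧ z.re < β) :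
    volume A ≤ ENNReal.ofReal (β - α) * ENNReal.ofReal (2 * Real.pi) := by
  have key : ∀ B : Set ℂ, MeasurableSet B → InjOn Complex.exp B →
      ∫⁻ w in Complex.exp '' B, ENNReal.ofReal (1 / ‖w‖ ^ 2) = volume B := by
    intro B hB hBi
    rw [lintegral_image_holomorphic hB (fun z _ => Complex.differentiableAt_exp) hBi]
    rw [← setLIntegral_one]
    refine setLIntegral_congr_fun hB fun z _ => ?_
    simp only [Complex.deriv_exp]
    rw [← ENNReal.ofReal_mul (by positivity), mul_one_div_cancel, ENNReal.ofReal_one]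
    have : 0 < ‖Complex.exp z‖ := norm_pos_iff.2 (Complex.exp_ne_zero z)
    positivity
  set B : Set ℂ := {z : ℂ | z.re ∈ Ioo α β ∧ z.im ∈ Ioc (-Real.pi) Real.pi} with hB
  have hBm : MeasurableSet B :=
    (Complex.measurable_re measurableSet_Ioo).inter (Complex.measurable_im measurableSet_Ioc)
  have hBi : InjOn Complex.exp B := by
    intro z hz w hw h
    rw [← Complex.log_exp hz.2.1 hz.2.2, h, Complex.log_exp hw.2.1 hw.2.2]
  have hAB : Complex.exp '' A ⊆ Complex.exp '' B := by
    rintro _ ⟨z, hz, rfl⟩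
    refine ⟨Complex.log (Complex.exp z), ⟨?_, Complex.neg_pi_lt_log_im _, Complex.log_im_le_pi _⟩,
      Complex.exp_log (Complex.exp_ne_zero z)⟩
    rw [Complex.log_re, Complex.norm_exp, Real.log_exp]
    exact hsub z hz
  calc volume A = _ := (key A hA hinj).symm
    _ ≤ _ := lintegral_mono_set hAB
    _ = volume B := key B hBm hBi
    _ = _ := by
      rw [hB, volume_reProdIm, Real.volume_Ioo, Real.volume_Ioc]
      ring_nf

theorem ofReal_le_lintegral_deriv {u u' : ℝ → ℝ} {I : Set ℝ} (hI : IsOpen I)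
    (hIc : IsPreconnected I) (hu : ∀ t ∈ I, HasDerivAt u (u' t) t) {α β : ℝ} {s t : ℝ}
    (hs : s ∈ I) (ht : t ∈ I) (hus : u s ≤ α) (hut : β ≤ u t) :
    ENNReal.ofReal (β - α) ≤ ∫⁻ θ in {θ ∈ I | α < u θ ∧ u θ < β}, ENNReal.ofReal |u' θ| := by
  have hc : ContinuousOn u I := fun t ht => (hu t ht).continuousAt.continuousWithinAt
  have hmeas : MeasurableSet {θ ∈ I | α < u θ ∧ u θ < β} :=
    (hc.isOpen_inter_preimage hI isOpen_Ioo).measurableSet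
  have h1 := addHaar_image_le_lintegral_abs_det_fderiv volume hmeas
    (fun θ hθ => (hu θ hθ.1).hasFDerivAt.hasFDerivWithinAt)
  simp only [ContinuousLinearMap.det_toSpanSingleton] at h1
  refine le_trans ?_ h1
  rw [← Real.volume_Ioo]
  refine measure_mono ?_
  intro v hv
  obtain ⟨θ, hθ, rfl⟩ := hIc.intermediate_value hs ht hc ⟨hus.trans hv.1.le, hv.2.le.trans hut⟩
  exact ⟨θ, ⟨hθ, hv⟩, rfl⟩

/-- Length–area estimate on a strip. -/
theorem mul_le_of_strip {G : ℂ → ℂ} {α β s1 s2 : ℝ} (hαβ : α < β) (hs : s1 < s2)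
    (hG : DifferentiableOn ℂ G {z | 0 < z.im ∧ z.im < Real.pi})
    (hinj : InjOn (fun z => Complex.exp (G z)) {z | 0 < z.im ∧ z.im < Real.pi})
    (hcr : ∀ s ∈ Ioo s1 s2, (∃ θ ∈ Ioo 0 Real.pi, (G (s + θ * Complex.I)).re ≤ α) ∧
      ∃ θ ∈ Ioo 0 Real.pi, β ≤ (G (s + θ * Complex.I)).re) :
    (β - α) * (s2 - s1) ≤ 2 * Real.pi ^ 2 := by
  have hpi := Real.pi_pos
  set U : Set ℂ := {z | 0 < z.im ∧ z.im < Real.pi} with hU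
  have hUo : IsOpen U := (isOpen_lt continuous_const Complex.continuous_im).inter
    (isOpen_lt Complex.continuous_im continuous_const)
  have hUo2 : IsOpen (U ∩ {z : ℂ | z.re ∈ Ioo s1 s2}) :=
    hUo.inter (isOpen_Ioo.preimage Complex.continuous_re)
  set S : Set ℂ := (U ∩ {z : ℂ | z.re ∈ Ioo s1 s2}) ∩ G ⁻¹' {w | w.re ∈ Ioo α β} with hS
  have hSo : IsOpen S := (hG.continuousOn.mono inter_subset_left).isOpen_inter_preimage hUo2
    (isOpen_Ioo.preimage Complex.continuous_re)
  have hSU : S ⊆ U := fun z hz => hz.1.1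
  have hGd : ∀ z ∈ U, DifferentiableAt ℂ G z := fun z hz => hG.differentiableAt (hUo.mem_nhds hz)
  have hGinj : InjOn G S := fun a ha b hb e => hinj (hSU ha) (hSU hb) (by simp only [e])
  have hGS : IsOpen (G '' S) := isOpen_image_of_injOn hSo (hG.mono hSU) hGinj hSo Subset.rfl
  have harea : ∫⁻ z in S, ENNReal.ofReal (‖deriv G z‖ ^ 2) ≤
      ENNReal.ofReal (β - α) * ENNReal.ofReal (2 * Real.pi) := by
    have h1 := lintegral_image_holomorphic hSo.measurableSet (fun z hz => hGd z (hSU hz)) hGinj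
      (fun _ => 1)
    simp only [mul_one, lintegral_const, one_mul, Measure.restrict_apply_univ] at h1
    rw [← h1]
    refine volume_le_of_injOn_exp hGS.measurableSet ?_ ?_
    · rintro _ ⟨a, ha, rfl⟩ _ ⟨b, hb, rfl⟩ e
      rw [hinj (hSU ha) (hSU hb) e]
    · rintro _ ⟨a, ha, rfl⟩
      exact ha.2
  have hvolS : volume S ≤ ENNReal.ofReal (s2 - s1) * ENNReal.ofReal Real.pi := by
    have : S ⊆ {z : ℂ | z.re ∈ Ioo s1 s2 ∧ z.im ∈ Ioo 0 Real.pi} := fun z hz => ⟨hz.1.2, hz.1.1⟩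
    refine (measure_mono this).trans ?_
    rw [volume_reProdIm, Real.volume_Ioo, Real.volume_Ioo, sub_zero]
  set t : ℝ := (s2 - s1) / (2 * Real.pi) with ht
  have hs' : 0 < s2 - s1 := by linarith
  have ht0 : 0 < t := by positivity
  set F : ℂ → ℝ≥0∞ := S.indicator fun z => ENNReal.ofReal (t / 2) *
    ENNReal.ofReal (‖deriv G z‖ ^ 2) + ENNReal.ofReal (1 / (2 * t)) with hF
  have hm1 : Measurable fun z : ℂ => ENNReal.ofReal (‖deriv G z‖ ^ 2) :=
    ((measurable_deriv G).norm.pow_const 2).ennreal_ofReal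
  have hFm : Measurable F :=
    ((hm1.const_mul _).add_const _).indicator hSo.measurableSet
  have hline : ∀ s ∈ Ioo s1 s2, ENNReal.ofReal (β - α) ≤ ∫⁻ θ : ℝ, F (s + θ * Complex.I) := by
    intro s hs
    obtain ⟨⟨θ1, hθ1, h1⟩, θ2, hθ2, h2⟩ := hcr s hs
    have hUm : ∀ θ ∈ Ioo 0 Real.pi, (s + θ * Complex.I : ℂ) ∈ U := by
      intro θ hθ; simpa [hU] using hθ
    have hder : ∀ θ ∈ Ioo 0 Real.pi, HasDerivAt (fun θ : ℝ => (G (s + θ * Complex.I)).re)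
        ((deriv G (s + θ * Complex.I) * Complex.I).re) θ := by
      intro θ hθ
      have h3 : HasDerivAt (fun θ : ℂ => G (s + θ * Complex.I))
          (deriv G (s + θ * Complex.I) * Complex.I) (θ : ℂ) := by
        have h4 : HasDerivAt (fun θ : ℂ => (s + θ * Complex.I : ℂ)) Complex.I (θ : ℂ) := by
          simpa using ((hasDerivAt_id (θ : ℂ)).mul_const Complex.I).const_add (s : ℂ)
        exact HasDerivAt.comp (θ : ℂ) (hGd _ (hUm θ hθ)).hasDerivAt h4
      exact h3.real_of_complex
    refine (ofReal_le_lintegral_deriv isOpen_Ioo isPreconnected_Ioo hder hθ1 hθ2 h1 h2).trans ?_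
    have hmT : MeasurableSet {θ ∈ Ioo 0 Real.pi | α < (G (s + θ * Complex.I)).re ∧
        (G (s + θ * Complex.I)).re < β} := by
      have hc : ContinuousOn (fun θ : ℝ => (G (s + θ * Complex.I)).re) (Ioo 0 Real.pi) :=
        fun t ht => (hder t ht).continuousAt.continuousWithinAt
      exact (hc.isOpen_inter_preimage isOpen_Ioo isOpen_Ioo).measurableSet
    rw [← lintegral_indicator hmT]
    refine lintegral_mono fun θ => ?_
    by_cases hθ : θ ∈ {θ ∈ Ioo 0 Real.pi | α < (G (s + θ * Complex.I)).re ∧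
        (G (s + θ * Complex.I)).re < β}
    · have hmem : (s + θ * Complex.I : ℂ) ∈ S :=
        ⟨⟨hUm θ hθ.1, by simpa using hs⟩, hθ.2⟩
      rw [indicator_of_mem hθ, hF, indicator_of_mem hmem, ← ENNReal.ofReal_mul (by positivity),
        ← ENNReal.ofReal_add (by positivity) (by positivity)]
      refine ENNReal.ofReal_le_ofReal ?_
      set g := ‖deriv G (s + θ * Complex.I)‖ with hg
      have h5 : |(deriv G (s + θ * Complex.I) * Complex.I).re| ≤ g := by
        refine (Complex.abs_re_le_norm _).trans ?_
        rw [norm_mul, Complex.norm_I, mul_one]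
      refine h5.trans ?_
      have h6 : 0 ≤ (t * g - 1) ^ 2 / (2 * t) := by positivity
      have h7 : (t * g - 1) ^ 2 / (2 * t) = t / 2 * g ^ 2 + 1 / (2 * t) - g := by
        field_simp; ring
      linarith
    · rw [indicator_of_notMem hθ]; exact zero_le
  have hfub : ∫⁻ z, F z = ∫⁻ s : ℝ, ∫⁻ θ : ℝ, F (s + θ * Complex.I) := by
    rw [← Complex.volume_preserving_equiv_real_prod.symm.lintegral_comp_emb
      Complex.measurableEquivRealProd.symm.measurableEmbedding, Measure.volume_eq_prod,
      lintegral_prod _ (by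
        exact (hFm.comp Complex.measurableEquivRealProd.symm.measurable).aemeasurable)]
    refine lintegral_congr fun s => lintegral_congr fun θ => ?_
    congr 1
    apply Complex.ext <;> simp
  have hlow : ENNReal.ofReal (β - α) * ENNReal.ofReal (s2 - s1) ≤ ∫⁻ z, F z := by
    rw [hfub]
    calc ENNReal.ofReal (β - α) * ENNReal.ofReal (s2 - s1)
        = ∫⁻ _ in Ioo s1 s2, ENNReal.ofReal (β - α) := by
          rw [setLIntegral_const, Real.volume_Ioo]
      _ ≤ ∫⁻ s in Ioo s1 s2, ∫⁻ θ : ℝ, F (s + θ * Complex.I) :=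
          setLIntegral_mono' measurableSet_Ioo hline
      _ ≤ _ := setLIntegral_le_lintegral _ _
  have hup : ∫⁻ z, F z ≤ ENNReal.ofReal (t / 2) *
      (ENNReal.ofReal (β - α) * ENNReal.ofReal (2 * Real.pi)) +
      ENNReal.ofReal (1 / (2 * t)) * (ENNReal.ofReal (s2 - s1) * ENNReal.ofReal Real.pi) := by
    rw [hF, lintegral_indicator hSo.measurableSet, lintegral_add_right _ measurable_const,
      lintegral_const_mul _ hm1, setLIntegral_const]
    gcongr
  have hfin := hlow.trans hup
  have hαβ' : 0 < β - α := by linarith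
  rw [← ENNReal.ofReal_mul (by positivity), ← ENNReal.ofReal_mul (by positivity),
    ← ENNReal.ofReal_mul (by positivity), ← ENNReal.ofReal_mul (by positivity),
    ← ENNReal.ofReal_mul (by positivity), ← ENNReal.ofReal_add (by positivity) (by positivity),
    ENNReal.ofReal_le_ofReal_iff (by positivity)] at hfin
  have e1 : t / 2 * ((β - α) * (2 * Real.pi)) = (β - α) * (s2 - s1) / 2 := by
    rw [ht]; field_simp
  have e2 : 1 / (2 * t) * ((s2 - s1) * Real.pi) = Real.pi ^ 2 := by
    rw [ht]; field_simp
  rw [e1, e2] at hfin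
  linarith

/-- Length–area estimate on semicircles. -/
theorem ConformalUHP.length_area {f ψ : ℂ → ℂ} {Ω : Set ℂ} (h : ConformalUHP f ψ Ω) {x : ℂ}
    (hx : x ∈ frontier Ω) (x0 : ℝ) {a b ρ1 ρ2 : ℝ} (ha : 0 < a) (hab : a < b) (hρ1 : 0 < ρ1)
    (hρ : ρ1 < ρ2)
    (hcr : ∀ ρ ∈ Ioo ρ1 ρ2, (∃ z ∈ uhp, dist z x0 = ρ ∧ dist (f z) x ≤ a) ∧
      ∃ z ∈ uhp, dist z x0 = ρ ∧ b ≤ dist (f z) x) :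
    Real.log (b / a) * Real.log (ρ2 / ρ1) ≤ 2 * Real.pi ^ 2 := by
  have hnx := h.not_mem hx
  obtain ⟨l, hl, hle⟩ := exists_differentiableOn_log isOpen_uhp convex_uhp
    ⟨Complex.I, by simp [mem_uhp]⟩ (h.diff.sub_const x)
    (fun z hz h0 => hnx ⟨z, hz, sub_eq_zero.1 h0⟩)
  have hmaps : ∀ z ∈ {z : ℂ | 0 < z.im ∧ z.im < Real.pi}, (x0 : ℂ) + Complex.exp z ∈ uhp := by
    intro z hz
    rw [mem_uhp, Complex.add_im, Complex.ofReal_im, zero_add, Complex.exp_im]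
    exact mul_pos (Real.exp_pos _) (Real.sin_pos_of_pos_of_lt_pi hz.1 hz.2)
  have hre : ∀ z ∈ uhp, (l z).re = Real.log (dist (f z) x) := by
    intro z hz
    rw [dist_eq_norm, ← hle z hz, Complex.norm_exp, Real.log_exp]
  have hpt : ∀ z ∈ uhp, ∀ ρ, 0 < ρ → dist z x0 = ρ → ∃ θ ∈ Ioo 0 Real.pi,
      (x0 : ℂ) + Complex.exp ((Real.log ρ : ℝ) + θ * Complex.I) = z := by
    intro z hz ρ hρ e
    have hz0 : z - x0 ≠ 0 := by rw [← norm_pos_iff, ← dist_eq_norm, e]; exact hρ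
    have hzi : 0 < (z - x0).im := by rw [mem_uhp] at hz; simpa using hz
    refine ⟨(z - x0).arg, ⟨?_, ?_⟩, ?_⟩
    · refine lt_of_le_of_ne (Complex.arg_nonneg_iff.2 hzi.le) fun h0 => ?_
      have := (Complex.arg_eq_zero_iff.1 h0.symm).2
      linarith
    · refine lt_of_le_of_ne (Complex.arg_le_pi _) fun h0 => ?_
      have := (Complex.arg_eq_pi_iff.1 h0).2
      linarith
    · rw [← e, dist_eq_norm]
      have : ((Real.log ‖z - x0‖ : ℝ) : ℂ) + (z - x0).arg * Complex.I = Complex.log (z - x0) := rfl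
      rw [this, Complex.exp_log hz0]; ring
  have hb : 0 < b := ha.trans hab
  have hρ2 : 0 < ρ2 := hρ1.trans hρ
  rw [Real.log_div hb.ne' ha.ne', Real.log_div hρ2.ne' hρ1.ne']
  refine mul_le_of_strip (G := fun z => l (x0 + Complex.exp z)) (Real.log_lt_log ha hab)
    (Real.log_lt_log hρ1 hρ) ?_ ?_ ?_
  · exact hl.comp (by fun_prop) hmaps
  · intro z hz w hw e
    simp only [hle _ (hmaps z hz), hle _ (hmaps w hw), sub_left_inj] at e
    have e2 := add_left_cancel (h.injOn (hmaps z hz) (hmaps w hw) e)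
    rw [← Complex.log_exp (by linarith [hz.1, Real.pi_pos]) hz.2.le, e2,
      Complex.log_exp (by linarith [hw.1, Real.pi_pos]) hw.2.le]
  · intro s hs
    have hρs : Real.exp s ∈ Ioo ρ1 ρ2 :=
      ⟨(Real.log_lt_iff_lt_exp hρ1).1 hs.1, (Real.lt_log_iff_exp_lt hρ2).1 hs.2⟩
    obtain ⟨⟨z, hz, hzd, hza⟩, w, hw, hwd, hwb⟩ := hcr _ hρs
    constructor
    · obtain ⟨θ, hθ, e⟩ := hpt z hz _ (Real.exp_pos s) hzd
      rw [Real.log_exp] at e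
      refine ⟨θ, hθ, ?_⟩
      rw [e, hre z hz]
      refine Real.log_le_log ?_ hza
      rw [dist_pos]
      exact fun h0 => hnx ⟨z, hz, h0⟩
    · obtain ⟨θ, hθ, e⟩ := hpt w hw _ (Real.exp_pos s) hwd
      rw [Real.log_exp] at e
      refine ⟨θ, hθ, ?_⟩
      rw [e, hre w hw]
      exact Real.log_le_log hb hwb

/-! ### Quasi-invariant estimates in Carleson boxes -/

/-- A conformal map of the half-plane onto a bounded Jordan domain of bounded turning, normalised
so that `f i` has distance at least `d₀` to the boundary. -/
structure NormalizedUHP (C d₀ D : ℝ) (f ψ : ℂ → ℂ) (Ω : Set ℂ) : Prop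
    extends ConformalUHP f ψ Ω where
  jordan : IsJordanCurve (frontier Ω)
  turning : BoundedTurning (frontier Ω) C
  base : d₀ ≤ infDist (f Complex.I) (frontier Ω)
  diam : ∀ a ∈ Ω, ∀ b ∈ Ω, dist a b ≤ D

theorem exists_mem_dist_eq {V : Set ℂ} (hV : IsPreconnected V) {p q x : ℂ} (hp : p ∈ V)
    (hq : q ∈ V) {ρ : ℝ} (h1 : dist p x ≤ ρ) (h2 : ρ ≤ dist q x) : ∃ z ∈ V, dist z x = ρ := by
  obtain ⟨z, hz, e⟩ := hV.intermediate_value hp hq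
    (continuous_id.dist continuous_const).continuousOn ⟨h1, h2⟩
  exact ⟨z, hz, e⟩

theorem im_add_mul_I (x y : ℝ) : ((x : ℂ) + y * Complex.I).im = y := by simp

theorem mem_uhp_add_mul_I {x y : ℝ} (hy : 0 < y) : (x : ℂ) + y * Complex.I ∈ uhp := by
  rw [mem_uhp, im_add_mul_I]; exact hy

theorem dist_add_mul_I (x y y' : ℝ) :
    dist ((x : ℂ) + y * Complex.I) (x + y' * Complex.I) = |y - y'| := by
  rw [dist_eq_norm, show (x : ℂ) + y * Complex.I - (x + y' * Complex.I) =
    ((y - y' : ℝ) : ℂ) * Complex.I by push_cast; ring, norm_mul, Complex.norm_I, mul_one,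
    Complex.norm_real, Real.norm_eq_abs]

theorem dist_add_mul_I_ofReal {x y : ℝ} (hy : 0 ≤ y) :
    dist ((x : ℂ) + y * Complex.I) x = y := by
  rw [dist_eq_norm, add_sub_cancel_left, norm_mul, Complex.norm_I, mul_one, Complex.norm_real,
    Real.norm_of_nonneg hy]

theorem one_le_dist_I (x : ℝ) : 1 ≤ dist Complex.I x := by
  rw [dist_eq_norm]
  have := Complex.abs_im_le_norm (Complex.I - x)
  simpa using this

/-- The distortion on a Carleson box is controlled by the distance to the boundary at its top. -/
theorem exists_box_bound {C d₀ D : ℝ} (hC : 1 ≤ C) (hd₀ : 0 < d₀) :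
    ∃ C₁, 1 ≤ C₁ ∧ ∀ f ψ Ω, NormalizedUHP C d₀ D f ψ Ω → ∀ x y : ℝ, 0 < y → y ≤ 1 / 8 →
      ∀ p ∈ uhp, dist p x < 2 * y → dist (f p) (f (x + y * Complex.I)) ≤
        C₁ * infDist (f (x + y * Complex.I)) (frontier Ω) := by
  set C3 := Real.exp (96 * Real.pi * 3) with hC3
  set C4 := 4 * C * (C3 * Real.exp (2 * Real.pi ^ 2 / Real.log 2)) with hC4
  have hlog2 : 0 < Real.log 2 := Real.log_pos (by norm_num)
  have hC30 : 0 < C3 := Real.exp_pos _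
  have hC40 : 0 < C4 := by positivity
  refine ⟨max (C4 + 1) (|D| * C4 / d₀), le_max_of_le_left (by linarith), ?_⟩
  intro f ψ Ω h x y hy hy8 p hp hpx
  set q : ℂ := x + y * Complex.I with hq
  have hqu : q ∈ uhp := mem_uhp_add_mul_I hy
  set d := infDist (f q) (frontier Ω) with hd
  have hd0 : 0 < d := h.pos (h.mem hqu)
  obtain ⟨X, hX, hXd⟩ := h.exists_nearest (f q)
  rw [← hd] at hXd
  have hIu : Complex.I ∈ uhp := by simp [mem_uhp]
  have key : ∀ T, 0 < T → T ≤ dist (f p) X → T ≤ dist (f Complex.I) X → T ≤ C4 * d := by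
    intro T hT hT1 hT2
    set r := T / (4 * C) with hr
    have hr0 : 0 < r := by positivity
    have hrT : 4 * C * r = T := by rw [hr]; field_simp
    obtain ⟨V, hVΩ, hVc, hpV, hIV, hVr⟩ := exists_connected_outside h.isOpen h.isPreconnected
      h.jordan.isCompact hC h.turning X hr0 (h.mem hp) (h.mem hIu) (by rw [hrT]; exact hT1)
      (by rw [hrT]; exact hT2)
    have hWc : IsPreconnected (ψ '' V) := hVc.image ψ (h.diff_inv.continuousOn.mono hVΩ)
    have hpW : p ∈ ψ '' V := ⟨f p, hpV, h.left p hp⟩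
    have hIW : Complex.I ∈ ψ '' V := ⟨_, hIV, h.left _ hIu⟩
    by_contra! hcon
    have hlt : C3 * d < r := by
      have h1 : 1 ≤ Real.exp (2 * Real.pi ^ 2 / Real.log 2) := Real.one_le_exp (by positivity)
      rw [← hrT, hC4] at hcon
      have h2 : 4 * C * (C3 * Real.exp (2 * Real.pi ^ 2 / Real.log 2) * d) < 4 * C * r := by
        linarith
      have h3 := lt_of_mul_lt_mul_left h2 (by positivity)
      calc C3 * d = C3 * 1 * d := by ring
        _ ≤ C3 * Real.exp (2 * Real.pi ^ 2 / Real.log 2) * d := by gcongr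
        _ < r := h3
    have hla := h.length_area hX x (a := C3 * d) (b := r) (ρ1 := 2 * y) (ρ2 := 4 * y)
      (by positivity) hlt (by positivity) (by linarith) (by
        intro ρ hρ
        have hρ0 : 0 < ρ := by linarith [hρ.1]
        constructor
        · refine ⟨x + ρ * Complex.I, mem_uhp_add_mul_I hρ0, dist_add_mul_I_ofReal hρ0.le, ?_⟩
          have h1 := h.harnack_dist hX hy (p := x + ρ * Complex.I) (q := q)
            (by rw [im_add_mul_I]; linarith [hρ.1]) (by rw [hq, im_add_mul_I])
          rw [hXd] at h1
          refine h1.trans ?_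
          gcongr
          rw [hC3]
          refine Real.exp_le_exp.2 ?_
          rw [mul_div_assoc]
          gcongr
          rw [div_le_iff₀ hy, hq, dist_add_mul_I, abs_of_nonneg (by linarith [hρ.1])]
          linarith [hρ.2]
        · obtain ⟨z, ⟨v, hv, rfl⟩, hzd⟩ := exists_mem_dist_eq hWc hpW hIW (x := x) (ρ := ρ)
            (by linarith [hρ.1]) (by linarith [hρ.2, one_le_dist_I x])
          refine ⟨ψ v, h.map_mem (hVΩ hv), hzd, ?_⟩
          rw [h.right (hVΩ hv)]
          exact (hVr v hv).le)
    have e1 : 4 * y / (2 * y) = 2 := by field_simp; norm_num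
    rw [e1, ← le_div_iff₀ hlog2] at hla
    have h4 := Real.exp_le_exp.2 hla
    rw [Real.exp_log (by positivity), div_le_iff₀ (by positivity)] at h4
    rw [← hrT, hC4] at hcon
    have h5 : 4 * C * r ≤ 4 * C * (Real.exp (2 * Real.pi ^ 2 / Real.log 2) * (C3 * d)) := by gcongr
    linarith
  have hnp : 0 < dist (f p) X := by
    rw [dist_pos]; exact fun h0 => h.not_mem hX ⟨p, hp, h0⟩
  have hnI : 0 < dist (f Complex.I) X := by
    rw [dist_pos]; exact fun h0 => h.not_mem hX ⟨_, hIu, h0⟩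
  rcases le_total (dist (f p) X) (dist (f Complex.I) X) with hle | hle
  · have h1 := key _ hnp le_rfl hle
    calc dist (f p) (f q) ≤ dist (f p) X + dist (f q) X := dist_triangle_right _ _ _
      _ ≤ C4 * d + d := by rw [hXd]; gcongr
      _ = (C4 + 1) * d := by ring
      _ ≤ _ := by gcongr; exact le_max_left _ _
  · have h1 := key _ hnI hle le_rfl
    have h2 : d₀ ≤ C4 * d := (h.base.trans (infDist_le_dist_of_mem hX)).trans h1
    calc dist (f p) (f q) ≤ D := h.diam _ (h.mem hp) _ (h.mem hqu)
      _ ≤ |D| := le_abs_self D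
      _ = |D| / d₀ * d₀ := by field_simp
      _ ≤ |D| / d₀ * (C4 * d) := by gcongr
      _ = |D| * C4 / d₀ * d := by ring
      _ ≤ _ := by gcongr; exact le_max_right _ _

/-- Finitely many disjoint discs of radius at least `s` in a disc of radius `t`. -/
theorem card_mul_sq_le_of_disjoint_balls {n : ℕ} {c : ℕ → ℂ} {r : ℕ → ℝ} {o : ℂ} {s t : ℝ}
    (hs : 0 ≤ s) (ht : 0 ≤ t) (hr : ∀ j < n, s ≤ r j)
    (hd : ∀ i < n, ∀ j < n, i ≠ j → Disjoint (ball (c i) (r i)) (ball (c j) (r j)))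
    (hsub : ∀ j < n, ball (c j) (r j) ⊆ closedBall o t) : n * s ^ 2 ≤ t ^ 2 := by
  have h1 : volume (⋃ j ∈ Finset.range n, ball (c j) (r j)) ≤ volume (closedBall o t) := by
    refine measure_mono (iUnion₂_subset fun j hj => hsub j (Finset.mem_range.1 hj))
  rw [measure_biUnion_finset] at h1
  · have h2 : ∑ j ∈ Finset.range n, ENNReal.ofReal s ^ 2 * NNReal.pi ≤
        ∑ j ∈ Finset.range n, volume (ball (c j) (r j)) := by
      refine Finset.sum_le_sum fun j hj => ?_
      rw [Complex.volume_ball]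
      gcongr
      exact hr j (Finset.mem_range.1 hj)
    have h3 := h2.trans h1
    rw [Complex.volume_closedBall, Finset.sum_const, Finset.card_range, nsmul_eq_mul,
      ← mul_assoc] at h3
    have hpi : (NNReal.pi : ℝ≥0∞) ≠ 0 := by
      simpa using NNReal.pi_ne_zero
    rw [ENNReal.mul_le_mul_iff_left hpi ENNReal.coe_ne_top, ← ENNReal.ofReal_natCast,
      ← ENNReal.ofReal_pow hs, ← ENNReal.ofReal_pow ht,
      ← ENNReal.ofReal_mul (by positivity), ENNReal.ofReal_le_ofReal_iff (by positivity)] at h3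
    exact h3
  · intro i hi j hj hij
    exact hd i (Finset.mem_range.1 hi) j (Finset.mem_range.1 hj) hij
  · exact fun _ _ => measurableSet_ball

theorem ConformalUHP.dist_le_of_mem_ball {f ψ : ℂ → ℂ} {Ω : Set ℂ} (h : ConformalUHP f ψ Ω)
    {q w : ℂ} (hq : q ∈ uhp) (hw : w ∈ ball (f q) (infDist (f q) (frontier Ω) / 9)) :
    dist (ψ w) q ≤ q.im / 4 := by
  have hδ := h.pos (h.mem hq)
  rw [mem_ball] at hw
  have h1 := h.schwarz hq (w := w) (by linarith)
  have hq0 : 0 < q.im := hq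
  have hd := dist_nonneg (x := ψ w) (y := q)
  set δ := infDist (f q) (frontier Ω)
  have h2 : dist (ψ w) q * (8 / 9 * δ) ≤ 2 * q.im * (δ / 9) := by
    calc _ ≤ dist (ψ w) q * (δ - dist w (f q)) := by gcongr; linarith
      _ ≤ _ := h1
      _ ≤ _ := by gcongr
  have h3 : dist (ψ w) q * δ ≤ q.im / 4 * δ := by nlinarith
  exact le_of_mul_le_mul_right h3 hδ

/-- The distance to the boundary decays along vertical lines. -/
theorem exists_decay {C d₀ D : ℝ} (hC : 1 ≤ C) (hd₀ : 0 < d₀) {ε : ℝ} (hε : 0 < ε) :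
    ∃ l : ℝ, 0 < l ∧ l < 1 ∧ ∀ f ψ Ω, NormalizedUHP C d₀ D f ψ Ω → ∀ x y ρ : ℝ, 0 < y →
      y ≤ l * ρ → ρ ≤ 1 / 8 → infDist (f (x + y * Complex.I)) (frontier Ω) ≤
        ε * infDist (f (x + ρ * Complex.I)) (frontier Ω) := by
  obtain ⟨C₁, hC₁, hbox⟩ := exists_box_bound (D := D) hC hd₀
  obtain ⟨J, hJ⟩ := exists_nat_gt ((9 * (C₁ + 1) * C₁ / ε) ^ 2)
  refine ⟨(1 / 2) ^ (J + 1), by positivity, pow_lt_one₀ (by norm_num) (by norm_num) (by simp), ?_⟩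
  intro f ψ Ω h x y ρ hy hyl hρ8
  have hρ : 0 < ρ := by
    by_contra! hcon
    have : (1 / 2 : ℝ) ^ (J + 1) * ρ ≤ 0 := mul_nonpos_of_nonneg_of_nonpos (by positivity) hcon
    linarith
  set s : ℕ → ℝ := fun j => (1 / 2) ^ j * ρ with hs
  have hs0 : ∀ j, 0 < s j := fun j => by positivity
  have hsρ : ∀ j, s j ≤ ρ := fun j => by
    have : (1 / 2 : ℝ) ^ j ≤ 1 := pow_le_one₀ (by norm_num) (by norm_num)
    calc s j ≤ 1 * ρ := by simp only [hs]; gcongr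
      _ = ρ := one_mul _
  have hanti : ∀ i j, i < j → s j ≤ s i / 2 := fun i j hij => by
    have h1 : (1 / 2 : ℝ) ^ j ≤ (1 / 2) ^ (i + 1) :=
      pow_le_pow_of_le_one (by norm_num) (by norm_num) hij
    calc s j ≤ (1 / 2) ^ (i + 1) * ρ := by simp only [hs]; gcongr
      _ = s i / 2 := by simp only [hs]; ring
  set z : ℕ → ℂ := fun j => x + s j * Complex.I with hz
  have hzu : ∀ j, z j ∈ uhp := fun j => mem_uhp_add_mul_I (hs0 j)
  have hzim : ∀ j, (z j).im = s j := fun j => im_add_mul_I _ _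
  set δ : ℂ → ℝ := fun p => infDist (f p) (frontier Ω) with hδ
  have hδ0 : ∀ p ∈ uhp, 0 < δ p := fun p hp => h.pos (h.mem hp)
  have hyu : (x : ℂ) + y * Complex.I ∈ uhp := mem_uhp_add_mul_I hy
  set δy := δ (x + y * Complex.I) with hδy
  have hδy0 : 0 < δy := hδ0 _ hyu
  have hle : ∀ j < J, δy / (9 * (C₁ + 1)) ≤ δ (z j) / 9 := by
    intro j hj
    have hys : y ≤ s j := by
      refine hyl.trans ?_
      simp only [hs]
      gcongr ?_ * ρ
      exact pow_le_pow_of_le_one (by norm_num) (by norm_num) (by omega)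
    have h1 := hbox f ψ Ω h x (s j) (hs0 j) ((hsρ j).trans hρ8) _ hyu
      (by rw [dist_add_mul_I_ofReal hy.le]; linarith [hs0 j])
    have h2 : δy ≤ δ (z j) + dist (f (x + y * Complex.I)) (f (z j)) :=
      infDist_le_infDist_add_dist
    rw [div_le_div_iff₀ (by positivity) (by norm_num)]
    have : δy ≤ (C₁ + 1) * δ (z j) := by linarith
    linarith
  have hψ : ∀ j, ∀ w ∈ ball (f (z j)) (δ (z j) / 9), w ∈ Ω ∧ dist (ψ w) (z j) ≤ s j / 4 := by
    intro j w hw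
    refine ⟨h.ball_subset (h.mem (hzu j)) (ball_subset_ball ?_ hw), ?_⟩
    · have := hδ0 _ (hzu j)
      simp only [hδ] at this ⊢
      linarith
    · rw [← hzim j]; exact h.dist_le_of_mem_ball (hzu j) hw
  have hdis : ∀ i j, i < j → Disjoint (ball (f (z i)) (δ (z i) / 9))
      (ball (f (z j)) (δ (z j) / 9)) := by
    intro i j hij
    rw [Set.disjoint_left]
    intro w hw1 hw2
    have h1 := (hψ i w hw1).2
    have h2 := (hψ j w hw2).2
    have h3 := dist_triangle_left (z i) (z j) (ψ w)
    rw [show dist (z i) (z j) = |s i - s j| from dist_add_mul_I _ _ _] at h3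
    have h4 := le_abs_self (s i - s j)
    have h5 := hanti i j hij
    linarith [hs0 i]
  have hz0 : z 0 = x + ρ * Complex.I := by simp [hz, hs]
  have key := card_mul_sq_le_of_disjoint_balls (n := J) (c := fun j => f (z j))
    (r := fun j => δ (z j) / 9) (o := f (z 0)) (s := δy / (9 * (C₁ + 1))) (t := C₁ * δ (z 0))
    (by positivity) (by have := hδ0 _ (hzu 0); positivity) hle
    (by
      intro i _ j _ hij
      rcases lt_or_gt_of_ne hij with hlt | hlt
      · exact hdis i j hlt
      · exact (hdis j i hlt).symm)
    (by
      intro j _ w hw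
      obtain ⟨hwΩ, hwd⟩ := hψ j w hw
      rw [mem_closedBall, hz0, ← h.right hwΩ]
      refine hbox f ψ Ω h x ρ hρ hρ8 _ (h.map_mem hwΩ) ?_
      have h1 := dist_triangle (ψ w) (z j) x
      rw [show dist (z j) x = s j from dist_add_mul_I_ofReal (hs0 j).le] at h1
      linarith [hsρ j])
  rw [← hz0]
  change δy ≤ ε * δ (z 0)
  have hz00 := hδ0 _ (hzu 0)
  by_contra! hcon
  have h1 : (9 * (C₁ + 1) * C₁ / ε) ^ 2 * (δy / (9 * (C₁ + 1))) ^ 2 ≤ (C₁ * δ (z 0)) ^ 2 :=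
    le_trans (by gcongr) key
  rw [← mul_pow, sq_le_sq₀ (by positivity) (by positivity)] at h1
  have h2 : 9 * (C₁ + 1) * C₁ / ε * (δy / (9 * (C₁ + 1))) = C₁ * (δy / ε) := by field_simp
  rw [h2] at h1
  have h3 := le_of_mul_le_mul_left h1 (by linarith)
  rw [div_le_iff₀ hε] at h3
  linarith

/-- A point whose image is close to the image of `x + i y`, relative to the distance to the
boundary there, is at distance comparable to `y` from `x`. -/
theorem exists_dist_le_of_dist_image_le {C d₀ D : ℝ} (hC : 1 ≤ C) (hd₀ : 0 < d₀) {D' : ℝ}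
    (hD' : 1 ≤ D') :
    ∃ L y₁ : ℝ, 1 ≤ L ∧ 0 < y₁ ∧ ∀ f ψ Ω, NormalizedUHP C d₀ D f ψ Ω → ∀ x y : ℝ, 0 < y →
      y ≤ y₁ → ∀ p ∈ uhp, dist (f p) (f (x + y * Complex.I)) ≤
        D' * infDist (f (x + y * Complex.I)) (frontier Ω) → dist p x ≤ L * y := by
  obtain ⟨l, hl0, hl1, hdec⟩ := exists_decay (D := D) hC hd₀ (ε := 1 / (10 * C * (D' + 2)))
    (by positivity)
  have hlog2 : 0 < Real.log 2 := Real.log_pos (by norm_num)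
  set E := Real.exp (2 * Real.pi ^ 2 / Real.log 2 + 1) with hE
  have hE1 : 1 < E := Real.one_lt_exp_iff.2 (by positivity)
  have hL : 1 ≤ 1 / l * E := by
    rw [one_div, ← div_eq_inv_mul, le_div_iff₀ hl0]; linarith
  have hL0 : 0 < 1 / l * E := by linarith
  refine ⟨1 / l * E, 1 / (8 * (1 / l * E)), hL, by positivity, ?_⟩
  intro f ψ Ω h x y hy hyy p hp hpd
  set q : ℂ := x + y * Complex.I with hq
  have hqu : q ∈ uhp := mem_uhp_add_mul_I hy
  set d := infDist (f q) (frontier Ω) with hd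
  have hd0 : 0 < d := h.pos (h.mem hqu)
  obtain ⟨X, hX, hXd⟩ := h.exists_nearest (f q)
  rw [← hd] at hXd
  by_contra! hcon
  have hr0 : 0 < (D' + 2) * d := by positivity
  obtain ⟨V, hVΩ, hVc, hpV, hqV, hVr⟩ := exists_connected_inside h.isOpen h.isPreconnected
    h.jordan hC h.turning X hr0 (h.mem hp) (h.mem hqu)
    (by
      have := dist_triangle (f p) (f q) X
      nlinarith)
    (by rw [hXd]; nlinarith)
  have hWc : IsPreconnected (ψ '' V) := hVc.image ψ (h.diff_inv.continuousOn.mono hVΩ)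
  have hpW : p ∈ ψ '' V := ⟨f p, hpV, h.left p hp⟩
  have hqW : q ∈ ψ '' V := ⟨_, hqV, h.left _ hqu⟩
  set a := 5 * C * ((D' + 2) * d) with ha
  have ha0 : 0 < a := by positivity
  have hl1' : 1 < 1 / l := by rw [lt_div_iff₀ hl0]; linarith
  have hLy : 1 / l * E * y ≤ 1 / 8 := by
    calc 1 / l * E * y ≤ 1 / l * E * (1 / (8 * (1 / l * E))) := by gcongr
      _ = 1 / 8 := by field_simp
  have hla := h.length_area hX x (a := a) (b := 2 * a) (ρ1 := 1 / l * y) (ρ2 := 1 / l * E * y)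
    ha0 (by linarith) (by positivity) (by
      have : 0 < 1 / l * y := by positivity
      nlinarith) (by
      intro ρ hρ
      have hρ0 : 0 < ρ := lt_trans (by positivity) hρ.1
      constructor
      · obtain ⟨z, ⟨v, hv, rfl⟩, hzd⟩ := exists_mem_dist_eq hWc hqW hpW (x := x) (ρ := ρ)
          (by
            rw [hq, dist_add_mul_I_ofReal hy.le]
            have h1 := hρ.1
            nlinarith) (by linarith [hρ.2])
        refine ⟨ψ v, h.map_mem (hVΩ hv), hzd, ?_⟩
        rw [h.right (hVΩ hv)]
        exact (hVr v hv).le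
      · refine ⟨x + ρ * Complex.I, mem_uhp_add_mul_I hρ0, dist_add_mul_I_ofReal hρ0.le, ?_⟩
        have h1 := hdec f ψ Ω h x y ρ hy (by
          have h1 := hρ.1
          rw [one_div, ← div_eq_inv_mul, div_lt_iff₀ hl0] at h1
          linarith) (by linarith [hρ.2])
        change d ≤ _ at h1
        refine le_trans ?_ (infDist_le_dist_of_mem hX)
        rw [one_div, ← div_eq_inv_mul, le_div_iff₀ (by positivity)] at h1
        rw [ha]
        linarith)
  have e1 : 1 / l * E * y / (1 / l * y) = E := by field_simp
  have e2 : 2 * a / a = 2 := by field_simp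
  rw [e1, e2, hE, Real.log_exp, mul_add, mul_div_cancel₀ _ hlog2.ne'] at hla
  linarith

/-! ### Sums over stopping times on the dyadic tree -/

open Classical in
/-- The sum of `w` over the terminal nodes below `(n, k)`, where a branch terminates at the first
node satisfying `halt`, or after `d` generations. The children of `(n, k)` are `(n + 1, 2 k)` and
`(n + 1, 2 k + 1)`. -/
noncomputable def treeSum (halt : ℕ → ℕ → Prop) (w : ℕ → ℕ → ℝ) : ℕ → ℕ → ℕ → ℝ
  | 0, n, k => w n k
  | d + 1, n, k => if halt n k then w n k else
      treeSum halt w d (n + 1) (2 * k) + treeSum halt w d (n + 1) (2 * k + 1)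

section treeSum

variable {halt halt' : ℕ → ℕ → Prop} {w w' : ℕ → ℕ → ℝ}

theorem treeSum_zero (n k : ℕ) : treeSum halt w 0 n k = w n k := rfl

theorem treeSum_of_halt {n k : ℕ} (h : halt n k) (d : ℕ) : treeSum halt w d n k = w n k := by
  cases d with
  | zero => rfl
  | succ d => simp [treeSum, h]

theorem treeSum_succ {n k : ℕ} (h : ¬ halt n k) (d : ℕ) : treeSum halt w (d + 1) n k =
    treeSum halt w d (n + 1) (2 * k) + treeSum halt w d (n + 1) (2 * k + 1) := by
  simp [treeSum, h]

theorem treeSum_mono {N d n k : ℕ} (hN : n + d ≤ N) (h : ∀ n k, n ≤ N → w n k ≤ w' n k) :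
    treeSum halt w d n k ≤ treeSum halt w' d n k := by
  induction d generalizing n k with
  | zero => exact h n k (by omega)
  | succ d ih =>
    by_cases hs : halt n k
    · rw [treeSum_of_halt hs, treeSum_of_halt hs]; exact h n k (by omega)
    · rw [treeSum_succ hs, treeSum_succ hs]
      exact add_le_add (ih (by omega)) (ih (by omega))

theorem treeSum_add (d n k : ℕ) : treeSum halt (fun n k => w n k + w' n k) d n k =
    treeSum halt w d n k + treeSum halt w' d n k := by
  induction d generalizing n k with
  | zero => rfl
  | succ d ih =>
    by_cases hs : halt n k
    · simp only [treeSum_of_halt hs]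
    · rw [treeSum_succ hs, treeSum_succ hs, treeSum_succ hs, ih, ih]; ring

theorem treeSum_mul_left (c : ℝ) (d n k : ℕ) : treeSum halt (fun n k => c * w n k) d n k =
    c * treeSum halt w d n k := by
  induction d generalizing n k with
  | zero => rfl
  | succ d ih =>
    by_cases hs : halt n k
    · simp only [treeSum_of_halt hs]
    · rw [treeSum_succ hs, treeSum_succ hs, ih, ih]; ring

theorem treeSum_eq_of_additive (h : ∀ n k, w n k = w (n + 1) (2 * k) + w (n + 1) (2 * k + 1))
    (d n k : ℕ) : treeSum halt w d n k = w n k := by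
  induction d generalizing n k with
  | zero => rfl
  | succ d ih =>
    by_cases hs : halt n k
    · rw [treeSum_of_halt hs]
    · rw [treeSum_succ hs, ih, ih, ← h]

theorem treeSum_half_pow (d n k : ℕ) :
    treeSum halt (fun n _ => (1 / 2 : ℝ) ^ n) d n k = (1 / 2) ^ n :=
  treeSum_eq_of_additive (fun n _ => by rw [pow_succ]; ring) d n k

theorem treeSum_nonneg (h : ∀ n k, 0 ≤ w n k) (d n k : ℕ) : 0 ≤ treeSum halt w d n k := by
  induction d generalizing n k with
  | zero => exact h n k
  | succ d ih =>
    by_cases hs : halt n k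
    · rw [treeSum_of_halt hs]; exact h n k
    · rw [treeSum_succ hs]; exact add_nonneg (ih _ _) (ih _ _)

/-- Stopping earlier, and then summing below each terminal node. -/
theorem treeSum_refine (h : ∀ n k, halt n k → halt' n k) {N d n k : ℕ} (hN : n + d = N) :
    treeSum halt w d n k =
      treeSum halt' (fun n' k' => treeSum halt w (N - n') n' k') d n k := by
  induction d generalizing n k with
  | zero => simp only [treeSum_zero]; rw [show N - n = 0 by omega, treeSum_zero]
  | succ d ih =>
    by_cases hs' : halt' n k
    · rw [treeSum_of_halt hs', show N - n = d + 1 by omega]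
    · have hs : ¬ halt n k := fun hs => hs' (h n k hs)
      rw [treeSum_succ hs, treeSum_succ hs', ih (by omega), ih (by omega)]

end treeSum

section

open Classical

/-- The bound `log t ≤ t / τ + log τ - 1`. -/
theorem log_le_div_add_log {t τ : ℝ} (ht : 0 < t) (hτ : 0 < τ) :
    Real.log t ≤ t / τ + Real.log τ - 1 := by
  have h := Real.log_le_sub_one_of_pos (div_pos ht hτ)
  rw [Real.log_div ht.ne' hτ.ne'] at h
  linarith

/-- If the total length and the entropy of the exceptional terminal nodes are small, then the
remaining ones carry a definite proportion of the mass. -/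
theorem treeSum_lower_bound {halt high : ℕ → ℕ → Prop} {M X : ℕ → ℕ → ℝ} {C₀ : ℝ}
    {N d n k : ℕ} (hC₀ : 0 ≤ C₀) (hM : ∀ n k, 0 < M n k)
    (hX : ∀ n k, X n k = X (n + 1) (2 * k) + X (n + 1) (2 * k + 1))
    (hXM : ∀ n k, n ≤ N → |X n k - (1 / 2) ^ n * Real.log (M n k)| ≤ C₀ * (1 / 2) ^ n)
    (hN : n + d = N)
    (h1 : treeSum halt (fun n' k' => if high n' k' then (1 / 2) ^ n' else 0) d n k ≤
      (1 / 2) ^ n / 2)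
    (h2 : treeSum halt (fun n' k' => if high n' k' then
      (1 / 2) ^ n' * Real.log (M n' k' / M n k) else 0) d n k ≤ (1 / 2) ^ n) :
    Real.exp (-(4 * C₀ + 3)) * (M n k * (1 / 2) ^ n) ≤
      treeSum halt (fun n' k' => if high n' k' then 0 else M n' k' * (1 / 2) ^ n') d n k := by
  set τ := Real.exp (-(4 * C₀ + 3)) with hτ
  have hτ0 : 0 < τ := Real.exp_pos _
  have hlτ : Real.log τ = -(4 * C₀ + 3) := Real.log_exp _
  have hM0 := hM n k
  have hpt : ∀ n' k', n' ≤ N → X n' k' ≤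
      ((Real.log (M n k) + C₀ + Real.log τ - 1) * (1 / 2) ^ n' +
        (if high n' k' then (1 / 2) ^ n' * Real.log (M n' k' / M n k) else 0)) +
      (1 / (τ * M n k) * (if high n' k' then 0 else M n' k' * (1 / 2) ^ n') +
        (1 - Real.log τ) * (if high n' k' then (1 / 2) ^ n' else 0)) := by
    intro n' k' hn'
    have hl : (0 : ℝ) < (1 / 2) ^ n' := by positivity
    have h3 := (abs_le.1 (hXM n' k' hn')).2
    have h4 : Real.log (M n' k') = Real.log (M n k) + Real.log (M n' k' / M n k) := by
      rw [Real.log_div (hM n' k').ne' hM0.ne']; ring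
    rw [h4] at h3
    by_cases hh : high n' k'
    · simp only [hh, if_true]
      nlinarith
    · simp only [hh, if_false]
      have h5 := log_le_div_add_log (div_pos (hM n' k') hM0) hτ0
      have h6 := mul_le_mul_of_nonneg_left h5 hl.le
      have h7 : M n' k' / M n k / τ * (1 / 2) ^ n' =
        1 / (τ * M n k) * (M n' k' * (1 / 2) ^ n') := by field_simp
      nlinarith
  have hsum := treeSum_mono (halt := halt) (k := k) hN.le hpt
  rw [treeSum_eq_of_additive hX, treeSum_add, treeSum_add, treeSum_add, treeSum_mul_left,
    treeSum_mul_left, treeSum_mul_left, treeSum_half_pow] at hsum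
  have h3 := (abs_le.1 (hXM n k (by omega))).1
  set m := treeSum halt (fun n' k' => if high n' k' then 0 else M n' k' * (1 / 2) ^ n') d n k
  have hl : (0 : ℝ) < (1 / 2) ^ n := by positivity
  have h4 : (1 - Real.log τ) *
      treeSum halt (fun n' k' => if high n' k' then (1 / 2) ^ n' else 0) d n k ≤
      (1 - Real.log τ) * ((1 / 2) ^ n / 2) := by
    refine mul_le_mul_of_nonneg_left h1 ?_
    rw [hlτ]; linarith
  have h5 : (1 / 2) ^ n ≤ 1 / (τ * M n k) * m := by
    rw [hlτ] at h4 hsum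
    nlinarith
  rw [one_div_mul_eq_div, le_div_iff₀ (by positivity)] at h5
  linarith

end

section

open Classical

theorem log_le_two_mul_div {t a : ℝ} (ha : 0 < a) (ht : a ^ 2 ≤ t) : Real.log t ≤ 2 * (t / a) := by
  have ht0 : 0 < t := lt_of_lt_of_le (by positivity) ht
  have h1 : Real.log t = 2 * Real.log (√t) := by
    rw [Real.log_sqrt ht0.le]; ring
  have h2 : Real.log (√t) ≤ √t := (Real.log_le_sub_one_of_pos (Real.sqrt_pos.2 ht0)).trans
    (by linarith)
  have h3 : a ≤ √t := Real.le_sqrt_of_sq_le ht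
  have h4 : √t ≤ t / a := by
    rw [le_div_iff₀ ha]
    calc √t * a ≤ √t * √t := by gcongr
      _ = t := Real.mul_self_sqrt ht0.le
  rw [h1]; linarith

/-- Geometric decay of the distribution of a mass on the tree whose logarithm is within bounded
distance of a dyadic martingale and whose sums over stopping times satisfy a reverse Jensen
inequality. -/
theorem exists_treeSum_decay {C₀ Cc Cr : ℝ} (hC₀ : 0 ≤ C₀) (hCc : 1 ≤ Cc) (hCr : 1 ≤ Cr) :
    ∃ B θ : ℝ, 1 ≤ B ∧ 0 ≤ θ ∧ θ < 1 ∧ ∀ (halt : ℕ → ℕ → Prop) (M X : ℕ → ℕ → ℝ) (N : ℕ),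
      (∀ n k, 0 < M n k) →
      (∀ n k, X n k = X (n + 1) (2 * k) + X (n + 1) (2 * k + 1)) →
      (∀ n k, n ≤ N → |X n k - (1 / 2) ^ n * Real.log (M n k)| ≤ C₀ * (1 / 2) ^ n) →
      (∀ n k, M (n + 1) (2 * k) ≤ Cc * M n k ∧ M (n + 1) (2 * k + 1) ≤ Cc * M n k) →
      (∀ d n k, n + d = N → ¬ halt n k →
        treeSum halt (fun n k => M n k * (1 / 2) ^ n) d n k ≤ Cr * (M n k * (1 / 2) ^ n)) →
      ∀ j d n k, n + d = N →
        treeSum halt (fun n' k' => if B ^ j * M n k < M n' k' then M n' k' * (1 / 2) ^ n' else 0)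
          d n k ≤ θ ^ j * treeSum halt (fun n k => M n k * (1 / 2) ^ n) d n k := by
  set τ := Real.exp (-(4 * C₀ + 3)) with hτ
  have hτ0 : 0 < τ := Real.exp_pos _
  have hτ1 : τ ≤ 1 := Real.exp_le_one_iff.2 (by linarith)
  set a := 2 * Cr / τ with ha
  have ha2 : 2 ≤ a := by rw [ha, le_div_iff₀ hτ0]; nlinarith
  have haτ : a * τ = 2 * Cr := by rw [ha]; field_simp
  have hA1 : 1 ≤ a ^ 2 := by nlinarith
  have hB1 : 1 ≤ Cc * a ^ 2 := by nlinarith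
  have hττ : τ * τ / Cr ≤ 1 := by rw [div_le_one (by linarith)]; nlinarith
  refine ⟨Cc * a ^ 2, 1 - τ * τ / Cr, hB1, by linarith, by
    have : 0 < τ * τ / Cr := by positivity
    linarith, ?_⟩
  intro halt M X N hM hX hXM hMc hRJ j
  set m : ℕ → ℕ → ℝ := fun n k => treeSum halt (fun n k => M n k * (1 / 2) ^ n) (N - n) n k with hm
  have hml : ∀ n k, n ≤ N → τ * (M n k * (1 / 2) ^ n) ≤ m n k := by
    intro n k hn
    have := treeSum_lower_bound (halt := halt) (high := fun _ _ => False) (n := n) (k := k)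
      (d := N - n) hC₀ hM hX hXM (by omega)
      (by simp only [if_false]; rw [show (fun _ _ => 0 : ℕ → ℕ → ℝ) = fun n k => 0 * 0 by
            simp, treeSum_mul_left, zero_mul]; positivity)
      (by simp only [if_false]; rw [show (fun _ _ => 0 : ℕ → ℕ → ℝ) = fun n k => 0 * 0 by
            simp, treeSum_mul_left, zero_mul]; positivity)
    simpa only [if_false] using this
  have hmu : ∀ n k, n ≤ N → m n k ≤ Cr * (M n k * (1 / 2) ^ n) := by
    intro n k hn
    by_cases hs : halt n k
    · simp only [hm]
      rw [treeSum_of_halt hs]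
      have : 0 < M n k * (1 / 2) ^ n := mul_pos (hM n k) (by positivity)
      nlinarith
    · exact hRJ _ _ _ (by omega) hs
  have hm0 : ∀ n k, 0 ≤ m n k := fun n k =>
    treeSum_nonneg (fun n k => mul_nonneg (hM n k).le (by positivity)) _ _ _
  induction j with
  | zero =>
    intro d n k hN
    rw [pow_zero, pow_zero, one_mul, one_mul]
    refine treeSum_mono hN.le fun n' k' _ => ?_
    split_ifs
    · exact le_rfl
    · exact mul_nonneg (hM n' k').le (by positivity)
  | succ j ih =>
    intro d n k hN
    have hMQ := hM n k
    set high : ℕ → ℕ → Prop := fun n' k' => a ^ 2 * M n k < M n' k' with hhigh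
    set halt2 : ℕ → ℕ → Prop := fun n' k' => halt n' k' ∨ high n' k' with hhalt2
    set s := (Cc * a ^ 2) ^ (j + 1) * M n k with hs
    have hBj : 1 ≤ (Cc * a ^ 2) ^ j := one_le_pow₀ hB1
    have has : a ^ 2 * M n k ≤ s := by
      rw [hs, pow_succ (Cc * a ^ 2) j]
      have : a ^ 2 ≤ (Cc * a ^ 2) ^ j * (Cc * a ^ 2) := by
        calc a ^ 2 ≤ Cc * a ^ 2 := by nlinarith
          _ = 1 * (Cc * a ^ 2) := (one_mul _).symm
          _ ≤ _ := by gcongr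
      gcongr
    have hdk : m n k = treeSum halt (fun n k => M n k * (1 / 2) ^ n) d n k := by
      simp only [hm]; rw [show N - n = d by omega]
    have hrefine : m n k = treeSum halt2 m d n k := by
      rw [hdk]; exact treeSum_refine (fun n' k' h => Or.inl h) hN
    have hhm : treeSum halt2 (fun n' k' => if high n' k' then M n' k' * (1 / 2) ^ n' else 0) d n k
        ≤ 1 / τ * (Cr * (M n k * (1 / 2) ^ n)) := by
      have h1 : treeSum halt2 (fun n' k' => if high n' k' then M n' k' * (1 / 2) ^ n' else 0) d n k
          ≤ treeSum halt2 (fun n' k' => 1 / τ * m n' k') d n k := by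
        refine treeSum_mono hN.le fun n' k' hn' => ?_
        have h2 : M n' k' * (1 / 2) ^ n' ≤ 1 / τ * m n' k' := by
          rw [one_div_mul_eq_div, le_div_iff₀ hτ0, mul_comm]; exact hml n' k' hn'
        split_ifs
        · exact h2
        · exact mul_nonneg (by positivity) (hm0 _ _)
      rw [treeSum_mul_left, ← hrefine] at h1
      exact h1.trans (by gcongr; exact hmu _ _ (by omega))
    have hl : (0 : ℝ) < (1 / 2) ^ n := by positivity
    have hlow := treeSum_lower_bound (halt := halt2) (high := high) hC₀ hM hX hXM hN
      (by
        have h1 : treeSum halt2 (fun n' k' => if high n' k' then (1 / 2) ^ n' else 0) d n k ≤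
            treeSum halt2 (fun n' k' => 1 / (a ^ 2 * M n k) *
              if high n' k' then M n' k' * (1 / 2) ^ n' else 0) d n k := by
          refine treeSum_mono hN.le fun n' k' _ => ?_
          split_ifs with hh
          · rw [one_div_mul_eq_div, le_div_iff₀ (by positivity), mul_comm]
            exact mul_le_mul_of_nonneg_right hh.le (by positivity)
          · simp
        rw [treeSum_mul_left] at h1
        refine (h1.trans (mul_le_mul_of_nonneg_left hhm (by positivity))).trans ?_
        have : 1 / (a ^ 2 * M n k) * (1 / τ * (Cr * (M n k * (1 / 2) ^ n))) =
            Cr / (a * (a * τ)) * (1 / 2) ^ n := by field_simp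
        rw [this, haτ]
        have : Cr / (a * (2 * Cr)) = 1 / (2 * a) := by field_simp
        rw [this]
        have : 1 / (2 * a) ≤ 1 / 2 := by gcongr; linarith
        nlinarith)
      (by
        have h1 : treeSum halt2 (fun n' k' => if high n' k' then
            (1 / 2) ^ n' * Real.log (M n' k' / M n k) else 0) d n k ≤
            treeSum halt2 (fun n' k' => 2 / (a * M n k) *
              if high n' k' then M n' k' * (1 / 2) ^ n' else 0) d n k := by
          refine treeSum_mono hN.le fun n' k' _ => ?_
          split_ifs with hh
          · have h2 := log_le_two_mul_div (a := a) (t := M n' k' / M n k) (by linarith)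
              (by rw [le_div_iff₀ hMQ]; exact hh.le)
            calc (1 / 2) ^ n' * Real.log (M n' k' / M n k)
                ≤ (1 / 2) ^ n' * (2 * (M n' k' / M n k / a)) := by gcongr
              _ = _ := by field_simp
          · simp
        rw [treeSum_mul_left] at h1
        refine (h1.trans (mul_le_mul_of_nonneg_left hhm (by positivity))).trans ?_
        have : 2 / (a * M n k) * (1 / τ * (Cr * (M n k * (1 / 2) ^ n))) =
            2 * Cr / (a * τ) * (1 / 2) ^ n := by field_simp
        rw [this, haτ, div_self (by positivity), one_mul])
    have hsplit : treeSum halt2 (fun n' k' => if high n' k' then m n' k' else 0) d n k ≤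
        (1 - τ * τ / Cr) * m n k := by
      have h1 : treeSum halt2 (fun n' k' => (if high n' k' then m n' k' else 0) +
          τ * (if high n' k' then 0 else M n' k' * (1 / 2) ^ n')) d n k ≤ m n k := by
        rw [hrefine]
        refine treeSum_mono hN.le fun n' k' hn' => ?_
        split_ifs
        · simp
        · rw [zero_add]; exact hml n' k' hn'
      rw [treeSum_add, treeSum_mul_left] at h1
      have h2 := hmu n k (by omega)
      have h3 : τ * τ / Cr * m n k ≤ τ * (τ * (M n k * (1 / 2) ^ n)) := by
        calc τ * τ / Cr * m n k ≤ τ * τ / Cr * (Cr * (M n k * (1 / 2) ^ n)) := by gcongr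
          _ = _ := by field_simp
      have h4 := mul_le_mul_of_nonneg_left hlow hτ0.le
      linarith
    have hmain : ∀ d' n' k', n' + d' = N → M n' k' ≤ Cc * a ^ 2 * M n k →
        treeSum halt (fun n' k' => if s < M n' k' then M n' k' * (1 / 2) ^ n' else 0) d' n' k' ≤
          (1 - τ * τ / Cr) ^ j *
            treeSum halt2 (fun n' k' => if high n' k' then m n' k' else 0) d' n' k' := by
      have hhighcase : ∀ d' n' k', n' + d' = N → M n' k' ≤ Cc * a ^ 2 * M n k → high n' k' →
        treeSum halt (fun n' k' => if s < M n' k' then M n' k' * (1 / 2) ^ n' else 0) d' n' k' ≤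
          (1 - τ * τ / Cr) ^ j *
            treeSum halt2 (fun n' k' => if high n' k' then m n' k' else 0) d' n' k' := by
        intro d' n' k' hN' hle hh
        rw [treeSum_of_halt (halt := halt2) (Or.inr hh)]
        simp only [hh, if_true]
        have h1 := ih d' n' k' hN'
        simp only [hm]
        rw [show N - n' = d' by omega]
        refine le_trans (treeSum_mono hN'.le fun i l _ => ?_) h1
        have h2 : (Cc * a ^ 2) ^ j * M n' k' ≤ s := by
          rw [hs, pow_succ (Cc * a ^ 2) j, mul_assoc ((Cc * a ^ 2) ^ j)]
          gcongr
        by_cases h3 : s < M i l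
        · rw [if_pos h3, if_pos (h2.trans_lt h3)]
        · rw [if_neg h3]
          split_ifs
          · exact mul_nonneg (hM _ _).le (by positivity)
          · exact le_rfl
      have hlowcase : ∀ n' k', ¬ high n' k' → ¬ s < M n' k' := fun n' k' hh =>
        not_lt.2 ((not_lt.1 hh).trans has)
      intro d'
      induction d' with
      | zero =>
        intro n' k' hN' hle
        by_cases hh : high n' k'
        · exact hhighcase 0 n' k' hN' hle hh
        · rw [treeSum_zero, treeSum_zero, if_neg (hlowcase _ _ hh), if_neg hh, mul_zero]
      | succ d' ih' =>
        intro n' k' hN' hle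
        by_cases hh : high n' k'
        · exact hhighcase _ n' k' hN' hle hh
        by_cases hst : halt n' k'
        · rw [treeSum_of_halt hst, treeSum_of_halt (halt := halt2) (Or.inl hst),
            if_neg (hlowcase _ _ hh), if_neg hh, mul_zero]
        · rw [treeSum_succ hst, treeSum_succ (halt := halt2) (by simp [halt2, hst, hh]), mul_add]
          have h1 : Cc * M n' k' ≤ Cc * a ^ 2 * M n k := by
            rw [mul_assoc]; exact mul_le_mul_of_nonneg_left (not_lt.1 hh) (by linarith)
          exact add_le_add (ih' _ _ (by omega) ((hMc n' k').1.trans h1))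
            (ih' _ _ (by omega) ((hMc n' k').2.trans h1))
    have h1 := hmain d n k hN (by nlinarith)
    refine h1.trans ?_
    rw [← hdk, pow_succ (1 - τ * τ / Cr) j, mul_assoc ((1 - τ * τ / Cr) ^ j)]
    refine mul_le_mul_of_nonneg_left hsplit (pow_nonneg (by linarith) _)

end

/-! ### Dyadic boxes -/

/-- The nodes of the dyadic tree at most `d` generations below `(n, k)`. -/
def treeBelow : ℕ → ℕ → ℕ → Finset (ℕ × ℕ)
  | 0, n, k => {(n, k)}
  | d + 1, n, k => insert (n, k) (treeBelow d (n + 1) (2 * k) ∪ treeBelow d (n + 1) (2 * k + 1))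

theorem mem_treeBelow {d n k i l : ℕ} (h : (i, l) ∈ treeBelow d n k) :
    n ≤ i ∧ i ≤ n + d ∧ k * 2 ^ (i - n) ≤ l ∧ l < (k + 1) * 2 ^ (i - n) := by
  induction d generalizing n k with
  | zero =>
    simp only [treeBelow, Finset.mem_singleton, Prod.mk.injEq] at h
    obtain ⟨rfl, rfl⟩ := h
    simp
  | succ d ih =>
    simp only [treeBelow, Finset.mem_insert, Prod.mk.injEq, Finset.mem_union] at h
    rcases h with ⟨rfl, rfl⟩ | h | h
    · simp
    · obtain ⟨h1, h2, h3, h4⟩ := ih h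
      have e : i - n = i - (n + 1) + 1 := by omega
      refine ⟨by omega, by omega, ?_, ?_⟩
      · rw [e, pow_succ]; nlinarith
      · rw [e, pow_succ]
        have := Nat.pos_of_ne_zero (pow_ne_zero (i - (n + 1)) (two_ne_zero (α := ℕ)))
        nlinarith
    · obtain ⟨h1, h2, h3, h4⟩ := ih h
      have e : i - n = i - (n + 1) + 1 := by omega
      refine ⟨by omega, by omega, ?_, ?_⟩
      · rw [e, pow_succ]
        have := Nat.pos_of_ne_zero (pow_ne_zero (i - (n + 1)) (two_ne_zero (α := ℕ)))
        nlinarith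
      · rw [e, pow_succ]; nlinarith

theorem sum_treeBelow_succ (g : ℕ × ℕ → ℝ) (d n k : ℕ) :
    ∑ p ∈ treeBelow (d + 1) n k, g p = g (n, k) + (∑ p ∈ treeBelow d (n + 1) (2 * k), g p +
      ∑ p ∈ treeBelow d (n + 1) (2 * k + 1), g p) := by
  rw [treeBelow, Finset.sum_insert, Finset.sum_union]
  · rw [Finset.disjoint_left]
    rintro ⟨i, l⟩ h1 h2
    have h3 := (mem_treeBelow h1).2.2.2
    have h4 := (mem_treeBelow h2).2.2.1
    rw [show 2 * k + 1 = 2 * k + 1 from rfl] at h4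
    omega
  · rw [Finset.mem_union]
    rintro (h | h) <;> have := (mem_treeBelow h).1 <;> omega

/-- A stopped sum is bounded by the sum over the nodes at which a branch can terminate. -/
theorem treeSum_le_sum {inside : ℕ → ℕ → Prop} {w : ℕ → ℕ → ℝ} {g : ℕ × ℕ → ℝ} {N : ℕ}
    (hg : ∀ p, 0 ≤ g p) (hN : ∀ k, inside N k → w N k ≤ g (N, k))
    (hexit : ∀ n k k', n < N → inside n k → (k' = 2 * k ∨ k' = 2 * k + 1) →
      ¬ inside (n + 1) k' → w (n + 1) k' ≤ g (n + 1, k'))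
    {d n k : ℕ} (hd : n + d = N) (h0 : ¬ inside n k → w n k ≤ g (n, k)) :
    treeSum (fun n k => ¬ inside n k) w d n k ≤ ∑ p ∈ treeBelow d n k, g p := by
  induction d generalizing n k with
  | zero =>
    obtain rfl : n = N := by omega
    simp only [treeBelow, Finset.sum_singleton, treeSum_zero]
    by_cases h : inside n k
    · exact hN k h
    · exact h0 h
  | succ d ih =>
    rw [sum_treeBelow_succ]
    by_cases h : inside n k
    · rw [treeSum_succ (by simpa using h)]
      have h1 := ih (n := n + 1) (k := 2 * k) (by omega)
        (hexit n k _ (by omega) h (Or.inl rfl))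
      have h2 := ih (n := n + 1) (k := 2 * k + 1) (by omega)
        (hexit n k _ (by omega) h (Or.inr rfl))
      linarith [hg (n, k)]
    · rw [treeSum_of_halt (by simpa using h)]
      have h1 := Finset.sum_nonneg (s := treeBelow d (n + 1) (2 * k)) fun p _ => hg p
      have h2 := Finset.sum_nonneg (s := treeBelow d (n + 1) (2 * k + 1)) fun p _ => hg p
      linarith [h0 h]

/-- The centre of a dyadic interval. -/
noncomputable def treeX (n k : ℕ) : ℝ := (k + 1 / 2) * (1 / 2) ^ n

/-- The point above the centre of a dyadic interval, at height the length of the interval. -/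
noncomputable def treePt (n k : ℕ) : ℂ := treeX n k + ((1 / 2 : ℝ) ^ n : ℝ) * Complex.I

/-- The half-open Carleson box over a dyadic interval. -/
def treeBox (n k : ℕ) : Set ℂ :=
  {p | |p.re - treeX n k| ≤ (1 / 2) ^ n / 2 ∧ 0 < p.im ∧ p.im ≤ (1 / 2) ^ n}

theorem treePt_re (n k : ℕ) : (treePt n k).re = treeX n k := by
  simp only [treePt, Complex.add_re, Complex.ofReal_re, Complex.mul_re, Complex.I_re,
    Complex.I_im, Complex.ofReal_im]
  ring

theorem treePt_im (n k : ℕ) : (treePt n k).im = (1 / 2) ^ n := im_add_mul_I _ _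

theorem treePt_mem (n k : ℕ) : treePt n k ∈ uhp := mem_uhp_add_mul_I (by positivity)

theorem treeBox_subset (n k : ℕ) : treeBox n k ⊆ uhp := fun _ h => h.2.1

theorem treeX_left (n k : ℕ) : treeX (n + 1) (2 * k) = treeX n k - (1 / 2) ^ n / 4 := by
  simp only [treeX]; push_cast; ring

theorem treeX_right (n k : ℕ) : treeX (n + 1) (2 * k + 1) = treeX n k + (1 / 2) ^ n / 4 := by
  simp only [treeX]; push_cast; ring

theorem treeBox_child {n k k' : ℕ} (h : k' = 2 * k ∨ k' = 2 * k + 1) :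
    treeBox (n + 1) k' ⊆ treeBox n k := by
  intro p hp
  simp only [treeBox, mem_ofPred_eq, pow_succ, abs_le] at hp ⊢
  have : (0 : ℝ) < (1 / 2) ^ n := by positivity
  rcases h with rfl | rfl
  · rw [treeX_left] at hp
    refine ⟨⟨?_, ?_⟩, hp.2.1, ?_⟩ <;> linarith [hp.1.1, hp.1.2, hp.2.2]
  · rw [treeX_right] at hp
    refine ⟨⟨?_, ?_⟩, hp.2.1, ?_⟩ <;> linarith [hp.1.1, hp.1.2, hp.2.2]

/-- A box is covered by its top half and the boxes over the two children. -/
theorem mem_treeBox_cases {n k : ℕ} {p : ℂ} (hp : p ∈ treeBox n k) : (1 / 2) ^ n / 2 < p.im ∨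
    p ∈ treeBox (n + 1) (2 * k) ∨ p ∈ treeBox (n + 1) (2 * k + 1) := by
  simp only [treeBox, mem_ofPred_eq, pow_succ, abs_le] at hp ⊢
  rw [treeX_left, treeX_right]
  by_cases h : (1 / 2) ^ n / 2 < p.im
  · exact Or.inl h
  rw [not_lt] at h
  right
  rcases le_total p.re (treeX n k) with h1 | h1
  · left; refine ⟨⟨?_, ?_⟩, hp.2.1, ?_⟩ <;> linarith [hp.1.1, hp.1.2, hp.2.2]
  · right; refine ⟨⟨?_, ?_⟩, hp.2.1, ?_⟩ <;> linarith [hp.1.1, hp.1.2, hp.2.2]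

theorem norm_lt_of_abs_re_im {z : ℂ} {a b : ℝ} (h1 : |z.re| ≤ a) (h2 : |z.im| ≤ b) :
    ‖z‖ ≤ a + b := (Complex.norm_le_abs_re_add_abs_im z).trans (add_le_add h1 h2)

theorem dist_treeX_lt {n k : ℕ} {p : ℂ} (hp : p ∈ treeBox n k) :
    dist p (treeX n k) < 2 * (1 / 2) ^ n := by
  have h0 : (0 : ℝ) < (1 / 2) ^ n := by positivity
  rw [dist_eq_norm]
  have := norm_lt_of_abs_re_im (z := p - treeX n k) (a := (1 / 2) ^ n / 2) (b := (1 / 2) ^ n)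
    (by simpa using hp.1) (by simp [abs_of_pos hp.2.1]; simpa using hp.2.2)
  linarith

/-- The Whitney-type neighbourhood of a point of the half-plane. -/
def whitney (A : ℝ) (q : ℂ) : Set ℂ :=
  {p | |p.re - q.re| ≤ A * q.im ∧ q.im ≤ A * p.im ∧ p.im ≤ A * q.im}

theorem convex_whitney (A : ℝ) (q : ℂ) : Convex ℝ (whitney A q) := by
  intro p hp p' hp' a b ha hb hab
  obtain ⟨h1, h2, h3⟩ := hp
  obtain ⟨h1', h2', h3'⟩ := hp'
  rw [abs_le] at h1 h1'
  have hb' : b = 1 - a := by linarith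
  have ha1 : 0 ≤ 1 - a := by linarith
  subst hb'
  refine ⟨abs_le.2 ⟨?_, ?_⟩, ?_, ?_⟩ <;> simp
  · nlinarith [mul_le_mul_of_nonneg_left h1.1 ha, mul_le_mul_of_nonneg_left h1'.1 ha1]
  · nlinarith [mul_le_mul_of_nonneg_left h1.2 ha, mul_le_mul_of_nonneg_left h1'.2 ha1]
  · nlinarith [mul_le_mul_of_nonneg_left h2 ha, mul_le_mul_of_nonneg_left h2' ha1]
  · nlinarith [mul_le_mul_of_nonneg_left h3 ha, mul_le_mul_of_nonneg_left h3' ha1]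

theorem whitney_subset_uhp {A : ℝ} {q : ℂ} (hA : 0 < A) (hq : q ∈ uhp) : whitney A q ⊆ uhp := by
  intro p hp
  by_contra hcon
  rw [mem_uhp, not_lt] at hcon
  have h1 : 0 < q.im := hq
  have h2 := hp.2.1
  nlinarith

theorem mem_whitney_self {A : ℝ} {q : ℂ} (hA : 1 ≤ A) (hq : q ∈ uhp) : q ∈ whitney A q := by
  have h1 : 0 < q.im := hq
  refine ⟨by simp; positivity, ?_, ?_⟩ <;> nlinarith

theorem whitney_parent {n k k' : ℕ} (h : k' = 2 * k ∨ k' = 2 * k + 1) {A : ℝ} (hA : 1 ≤ A) :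
    whitney A (treePt n k) ⊆ whitney (3 * A) (treePt (n + 1) k') := by
  intro p hp
  have h0 : (0 : ℝ) < (1 / 2) ^ n := by positivity
  have hp0 : 0 < p.im := whitney_subset_uhp (by linarith) (treePt_mem n k) hp
  simp only [whitney, mem_ofPred_eq, treePt_re, treePt_im, pow_succ, abs_le] at hp ⊢
  obtain ⟨⟨h1, h2⟩, h3, h4⟩ := hp
  rcases h with rfl | rfl
  · rw [treeX_left]
    refine ⟨⟨?_, ?_⟩, ?_, ?_⟩ <;> nlinarith
  · rw [treeX_right]
    refine ⟨⟨?_, ?_⟩, ?_, ?_⟩ <;> nlinarith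

theorem Finset.card_le_of_forall_le_add {S : Finset ℕ} {m : ℕ}
    (h : ∀ a ∈ S, ∀ b ∈ S, a ≤ b + m) : S.card ≤ m + 1 := by
  rcases S.eq_empty_or_nonempty with rfl | hS
  · simp
  · have : S ⊆ Finset.Icc (S.min' hS) (S.min' hS + m) := fun a ha =>
      Finset.mem_Icc.2 ⟨S.min'_le a ha, h a ha _ (S.min'_mem hS)⟩
    have := Finset.card_le_card this
    simp at this
    omega

/-- Bounded overlap of the nodes of a single generation. -/
theorem card_le_of_abs_sub_treeX_le {S : Finset (ℕ × ℕ)} {n : ℕ} {x A : ℝ}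
    (hn : ∀ p ∈ S, p.1 = n) (h : ∀ p ∈ S, |x - treeX n p.2| ≤ A * (1 / 2) ^ n) :
    S.card ≤ ⌈2 * A⌉₊ + 1 := by
  have hinj : Set.InjOn Prod.snd (S : Set (ℕ × ℕ)) := fun a ha b hb hab =>
    Prod.ext ((hn a ha).trans (hn b hb).symm) hab
  rw [← Finset.card_image_of_injOn hinj]
  refine Finset.card_le_of_forall_le_add ?_
  intro a ha b hb
  rw [Finset.mem_image] at ha hb
  obtain ⟨p, hp, rfl⟩ := ha
  obtain ⟨q, hq, rfl⟩ := hb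
  have h1 := abs_le.1 (h p hp)
  have h2 := abs_le.1 (h q hq)
  have h0 : (0 : ℝ) < (1 / 2) ^ n := by positivity
  simp only [treeX] at h1 h2
  have h3 : ((p.2 : ℝ) - q.2) * (1 / 2) ^ n ≤ 2 * A * (1 / 2) ^ n := by linarith [h1.1, h2.2]
  have h4 := le_of_mul_le_mul_right h3 h0
  have h5 := Nat.le_ceil (2 * A)
  have h6 : (p.2 : ℝ) ≤ q.2 + ⌈2 * A⌉₊ := by linarith
  exact_mod_cast h6

/-- Bounded overlap of the Whitney neighbourhoods of the nodes. -/
theorem exists_card_whitney_le {A : ℝ} (hA : 1 ≤ A) : ∃ K : ℕ, ∀ (S : Finset (ℕ × ℕ)) (p : ℂ),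
    (∀ q ∈ S, p ∈ whitney A (treePt q.1 q.2)) → S.card ≤ K := by
  obtain ⟨J, hJ⟩ := pow_unbounded_of_one_lt (A ^ 2) (one_lt_two (α := ℝ))
  refine ⟨(⌈2 * A⌉₊ + 1) * (J + 1), fun S p hS => ?_⟩
  have h1 : (S.image Prod.fst).card ≤ J + 1 := by
    refine Finset.card_le_of_forall_le_add ?_
    intro a ha b hb
    rw [Finset.mem_image] at ha hb
    obtain ⟨u, hu, rfl⟩ := ha
    obtain ⟨v, hv, rfl⟩ := hb
    have h2 := (hS u hu).2.2
    have h3 := (hS v hv).2.1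
    rw [treePt_im] at h2 h3
    by_contra! hcon
    have h4 : (1 / 2 : ℝ) ^ u.1 ≤ (1 / 2) ^ (v.1 + J) :=
      pow_le_pow_of_le_one (by norm_num) (by norm_num) hcon.le
    have h5 : (0 : ℝ) < (1 / 2) ^ v.1 := by positivity
    have h6 : (1 / 2 : ℝ) ^ v.1 ≤ A ^ 2 * ((1 / 2) ^ v.1 * (1 / 2) ^ J) := by
      calc (1 / 2 : ℝ) ^ v.1 ≤ A * p.im := h3
        _ ≤ A * (A * (1 / 2) ^ u.1) := by gcongr
        _ ≤ A * (A * (1 / 2) ^ (v.1 + J)) := by gcongr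
        _ = _ := by rw [pow_add]; ring
    have h7 : (1 / 2 : ℝ) ^ J = (2 ^ J)⁻¹ := by rw [one_div, inv_pow]
    rw [h7] at h6
    have h8 : (1 / 2 : ℝ) ^ v.1 * 2 ^ J ≤ A ^ 2 * (1 / 2) ^ v.1 := by
      calc (1 / 2 : ℝ) ^ v.1 * 2 ^ J ≤ A ^ 2 * ((1 / 2) ^ v.1 * (2 ^ J)⁻¹) * 2 ^ J := by gcongr
        _ = _ := by field_simp
    nlinarith
  refine (Finset.card_le_mul_card_image (f := Prod.fst) S (⌈2 * A⌉₊ + 1) ?_).trans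
    (Nat.mul_le_mul_left _ h1)
  intro n _
  refine card_le_of_abs_sub_treeX_le (n := n) (x := p.re) (A := A) ?_ ?_
  · intro q hq; exact (Finset.mem_filter.1 hq).2
  · intro q hq
    obtain ⟨hq1, hq2⟩ := Finset.mem_filter.1 hq
    have := (hS q hq1).1
    rwa [treePt_re, treePt_im, hq2] at this

/-- Sets with bounded overlap. -/
theorem sum_measure_le_of_card_le {ι α : Type*} [MeasurableSpace α] {μ : Measure α}
    {S : Finset ι} {B : ι → Set α} {D : Set α} {K : ℕ} (hB : ∀ i ∈ S, MeasurableSet (B i))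
    (hsub : ∀ i ∈ S, B i ⊆ D) (hD : MeasurableSet D)
    (hK : ∀ z, ∀ T ⊆ S, (∀ i ∈ T, z ∈ B i) → T.card ≤ K) :
    ∑ i ∈ S, μ (B i) ≤ K * μ D := by
  classical
  calc ∑ i ∈ S, μ (B i) = ∑ i ∈ S, ∫⁻ z, (B i).indicator 1 z ∂μ :=
        Finset.sum_congr rfl fun i hi => (lintegral_indicator_one (hB i hi)).symm
    _ = ∫⁻ z, ∑ i ∈ S, (B i).indicator 1 z ∂μ :=
        (lintegral_finsetSum' S fun i hi =>
          ((measurable_const (a := (1 : ℝ≥0∞))).indicator (hB i hi)).aemeasurable).symm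
    _ ≤ ∫⁻ z, D.indicator (fun _ => (K : ℝ≥0∞)) z ∂μ := by
        refine lintegral_mono fun z => ?_
        by_cases hz : z ∈ D
        · rw [indicator_of_mem hz]
          have : ∑ i ∈ S, (B i).indicator (1 : α → ℝ≥0∞) z =
              ((S.filter fun i => z ∈ B i).card : ℝ≥0∞) := by
            rw [Finset.card_filter]
            push_cast
            refine Finset.sum_congr rfl fun i _ => ?_
            simp [indicator_apply]
          rw [this]
          exact Nat.cast_le.2
            (hK z _ (Finset.filter_subset _ _) fun i hi => (Finset.mem_filter.1 hi).2)
        · rw [indicator_of_notMem hz]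
          refine (Finset.sum_eq_zero fun i hi => ?_).le
          exact indicator_of_notMem (fun h => hz (hsub i hi h)) _
    _ = K * μ D := lintegral_indicator_const hD _

/-! ### Rescaled box maps -/

theorem affine_mem_uhp {a s : ℝ} (hs : 0 < s) {z : ℂ} : (a : ℂ) + s * z ∈ uhp ↔ z ∈ uhp := by
  simp [mem_uhp, hs]

theorem ConformalUHP.affine {f ψ : ℂ → ℂ} {Ω : Set ℂ} (h : ConformalUHP f ψ Ω) (a : ℝ) {s : ℝ}
    (hs : 0 < s) :
    ConformalUHP (fun z => f (a + s * z)) (fun w => (ψ w - a) / s) Ω where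
  diff := h.diff.comp (by fun_prop) fun z hz => (affine_mem_uhp hs).2 hz
  img := by
    have hs' : (s : ℂ) ≠ 0 := by exact_mod_cast hs.ne'
    rw [← h.img]
    ext w
    constructor
    · rintro ⟨z, hz, rfl⟩
      exact ⟨_, (affine_mem_uhp hs).2 hz, rfl⟩
    · rintro ⟨z, hz, rfl⟩
      have e : (a : ℂ) + s * ((z - a) / s) = z := by field_simp; ring
      exact ⟨(z - a) / s, (affine_mem_uhp (a := a) hs).1 (by rwa [e]), by simp only [e]⟩
  left z hz := by
    have hs' : (s : ℂ) ≠ 0 := by exact_mod_cast hs.ne'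
    rw [h.left _ ((affine_mem_uhp hs).2 hz)]
    field_simp
    ring
  ne := h.ne

theorem affine_add_mul_I (a s x y : ℝ) :
    (a : ℂ) + s * (x + y * Complex.I) = ((a + s * x : ℝ) : ℂ) + ((s * y : ℝ) : ℂ) * Complex.I := by
  push_cast; ring

theorem dist_affine (a : ℝ) {s : ℝ} (hs : 0 < s) (p : ℂ) (x : ℝ) :
    dist ((a : ℂ) + s * p) ((a + s * x : ℝ) : ℂ) = s * dist p x := by
  rw [dist_eq_norm, dist_eq_norm, show (a : ℂ) + s * p - ((a + s * x : ℝ) : ℂ) = s * (p - x) by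
    push_cast; ring, norm_mul, Complex.norm_real, Real.norm_of_nonneg hs.le]

/-- A conformal map of the half-plane satisfying scale invariant box estimates up to scale `D₀`. -/
structure BoxMap (C₁ : ℝ) (lam : ℝ → ℝ) (L : ℕ → ℝ) (D₀ : ℕ) (F ψ : ℂ → ℂ) (Ω : Set ℂ) : Prop
    extends ConformalUHP F ψ Ω where
  box : ∀ x y : ℝ, 0 < y → y ≤ D₀ → ∀ p ∈ uhp, dist p x < 2 * y →
    dist (F p) (F (x + y * Complex.I)) ≤ C₁ * infDist (F (x + y * Complex.I)) (frontier Ω)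
  decay : ∀ ε : ℝ, 0 < ε → ∀ x y ρ : ℝ, 0 < y → y ≤ lam ε * ρ → ρ ≤ D₀ →
    infDist (F (x + y * Complex.I)) (frontier Ω) ≤
      ε * infDist (F (x + ρ * Complex.I)) (frontier Ω)
  joint : ∀ D' : ℕ, 1 ≤ D' → D' ≤ D₀ → ∀ x y : ℝ, 0 < y → y ≤ 1 → ∀ p ∈ uhp,
    dist (F p) (F (x + y * Complex.I)) ≤ D' * infDist (F (x + y * Complex.I)) (frontier Ω) →
      dist p x ≤ L D' * y

theorem BoxMap.affine {C₁ : ℝ} {lam : ℝ → ℝ} {L : ℕ → ℝ} {D₀ : ℕ} {F ψ : ℂ → ℂ} {Ω : Set ℂ}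
    (h : BoxMap C₁ lam L D₀ F ψ Ω) (a : ℝ) {s : ℝ} (hs : 0 < s) (hs1 : s ≤ 1) :
    BoxMap C₁ lam L D₀ (fun z => F (a + s * z)) (fun w => (ψ w - a) / s) Ω where
  toConformalUHP := h.toConformalUHP.affine a hs
  box x y hy hyD p hp hpx := by
    rw [affine_add_mul_I]
    refine h.box _ _ (mul_pos hs hy) ?_ _ ((affine_mem_uhp hs).2 hp) ?_
    · nlinarith
    · rw [dist_affine a hs]; nlinarith
  decay ε hε x y ρ hy hyl hρ := by
    rw [affine_add_mul_I, affine_add_mul_I]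
    refine h.decay ε hε _ _ _ (mul_pos hs hy) ?_ ?_
    · nlinarith
    · have : (0 : ℝ) ≤ D₀ := by positivity
      by_cases h0 : 0 ≤ ρ <;> nlinarith
  joint D' h1 h2 x y hy hy1 p hp hd := by
    rw [affine_add_mul_I] at hd
    have := h.joint D' h1 h2 _ _ (mul_pos hs hy) (by nlinarith) _ ((affine_mem_uhp hs).2 hp) hd
    rw [dist_affine a hs] at this
    exact le_of_mul_le_mul_left (by linarith) hs

theorem exists_boxMap {C d₀ : ℝ} (D : ℝ) (hC : 1 ≤ C) (hd₀ : 0 < d₀) :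
    ∃ (C₁ : ℝ) (lam : ℝ → ℝ) (L : ℕ → ℝ), 1 ≤ C₁ ∧ (∀ ε, 0 < ε → 0 < lam ε) ∧
      (∀ D', 1 ≤ D' → 1 ≤ L D') ∧ ∀ D₀ : ℕ, ∃ s₀ : ℝ, 0 < s₀ ∧
        ∀ f ψ Ω, NormalizedUHP C d₀ D f ψ Ω → ∀ a s : ℝ, 0 < s → s ≤ s₀ →
          BoxMap C₁ lam L D₀ (fun z => f (a + s * z)) (fun w => (ψ w - a) / s) Ω := by
  obtain ⟨C₁, hC₁, hbox⟩ := exists_box_bound (D := D) hC hd₀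
  have hdec : ∀ ε : ℝ, ∃ l : ℝ, 0 < ε → 0 < l ∧ ∀ f ψ Ω, NormalizedUHP C d₀ D f ψ Ω →
      ∀ x y ρ : ℝ, 0 < y → y ≤ l * ρ → ρ ≤ 1 / 8 → infDist (f (x + y * Complex.I)) (frontier Ω) ≤
        ε * infDist (f (x + ρ * Complex.I)) (frontier Ω) := by
    intro ε
    by_cases hε : 0 < ε
    · obtain ⟨l, h1, -, h2⟩ := exists_decay (D := D) hC hd₀ hε
      exact ⟨l, fun _ => ⟨h1, h2⟩⟩
    · exact ⟨0, fun h => absurd h hε⟩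
  choose lam hlam using hdec
  have hjoint : ∀ D' : ℕ, ∃ L y₁ : ℝ, 0 < y₁ ∧ (1 ≤ D' → 1 ≤ L ∧
      ∀ f ψ Ω, NormalizedUHP C d₀ D f ψ Ω → ∀ x y : ℝ, 0 < y →
      y ≤ y₁ → ∀ p ∈ uhp, dist (f p) (f (x + y * Complex.I)) ≤
        D' * infDist (f (x + y * Complex.I)) (frontier Ω) → dist p x ≤ L * y) := by
    intro D'
    by_cases h1 : 1 ≤ D'
    · obtain ⟨L, y₁, hL, hy₁, hh⟩ := exists_dist_le_of_dist_image_le (D := D) hC hd₀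
        (D' := (D' : ℝ)) (by exact_mod_cast h1)
      exact ⟨L, y₁, hy₁, fun _ => ⟨hL, hh⟩⟩
    · exact ⟨0, 1, one_pos, fun h => absurd h h1⟩
  choose L y₁ hy₁ hL using hjoint
  refine ⟨C₁, lam, L, hC₁, fun ε hε => (hlam ε hε).1, fun D' h => (hL D' h).1, fun D₀ => ?_⟩
  obtain ⟨m, hm, hmin⟩ := (Finset.range (D₀ + 1)).exists_min_image y₁ ⟨0, by simp⟩
  refine ⟨min (y₁ m) (1 / (8 * (D₀ + 1))), lt_min (hy₁ m) (by positivity), ?_⟩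
  intro f ψ Ω h a s hs hs0
  have hs1 : s * D₀ ≤ 1 / 8 := by
    have h1 := hs0.trans (min_le_right _ _)
    rw [le_div_iff₀ (by positivity)] at h1
    nlinarith
  have hsy : ∀ y : ℝ, y ≤ D₀ → s * y ≤ 1 / 8 := fun y hy =>
    (mul_le_mul_of_nonneg_left hy hs.le).trans hs1
  refine ⟨h.toConformalUHP.affine a hs, ?_, ?_, ?_⟩
  · intro x y hy hyD p hp hpx
    rw [affine_add_mul_I]
    refine hbox f ψ Ω h _ _ (mul_pos hs hy) (hsy y hyD) _ ((affine_mem_uhp hs).2 hp) ?_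
    rw [dist_affine a hs]; nlinarith
  · intro ε hε x y ρ hy hyl hρ
    rw [affine_add_mul_I, affine_add_mul_I]
    exact (hlam ε hε).2 f ψ Ω h _ _ _ (mul_pos hs hy) (by nlinarith) (hsy ρ hρ)
  · intro D' h1 h2 x y hy hy1 p hp hd
    rw [affine_add_mul_I] at hd
    have h3 : s * y ≤ y₁ D' := by
      have h4 := (hs0.trans (min_le_left _ _)).trans (hmin D' (by simp; omega))
      nlinarith
    have := (hL D' h1).2 f ψ Ω h _ _ (mul_pos hs hy) h3 _ ((affine_mem_uhp hs).2 hp) hd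
    rw [dist_affine a hs] at this
    exact le_of_mul_le_mul_left (by linarith) hs

/-! ### The derivative on Whitney boxes and its logarithm -/

/-- The distortion constant of a conformal map on a Whitney box of aperture `A`. -/
noncomputable def distortion (A : ℝ) : ℝ := Real.exp (96 * Real.pi * (2 * A ^ 2))

theorem one_le_distortion (A : ℝ) : 1 ≤ distortion A :=
  Real.one_le_exp (by have := Real.pi_pos; positivity)

theorem distortion_pos (A : ℝ) : 0 < distortion A := Real.exp_pos _

theorem dist_le_of_mem_whitney {A : ℝ} (hA : 1 ≤ A) {p q : ℂ} (hq : q ∈ uhp)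
    (hp : p ∈ whitney A q) : dist p q ≤ 2 * A * q.im := by
  have hq0 : 0 < q.im := hq
  have hp0 : 0 < p.im := whitney_subset_uhp (by linarith) hq hp
  obtain ⟨h1, h2, h3⟩ := hp
  rw [dist_eq_norm]
  have := norm_lt_of_abs_re_im (z := p - q) (a := A * q.im) (b := A * q.im) (by simpa using h1)
    (by rw [Complex.sub_im, abs_le]; constructor <;> nlinarith)
  linarith

namespace ConformalUHP

variable {f ψ : ℂ → ℂ} {Ω : Set ℂ}

theorem whitney_infDist (h : ConformalUHP f ψ Ω) {A : ℝ} (hA : 1 ≤ A) {p q : ℂ} (hq : q ∈ uhp)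
    (hp : p ∈ whitney A q) :
    infDist (f p) (frontier Ω) ≤ distortion A * infDist (f q) (frontier Ω) ∧
      infDist (f q) (frontier Ω) ≤ distortion A * infDist (f p) (frontier Ω) := by
  have hq0 : 0 < q.im := hq
  have hd := dist_le_of_mem_whitney hA hq hp
  have hm : 0 < q.im / A := by positivity
  have h1 : q.im / A ≤ p.im := by rw [div_le_iff₀ (by linarith)]; linarith [hp.2.1]
  have h2 : q.im / A ≤ q.im := div_le_self hq0.le hA
  have h3 : 96 * Real.pi * dist p q / (q.im / A) ≤ 96 * Real.pi * (2 * A ^ 2) := by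
    rw [div_le_iff₀ hm]
    have e : 96 * Real.pi * (2 * A ^ 2) * (q.im / A) = 96 * Real.pi * (2 * A * q.im) := by
      field_simp
    rw [e]
    have := Real.pi_pos
    gcongr
  constructor
  · exact (h.harnack hm h1 h2).trans
      (mul_le_mul_of_nonneg_right (Real.exp_le_exp.2 h3) infDist_nonneg)
  · rw [dist_comm] at h3
    exact (h.harnack hm h2 h1).trans
      (mul_le_mul_of_nonneg_right (Real.exp_le_exp.2 h3) infDist_nonneg)

theorem norm_deriv_pos (h : ConformalUHP f ψ Ω) {q : ℂ} (hq : q ∈ uhp) : 0 < ‖deriv f q‖ :=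
  norm_pos_iff.2 (deriv_ne_zero_of_injOn isOpen_uhp h.diff h.injOn hq)

theorem whitney_deriv (h : ConformalUHP f ψ Ω) {A : ℝ} (hA : 1 ≤ A) {p q : ℂ} (hq : q ∈ uhp)
    (hp : p ∈ whitney A q) :
    ‖deriv f p‖ ≤ 192 * Real.pi * A * distortion A * ‖deriv f q‖ ∧
      ‖deriv f q‖ ≤ 192 * Real.pi * A * distortion A * ‖deriv f p‖ := by
  have hpu : p ∈ uhp := whitney_subset_uhp (by linarith) hq hp
  have hq0 : 0 < q.im := hq
  have hp0 : 0 < p.im := hpu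
  obtain ⟨h1, h2⟩ := h.whitney_infDist hA hq hp
  have h3 := distortion_pos A
  have h4 := Real.pi_pos
  have key : ∀ a b : ℂ, 0 < a.im → 0 < b.im → b.im ≤ A * a.im →
      a.im * ‖deriv f a‖ ≤ 96 * Real.pi * infDist (f a) (frontier Ω) →
      infDist (f a) (frontier Ω) ≤ distortion A * infDist (f b) (frontier Ω) →
      infDist (f b) (frontier Ω) ≤ 2 * b.im * ‖deriv f b‖ →
      ‖deriv f a‖ ≤ 192 * Real.pi * A * distortion A * ‖deriv f b‖ := by
    intro a b ha hb hab e1 e2 e3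
    have : a.im * ‖deriv f a‖ ≤ a.im * (192 * Real.pi * A * distortion A * ‖deriv f b‖) := by
      calc a.im * ‖deriv f a‖ ≤ 96 * Real.pi * infDist (f a) (frontier Ω) := e1
        _ ≤ 96 * Real.pi * (distortion A * (2 * (A * a.im) * ‖deriv f b‖)) := by
          gcongr
          refine e2.trans ?_
          gcongr
          refine e3.trans ?_
          gcongr
        _ = _ := by ring
    exact le_of_mul_le_mul_left this ha
  exact ⟨key p q hp0 hq0 hp.2.1 (h.koebe hpu) h1 (h.le_deriv hq),
    key q p hq0 hp0 hp.2.2 (h.koebe hq) h2 (h.le_deriv hpu)⟩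

theorem norm_deriv_deriv_le (h : ConformalUHP f ψ Ω) {q : ℂ} (hq : q ∈ uhp) :
    ‖deriv (deriv f) q‖ ≤ 768 * Real.pi * distortion 2 * ‖deriv f q‖ / q.im := by
  have hq0 : 0 < q.im := hq
  have hsub : closedBall q (q.im / 2) ⊆ whitney 2 q := by
    intro p hp
    rw [mem_closedBall, dist_eq_norm] at hp
    have h1 := (Complex.abs_re_le_norm (p - q)).trans hp
    have h2 := (Complex.abs_im_le_norm (p - q)).trans hp
    rw [Complex.sub_re] at h1
    rw [Complex.sub_im, abs_le] at h2
    exact ⟨by linarith, by linarith [h2.1], by linarith [h2.2]⟩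
  have hd : DifferentiableOn ℂ (deriv f) (closedBall q (q.im / 2)) :=
    (h.diff.deriv isOpen_uhp).mono (hsub.trans (whitney_subset_uhp (by norm_num) hq))
  have := Complex.norm_deriv_le_of_forall_mem_sphere_norm_le (f := deriv f) (c := q)
    (R := q.im / 2) (C := 192 * Real.pi * 2 * distortion 2 * ‖deriv f q‖) (by positivity)
    (hd.diffContOnCl_ball (Subset.refl _))
    fun z hz => (h.whitney_deriv (by norm_num) hq (hsub (sphere_subset_closedBall hz))).1
  refine this.trans (le_of_eq ?_)
  field_simp
  ring

/-- The logarithm of the derivative of a conformal map is a Bloch function. -/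
theorem exists_log_deriv (h : ConformalUHP f ψ Ω) :
    ∃ g : ℂ → ℂ, DifferentiableOn ℂ g uhp ∧ (∀ z ∈ uhp, (g z).re = Real.log ‖deriv f z‖) ∧
      ∀ z ∈ uhp, ‖deriv g z‖ ≤ 768 * Real.pi * distortion 2 / z.im := by
  obtain ⟨g, hg, he⟩ := exists_differentiableOn_log isOpen_uhp convex_uhp
    ⟨Complex.I, by simp [mem_uhp]⟩ (h.diff.deriv isOpen_uhp)
    fun z hz => deriv_ne_zero_of_injOn isOpen_uhp h.diff h.injOn hz
  refine ⟨g, hg, fun z hz => ?_, fun z hz => ?_⟩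
  · rw [← he z hz, Complex.norm_exp, Real.log_exp]
  · have h1 := h.norm_deriv_deriv_le hz
    rw [deriv_eq_mul_of_exp_eq isOpen_uhp hg he hz, norm_mul] at h1
    have h2 := h.norm_deriv_pos hz
    refine le_of_mul_le_mul_left (h1.trans (le_of_eq ?_)) h2
    ring

end ConformalUHP

theorem norm_sub_le_mul_log {g : ℂ → ℂ} (hg : DifferentiableOn ℂ g uhp) {G : ℝ}
    (hG : ∀ z ∈ uhp, ‖deriv g z‖ ≤ G / z.im) (x : ℝ) {y l : ℝ} (hy : 0 < y) (hyl : y ≤ l) :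
    ‖g (x + y * Complex.I) - g (x + l * Complex.I)‖ ≤ G * (Real.log l - Real.log y) := by
  have hd : ∀ t : ℝ, HasDerivAt (fun t : ℝ => g (x + (Real.exp t : ℝ) * Complex.I))
      (deriv g (x + (Real.exp t : ℝ) * Complex.I) * ((Real.exp t : ℝ) * Complex.I)) t := by
    intro t
    have h1 : HasDerivAt g (deriv g (x + (Real.exp t : ℝ) * Complex.I))
        (x + (Real.exp t : ℝ) * Complex.I) :=
      (hg.differentiableAt (isOpen_uhp.mem_nhds (mem_uhp_add_mul_I (Real.exp_pos t)))).hasDerivAt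
    have h2 : HasDerivAt (fun t : ℝ => (x : ℂ) + (Real.exp t : ℝ) * Complex.I)
        ((Real.exp t : ℝ) * Complex.I) t := by
      simpa using (((Real.hasDerivAt_exp t).ofReal_comp).mul_const Complex.I).const_add (x : ℂ)
    exact h1.comp t h2
  have := Convex.norm_image_sub_le_of_norm_deriv_le (𝕜 := ℝ)
    (f := fun t : ℝ => g (x + (Real.exp t : ℝ) * Complex.I)) (s := univ) (x := Real.log l)
    (y := Real.log y) (C := G) (fun t _ => (hd t).differentiableAt) (fun t _ => ?_) convex_univ
    (mem_univ _) (mem_univ _)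
  · simp only [Real.exp_log hy, Real.exp_log (hy.trans_le hyl)] at this
    rwa [Real.norm_eq_abs, abs_sub_comm,
      abs_of_nonneg (sub_nonneg.2 (Real.log_le_log hy hyl))] at this
  · rw [(hd t).deriv, norm_mul, norm_mul, Complex.norm_I, mul_one, Complex.norm_real,
      Real.norm_of_nonneg (Real.exp_pos t).le]
    have h1 := hG _ (mem_uhp_add_mul_I (x := x) (Real.exp_pos t))
    rw [im_add_mul_I, le_div_iff₀ (Real.exp_pos t)] at h1
    exact h1

theorem norm_sub_le_of_im_eq {g : ℂ → ℂ} (hg : DifferentiableOn ℂ g uhp) {G : ℝ}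
    (hG0 : 0 ≤ G) (hG : ∀ z ∈ uhp, ‖deriv g z‖ ≤ G / z.im) (x x' : ℝ) {l : ℝ} (hl : 0 < l) :
    ‖g (x + l * Complex.I) - g (x' + l * Complex.I)‖ ≤ G / l * |x - x'| := by
  have := Convex.norm_image_sub_le_of_norm_deriv_le (𝕜 := ℂ) (f := g) (s := {z | l ≤ z.im})
    (x := x' + l * Complex.I) (y := x + l * Complex.I) (C := G / l)
    (fun z hz => hg.differentiableAt (isOpen_uhp.mem_nhds (hl.trans_le hz)))
    (fun z hz => (hG z (hl.trans_le hz)).trans (by gcongr; exact hz))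
    (convex_halfSpace_im_ge l) (by simp) (by simp)
  refine this.trans (le_of_eq ?_)
  congr 1
  rw [show (x : ℂ) + l * Complex.I - (x' + l * Complex.I) = ((x - x' : ℝ) : ℂ) by push_cast; ring,
    Complex.norm_real, Real.norm_eq_abs]

theorem norm_integral_sub_le {g : ℂ → ℂ} (hg : DifferentiableOn ℂ g uhp) {G : ℝ}
    (hG0 : 0 ≤ G) (hG : ∀ z ∈ uhp, ‖deriv g z‖ ≤ G / z.im) (a : ℝ) {y l : ℝ} (hy : 0 < y)
    (hyl : y ≤ l) :
    ‖(∫ x in a..(a + l), g (x + y * Complex.I)) - l * g ((a + l / 2 : ℝ) + l * Complex.I)‖ ≤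
      4 * G * l := by
  have hl : 0 < l := hy.trans_le hyl
  have hcont : ∀ {u : ℝ → ℂ} {s : Set ℝ}, Continuous u → (∀ t ∈ s, u t ∈ uhp) →
      ContinuousOn (fun t => g (u t)) s := fun hu hs =>
    hg.continuousOn.comp hu.continuousOn hs
  have hrect := Complex.integral_boundary_rect_eq_zero_of_differentiableOn g
    (a + y * Complex.I) ((a + l : ℝ) + l * Complex.I) (hg.mono (by
      intro z hz
      rw [Complex.mem_reProdIm] at hz
      have := hz.2
      rw [im_add_mul_I, im_add_mul_I, uIcc_of_le hyl] at this
      exact hy.trans_le this.1))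
  have hre : ∀ x y : ℝ, ((x : ℂ) + y * Complex.I).re = x := fun x y => by simp
  rw [hre, hre, im_add_mul_I, im_add_mul_I] at hrect
  simp only [smul_eq_mul] at hrect
  set T := ∫ x in a..(a + l), g (x + l * Complex.I) with hT
  set Rt := ∫ t in y..l, g ((a + l : ℝ) + t * Complex.I) with hRt
  set Lt := ∫ t in y..l, g (a + t * Complex.I) with hLt
  have hvert : ∀ b : ℝ, IntervalIntegrable (fun t : ℝ => g (b + t * Complex.I)) volume y l := by
    intro b
    refine (hcont (by fun_prop) fun t ht => ?_).intervalIntegrable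
    rw [uIcc_of_le hyl] at ht
    exact mem_uhp_add_mul_I (hy.trans_le ht.1)
  have hhor : IntervalIntegrable (fun t : ℝ => g (t + l * Complex.I)) volume a (a + l) :=
    (hcont (by fun_prop) fun t _ => mem_uhp_add_mul_I hl).intervalIntegrable
  have e1 : T - l * g ((a + l / 2 : ℝ) + l * Complex.I) =
      ∫ x in a..(a + l), (g (x + l * Complex.I) - g ((a + l / 2 : ℝ) + l * Complex.I)) := by
    rw [intervalIntegral.integral_sub hhor (by simp), intervalIntegral.integral_const, hT]
    simp
  have b1 : ‖T - l * g ((a + l / 2 : ℝ) + l * Complex.I)‖ ≤ G * l := by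
    rw [e1]
    have := intervalIntegral.norm_integral_le_of_norm_le_const (a := a) (b := a + l) (C := G)
      (f := fun x : ℝ => g (x + l * Complex.I) - g ((a + l / 2 : ℝ) + l * Complex.I))
      (fun x hx => ?_)
    · simpa [abs_of_pos hl] using this
    · rw [uIoc_of_le (by linarith)] at hx
      refine (norm_sub_le_of_im_eq hg hG0 hG _ _ hl).trans ?_
      have : |x - (a + l / 2)| ≤ l := by rw [abs_le]; constructor <;> linarith [hx.1, hx.2]
      calc G / l * |x - (a + l / 2)| ≤ G / l * l := by gcongr
        _ = G := by field_simp
  have e2 : Rt - Lt = ∫ t in y..l, (g ((a + l : ℝ) + t * Complex.I) - g (a + t * Complex.I)) :=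
    (intervalIntegral.integral_sub (hvert _) (hvert _)).symm
  have hlogi : IntervalIntegrable (fun t => G + 2 * G * (Real.log l - Real.log t)) volume y l := by
    apply IntervalIntegrable.add (by simp)
    exact ((by simp : IntervalIntegrable (fun _ => Real.log l) volume y l).sub
      intervalIntegral.intervalIntegrable_log').const_mul _
  have b2 : ‖Rt - Lt‖ ≤ 3 * G * l := by
    rw [e2]
    refine (intervalIntegral.norm_integral_le_of_norm_le hyl (Filter.Eventually.of_forall
      fun t ht => ?_) hlogi).trans ?_
    · have ht0 : 0 < t := hy.trans ht.1
      have h1 := norm_sub_le_mul_log hg hG (a + l) ht0 ht.2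
      have h2 := norm_sub_le_mul_log hg hG a ht0 ht.2
      have h3 := norm_sub_le_of_im_eq hg hG0 hG (a + l) a hl
      rw [add_sub_cancel_left, abs_of_pos hl, div_mul_cancel₀ _ hl.ne'] at h3
      have e : g ((a + l : ℝ) + t * Complex.I) - g (a + t * Complex.I) =
          (g ((a + l : ℝ) + t * Complex.I) - g ((a + l : ℝ) + l * Complex.I)) +
          (g ((a + l : ℝ) + l * Complex.I) - g (a + l * Complex.I)) -
          (g (a + t * Complex.I) - g (a + l * Complex.I)) := by ring
      rw [e]
      refine (norm_sub_le _ _).trans ((add_le_add_left (norm_add_le _ _) _).trans ?_)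
      linarith
    · rw [intervalIntegral.integral_add (by simp) (((by simp :
        IntervalIntegrable (fun _ => Real.log l) volume y l).sub
        intervalIntegral.intervalIntegrable_log').const_mul _),
        intervalIntegral.integral_const_mul, intervalIntegral.integral_sub (by simp)
        intervalIntegral.intervalIntegrable_log', intervalIntegral.integral_const,
        intervalIntegral.integral_const, integral_log, smul_eq_mul, smul_eq_mul]
      have h1 := Real.log_le_log hy hyl
      have h2 : 0 ≤ G * (y * (Real.log l - Real.log y)) :=
        mul_nonneg hG0 (mul_nonneg hy.le (by linarith))
      have h3 : 0 ≤ G * y := by positivity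
      nlinarith
  have e3 : (∫ x in a..(a + l), g (x + y * Complex.I)) = T - Complex.I * (Rt - Lt) := by
    linear_combination hrect
  rw [e3, show T - Complex.I * (Rt - Lt) - l * g ((a + l / 2 : ℝ) + l * Complex.I) =
    (T - l * g ((a + l / 2 : ℝ) + l * Complex.I)) - Complex.I * (Rt - Lt) by ring]
  refine (norm_sub_le _ _).trans ?_
  rw [norm_mul, Complex.norm_I, one_mul]
  linarith

/-- The dyadic martingale of a conformal map at scale `(1 / 2) ^ N`. -/
theorem ConformalUHP.exists_additive {f ψ : ℂ → ℂ} {Ω : Set ℂ} (h : ConformalUHP f ψ Ω) (N : ℕ) :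
    ∃ X : ℕ → ℕ → ℝ, (∀ n k, X n k = X (n + 1) (2 * k) + X (n + 1) (2 * k + 1)) ∧
      ∀ n k, n ≤ N → |X n k - (1 / 2) ^ n * Real.log ‖deriv f (treePt n k)‖| ≤
        3072 * Real.pi * distortion 2 * (1 / 2) ^ n := by
  obtain ⟨g, hg, hre, hG⟩ := h.exists_log_deriv
  have hG0 : 0 ≤ 768 * Real.pi * distortion 2 := by
    have := Real.pi_pos; have := distortion_pos 2; positivity
  set y : ℝ := (1 / 2) ^ N with hy
  have hy0 : 0 < y := by positivity
  have hcont : Continuous fun x : ℝ => g (x + y * Complex.I) :=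
    hg.continuousOn.comp_continuous (by fun_prop) fun t => mem_uhp_add_mul_I hy0
  refine ⟨fun n k => (∫ x in (k * (1 / 2) ^ n : ℝ)..(k * (1 / 2) ^ n + (1 / 2) ^ n : ℝ),
    g (x + y * Complex.I)).re, fun n k => ?_, fun n k hn => ?_⟩
  · simp only
    rw [← Complex.add_re]
    congr 1
    have e1 : (((2 * k : ℕ) : ℝ) * (1 / 2) ^ (n + 1)) = k * (1 / 2) ^ n := by
      push_cast; ring
    have e2 : (((2 * k + 1 : ℕ) : ℝ) * (1 / 2) ^ (n + 1)) =
        k * (1 / 2) ^ n + (1 / 2) ^ (n + 1) := by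
      push_cast; ring
    have e3 : (k * (1 / 2) ^ n + (1 / 2) ^ (n + 1) + (1 / 2) ^ (n + 1) : ℝ) =
        k * (1 / 2) ^ n + (1 / 2) ^ n := by ring
    rw [e1, e2, e3]
    exact (intervalIntegral.integral_add_adjacent_intervals (hcont.intervalIntegrable _ _)
      (hcont.intervalIntegrable _ _)).symm
  · have hyn : y ≤ (1 / 2) ^ n := pow_le_pow_of_le_one (by norm_num) (by norm_num) hn
    have h1 := norm_integral_sub_le hg hG0 hG (k * (1 / 2) ^ n) hy0 hyn
    have e : (((k * (1 / 2) ^ n + (1 / 2) ^ n / 2 : ℝ) : ℂ) + ((1 / 2) ^ n : ℝ) * Complex.I) =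
        treePt n k := by
      rw [treePt, treeX]; push_cast; ring
    rw [e] at h1
    have h2 := (Complex.abs_re_le_norm _).trans h1
    rw [Complex.sub_re, Complex.re_ofReal_mul, hre _ (treePt_mem n k)] at h2
    refine h2.trans (le_of_eq ?_)
    ring

/-! ### Chord-arc subdomains and the dyadic tree -/

/-- The distance to the boundary at the top of a dyadic box. -/
noncomputable def treeDist (F : ℂ → ℂ) (Ω : Set ℂ) (n k : ℕ) : ℝ :=
  infDist (F (treePt n k)) (frontier Ω)

theorem treeBox_subset_of_mem_treeBelow {d n k : ℕ} {t : ℕ × ℕ} (h : t ∈ treeBelow d n k) :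
    treeBox t.1 t.2 ⊆ treeBox n k := by
  induction d generalizing n k with
  | zero =>
    simp only [treeBelow, Finset.mem_singleton] at h
    subst h; exact Subset.refl _
  | succ d ih =>
    simp only [treeBelow, Finset.mem_insert, Finset.mem_union] at h
    rcases h with rfl | h | h
    · exact Subset.refl _
    · exact (ih h).trans (treeBox_child (Or.inl rfl))
    · exact (ih h).trans (treeBox_child (Or.inr rfl))

theorem half_pow_le_one (n : ℕ) : (1 / 2 : ℝ) ^ n ≤ 1 := pow_le_one₀ (by norm_num) (by norm_num)

theorem half_pow_pos (n : ℕ) : (0 : ℝ) < (1 / 2) ^ n := by positivity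

theorem treePt_mem_treeBox (n k : ℕ) : treePt n k ∈ treeBox n k := by
  refine ⟨?_, treePt_mem n k, (treePt_im n k).le⟩
  rw [treePt_re, sub_self, abs_zero]; have := half_pow_pos n; positivity

theorem exists_mem_frontier_le_dist {W : Set ℂ} (hW : IsOpen W) (hb : Bornology.IsBounded W)
    (y : ℂ) {r : ℝ} (hr0 : 0 ≤ r) (hr : 2 * r < diam W) : ∃ x ∈ frontier W, r ≤ dist y x := by
  by_contra! hcon
  have hsub : W ⊆ closedBall y r := by
    intro w hw
    by_contra hwr
    rw [mem_closedBall, not_le] at hwr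
    have hray : IsPreconnected ((fun t : ℝ => y + t * (w - y)) '' Ici 1) :=
      isPreconnected_Ici.image _ (by fun_prop)
    have hWs := hray.subset_of_disjoint_frontier hW ?_ ⟨w, ⟨1, by simp, by simp⟩, hw⟩
    · obtain ⟨R, hR0, hR⟩ := hb.subset_ball_lt 0 y
      have hd : 0 < dist w y := by linarith
      have h1 : 1 ≤ 1 + R / dist w y := by have := div_pos hR0 hd; linarith
      have h2 := hR (hWs ⟨1 + R / dist w y, h1, rfl⟩)
      rw [mem_ball, dist_eq_norm, add_sub_cancel_left, norm_mul, Complex.norm_real,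
        ← dist_eq_norm w y] at h2
      rw [Real.norm_of_nonneg (by linarith), add_mul, div_mul_cancel₀ _ hd.ne'] at h2
      linarith
    · rintro z ⟨t, ht, rfl⟩ hz
      have h2 := hcon _ hz
      rw [dist_self_add_right, norm_mul, Complex.norm_real, ← dist_eq_norm w y] at h2
      have h3 : (1 : ℝ) ≤ t := ht
      rw [Real.norm_of_nonneg (by linarith)] at h2
      nlinarith
  have := (diam_mono hsub isBounded_closedBall).trans (diam_closedBall hr0)
  linarith

theorem exists_mem_le_dist {W : Set ℂ} (x : ℂ) {r : ℝ} (hr0 : 0 ≤ r) (hr : 2 * r < diam W) :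
    ∃ q ∈ W, r ≤ dist q x := by
  by_contra! hcon
  have hsub : W ⊆ closedBall x r := fun w hw => (hcon w hw).le
  have := (diam_mono hsub isBounded_closedBall).trans (diam_closedBall hr0)
  linarith

namespace BoxMap

variable {C₁ : ℝ} {lam : ℝ → ℝ} {L : ℕ → ℝ} {D₀ : ℕ} {F ψ : ℂ → ℂ} {Ω : Set ℂ}

theorem treeDist_pos (h : BoxMap C₁ lam L D₀ F ψ Ω) (n k : ℕ) : 0 < treeDist F Ω n k :=
  h.pos (h.mem (treePt_mem n k))

theorem dist_treePt_le (h : BoxMap C₁ lam L D₀ F ψ Ω) (hD : 1 ≤ D₀) {n k : ℕ} {p : ℂ}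
    (hp : p ∈ treeBox n k) : dist (F p) (F (treePt n k)) ≤ C₁ * treeDist F Ω n k :=
  h.box _ _ (half_pow_pos n) ((half_pow_le_one n).trans (by exact_mod_cast hD)) p
    (treeBox_subset n k hp) (dist_treeX_lt hp)

theorem treeDist_le (h : BoxMap C₁ lam L D₀ F ψ Ω) (hD : 1 ≤ D₀) {n k i l : ℕ}
    (hs : treeBox i l ⊆ treeBox n k) : treeDist F Ω i l ≤ (1 + C₁) * treeDist F Ω n k := by
  have h1 := h.dist_treePt_le hD (hs (treePt_mem_treeBox i l))
  have h2 : treeDist F Ω i l ≤ treeDist F Ω n k + _ := infDist_le_infDist_add_dist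
    (x := F (treePt i l)) (y := F (treePt n k)) (s := frontier Ω)
  linarith

theorem dist_treePt_le_of_dist_lt (h : BoxMap C₁ lam L D₀ F ψ Ω) {n k : ℕ} {R : ℝ} (hC : 1 ≤ C₁)
    (hR : 1 ≤ R) (hRD : R ≤ D₀) {p : ℂ} (hp : p ∈ uhp)
    (hpx : dist p (treeX n k) < 2 * (R * (1 / 2) ^ n)) :
    dist (F p) (F (treePt n k)) ≤ 2 * C₁ * distortion R * treeDist F Ω n k := by
  have hl := half_pow_pos n
  have hl1 := half_pow_le_one n
  have hy : 0 < R * (1 / 2) ^ n := by positivity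
  have hyD : R * (1 / 2) ^ n ≤ D₀ := by nlinarith
  have hq : (treeX n k + (R * (1 / 2) ^ n : ℝ) * Complex.I : ℂ) ∈ whitney R (treePt n k) := by
    refine ⟨?_, ?_, ?_⟩
    · have e : ((treeX n k : ℂ) + (R * (1 / 2) ^ n : ℝ) * Complex.I).re = treeX n k := by
        rw [Complex.add_re, Complex.re_ofReal_mul, Complex.ofReal_re, Complex.I_re, mul_zero,
          add_zero]
      rw [treePt_re, treePt_im, e, sub_self, abs_zero]
      exact hy.le
    · rw [treePt_im, im_add_mul_I]; nlinarith [mul_le_mul hR hR (by norm_num) (by linarith)]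
    · rw [treePt_im, im_add_mul_I]
  have h1 := (h.whitney_infDist hR (treePt_mem n k) hq).1
  have h2 := h.box _ _ hy hyD p hp hpx
  have h3 := h.box (treeX n k) _ hy hyD (treePt n k) (treePt_mem n k) (by
    rw [treePt, dist_add_mul_I_ofReal hl.le]; nlinarith)
  have h4 := dist_triangle_right (F p) (F (treePt n k))
    (F (treeX n k + (R * (1 / 2) ^ n : ℝ) * Complex.I))
  have h5 : C₁ * infDist (F (treeX n k + (R * (1 / 2) ^ n : ℝ) * Complex.I)) (frontier Ω) ≤
      C₁ * (distortion R * treeDist F Ω n k) := by gcongr; exact h1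
  linarith

end BoxMap

/-- A chord-arc subdomain of the root box that is large compared with all dyadic boxes. -/
structure ChordArcIn (κ k : ℝ) (F : ℂ → ℂ) (Ω W : Set ℂ) : Prop where
  isOpen : IsOpen W
  isConnected : IsConnected W
  subset : W ⊆ Ω
  arc : IsChordArcWith (frontier W) k
  sub_box : ∀ p ∈ uhp, F p ∈ W → p ∈ treeBox 0 0
  big : ∀ n l, treeBox n l ⊆ treeBox 0 0 → 2 * (κ * treeDist F Ω n l) < diam W

/-- The Whitney neighbourhood of a node of the root box meets the subdomain. -/
def NodeInside (A : ℝ) (F : ℂ → ℂ) (W : Set ℂ) (n k : ℕ) : Prop :=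
  treeBox n k ⊆ treeBox 0 0 ∧ ∃ p ∈ whitney A (treePt n k), F p ∈ W

/-- A box whose closure meets the common boundary corresponds to a node inside the subdomain. -/
theorem exists_nodeInside {C₁ : ℝ} {lam : ℝ → ℝ} {L : ℕ → ℝ}
    (hlam : ∀ ε, 0 < ε → 0 < lam ε) (hL : ∀ D', 1 ≤ D' → 1 ≤ L D') {κ k : ℝ} (hκ : 0 < κ)
    (hκ1 : κ ≤ 1) (hk : 1 < k) :
    ∃ A : ℝ, 1 ≤ A ∧ ∃ D₁ : ℕ, ∀ D₀ : ℕ, D₁ ≤ D₀ → ∀ F ψ Ω, BoxMap C₁ lam L D₀ F ψ Ω →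
      ∀ W, ChordArcIn κ k F Ω W → ∀ n l, treeBox n l ⊆ treeBox 0 0 →
        (frontier Ω ∩ frontier W ∩ closure (F '' treeBox n l)).Nonempty →
          NodeInside A F W n l := by
  set D' : ℕ := ⌈C₁⌉₊ + 1 with hD'
  set Λ := L D' with hΛ
  have hΛ1 : 1 ≤ Λ := hL D' (by omega)
  set E := Real.exp (96 * Real.pi * Λ) with hE
  have hE0 : 0 < E := Real.exp_pos _
  set ε := κ / (97 * (k + 1) * E) with hε
  have hε0 : 0 < ε := by positivity
  refine ⟨max Λ (1 / lam ε), le_max_of_le_left hΛ1, D', ?_⟩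
  intro D₀ hD₀ F ψ Ω h W hW n l hs hne
  obtain ⟨x, ⟨hxΩ, hxW⟩, hx⟩ := hne
  have hD1 : 1 ≤ D₀ := by omega
  have hl := half_pow_pos n
  have hl1 := half_pow_le_one n
  set δ := treeDist F Ω n l with hδ
  have hδ0 : 0 < δ := h.treeDist_pos n l
  have hxd : dist x (F (treePt n l)) ≤ C₁ * δ := by
    refine closure_minimal (t := closedBall (F (treePt n l)) (C₁ * δ)) ?_ isClosed_closedBall hx
    rintro _ ⟨p, hp, rfl⟩
    exact h.dist_treePt_le hD1 hp
  obtain ⟨w, hw, hwx, hwd⟩ := (hW.arc.boundedTurning hk).exists_corkscrew hW.isOpen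
    hW.isConnected.isPreconnected hW.arc.1.isCompact (by linarith) hxW (r := κ * δ)
    (by positivity) (exists_mem_le_dist x (by positivity) (hW.big n l hs))
  have hwΩ : w ∈ Ω := hW.subset hw
  set p := ψ w with hp
  have hpu : p ∈ uhp := h.map_mem hwΩ
  have hFp : F p = w := h.right hwΩ
  have hδp : κ * δ / (96 * (k + 1)) ≤ infDist (F p) (frontier Ω) := by
    rw [hFp]
    refine hwd.trans ((le_infDist h.ne).2 fun y hy => ?_)
    by_contra! hcon
    have : y ∈ W := ball_infDist_frontier_subset hW.isOpen hw (by
      rw [mem_ball, dist_comm]; exact hcon)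
    exact disjoint_left.1 h.isOpen.disjoint_frontier (hW.subset this) hy
  have hdist : dist (F p) (F (treePt n l)) ≤ D' * δ := by
    rw [hFp]
    have h1 := dist_triangle w x (F (treePt n l))
    have h2 : C₁ ≤ ⌈C₁⌉₊ := Nat.le_ceil _
    have h3 : ((D' : ℕ) : ℝ) = ⌈C₁⌉₊ + 1 := by rw [hD']; push_cast; ring
    rw [h3]
    nlinarith
  have hj : dist p (treeX n l) ≤ Λ * (1 / 2) ^ n :=
    h.joint D' (by omega) hD₀ _ _ hl hl1 p hpu hdist
  rw [dist_eq_norm] at hj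
  have hre := (Complex.abs_re_le_norm (p - treeX n l)).trans hj
  have him := (Complex.abs_im_le_norm (p - treeX n l)).trans hj
  simp only [Complex.sub_re, Complex.ofReal_re, Complex.sub_im, Complex.ofReal_im, sub_zero]
    at hre him
  have hp0 : 0 < p.im := hpu
  rw [abs_of_pos hp0] at him
  have hlow : lam ε * (1 / 2) ^ n < p.im := by
    by_contra! hcon
    have h1 := h.decay ε hε0 p.re p.im ((1 / 2) ^ n) hp0 hcon (hl1.trans (by exact_mod_cast hD1))
    rw [Complex.re_add_im] at h1
    have h2 := h.harnack (p := p.re + ((1 / 2 : ℝ) ^ n : ℝ) * Complex.I) (q := treePt n l) hl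
      (by rw [im_add_mul_I]) (by rw [treePt_im])
    have h3 : dist ((p.re : ℂ) + ((1 / 2 : ℝ) ^ n : ℝ) * Complex.I) (treePt n l) =
        |p.re - treeX n l| := by
      rw [treePt, dist_eq_norm, show (p.re : ℂ) + ((1 / 2 : ℝ) ^ n : ℝ) * Complex.I -
        (treeX n l + ((1 / 2 : ℝ) ^ n : ℝ) * Complex.I) = ((p.re - treeX n l : ℝ) : ℂ) by
          push_cast; ring, Complex.norm_real, Real.norm_eq_abs]
    have h4 : infDist (F (p.re + ((1 / 2 : ℝ) ^ n : ℝ) * Complex.I)) (frontier Ω) ≤ E * δ := by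
      refine h2.trans (mul_le_mul_of_nonneg_right (Real.exp_le_exp.2 ?_) infDist_nonneg)
      rw [h3, div_le_iff₀ hl]
      have := Real.pi_pos
      calc 96 * Real.pi * |p.re - treeX n l| ≤ 96 * Real.pi * (Λ * (1 / 2) ^ n) := by gcongr
        _ = _ := by ring
    have h5 : κ * δ / (96 * (k + 1)) ≤ ε * (E * δ) :=
      hδp.trans (h1.trans (by gcongr))
    have h6 : ε * (E * δ) = κ * δ / (97 * (k + 1)) := by rw [hε]; field_simp
    rw [h6] at h5
    have h7 : κ * δ / (97 * (k + 1)) < κ * δ / (96 * (k + 1)) := by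
      apply div_lt_div_of_pos_left <;> nlinarith [mul_pos hκ hδ0]
    linarith
  refine ⟨hs, p, ⟨?_, ?_, ?_⟩, by rw [hFp]; exact hw⟩
  · rw [treePt_re, treePt_im]
    exact hre.trans (mul_le_mul_of_nonneg_right (le_max_left _ _) hl.le)
  · rw [treePt_im]
    have h1 : (1 / 2 : ℝ) ^ n ≤ 1 / lam ε * p.im := by
      rw [← div_le_iff₀' (by have := hlam ε hε0; positivity), div_div_eq_mul_div, div_one]
      linarith
    exact h1.trans (mul_le_mul_of_nonneg_right (le_max_right _ _) hp0.le)
  · rw [treePt_im]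
    exact him.trans (mul_le_mul_of_nonneg_right (le_max_left _ _) hl.le)

theorem isCompact_whitney {A : ℝ} (hA : 1 ≤ A) {q : ℂ} (hq : q ∈ uhp) :
    IsCompact (whitney A q) := by
  refine (isCompact_closedBall q (2 * A * q.im)).of_isClosed_subset ?_
    fun p hp => dist_le_of_mem_whitney hA hq hp
  have e : whitney A q = {p : ℂ | |p.re - q.re| ≤ A * q.im} ∩
      ({p : ℂ | q.im ≤ A * p.im} ∩ {p : ℂ | p.im ≤ A * q.im}) := rfl
  rw [e]
  refine (isClosed_le ?_ continuous_const).inter ((isClosed_le continuous_const ?_).inter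
    (isClosed_le ?_ continuous_const))
  · exact (Complex.continuous_re.sub continuous_const).abs
  · exact continuous_const.mul Complex.continuous_im
  · exact Complex.continuous_im

/-- A family of sets with bounded overlap meets a chord-arc curve in bounded total length. -/
theorem IsChordArcWith.sum_measure_le {Γ : Set ℂ} {k : ℝ} (hΓ : IsChordArcWith Γ k) (hk : 1 < k)
    {ι : Type*} {S : Finset ι} {B : ι → Set ℂ} {K : ℕ} {x : ℂ} {r : ℝ} (hr : 0 < r)
    (hB : ∀ i ∈ S, MeasurableSet (B i)) (hsub : ∀ i ∈ S, B i ⊆ closedBall x r)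
    (hK : ∀ z, ∀ T ⊆ S, (∀ i ∈ T, z ∈ B i) → T.card ≤ K) :
    ∑ i ∈ S, (μH[1] (Γ ∩ B i)).toReal ≤ K * (4 * (k + 1) * r) := by
  have h1 := sum_measure_le_of_card_le (μ := (μH[1] : Measure ℂ).restrict Γ) hB hsub
    measurableSet_closedBall hK
  have e : ∀ i ∈ S, (μH[1] : Measure ℂ).restrict Γ (B i) = μH[1] (Γ ∩ B i) := fun i hi => by
    rw [Measure.restrict_apply (hB i hi), inter_comm]
  rw [Finset.sum_congr rfl e, Measure.restrict_apply measurableSet_closedBall, inter_comm] at h1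
  rw [← ENNReal.toReal_sum fun i _ => ((measure_mono inter_subset_left).trans_lt hΓ.2.1).ne]
  have h2 : (K : ℝ≥0∞) * μH[1] (Γ ∩ closedBall x r) ≤
      ENNReal.ofReal (K * (4 * (k + 1) * r)) := by
    rw [ENNReal.ofReal_mul (by positivity), ENNReal.ofReal_natCast]
    gcongr
    exact hΓ.measure_closedBall_le hk x hr
  exact ENNReal.toReal_le_of_le_ofReal (by positivity) (h1.trans h2)

namespace ChordArcIn

variable {C₁ : ℝ} {lam : ℝ → ℝ} {L : ℕ → ℝ} {D₀ : ℕ} {F ψ : ℂ → ℂ} {Ω W : Set ℂ} {κ k : ℝ}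

theorem isBounded (hW : ChordArcIn κ k F Ω W) (h : BoxMap C₁ lam L D₀ F ψ Ω) (hD : 1 ≤ D₀) :
    Bornology.IsBounded W := by
  refine (isBounded_closedBall (x := F (treePt 0 0)) (r := C₁ * treeDist F Ω 0 0)).subset ?_
  intro w hw
  have hwΩ := hW.subset hw
  have := h.dist_treePt_le hD (hW.sub_box (ψ w) (h.map_mem hwΩ) (by rwa [h.right hwΩ]))
  rwa [h.right hwΩ] at this

theorem le_measure_ball (hW : ChordArcIn κ k F Ω W) (h : BoxMap C₁ lam L D₀ F ψ Ω) (hD : 1 ≤ D₀)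
    {n l : ℕ} (hs : treeBox n l ⊆ treeBox 0 0) (hκ : 0 < κ) {y : ℂ} (hy : y ∈ frontier W) {r : ℝ}
    (hr : r ≤ κ * treeDist F Ω n l) : ENNReal.ofReal r ≤ μH[1] (frontier W ∩ ball y r) := by
  have h0 := h.treeDist_pos n l
  obtain ⟨x, hx, hxy⟩ := exists_mem_frontier_le_dist hW.isOpen (hW.isBounded h hD) y
    (by positivity) (hW.big n l hs)
  exact hW.arc.le_measure_ball hy hx (hr.trans hxy)

theorem exit (hW : ChordArcIn κ k F Ω W) (h : BoxMap C₁ lam L D₀ F ψ Ω) (hD : 1 ≤ D₀)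
    (hκ : 0 < κ) {A : ℝ} (hA : 1 ≤ A) {κ' : ℝ} (hκ' : κ' ≤ κ)
    (hκH : κ' ≤ 1 / (9 * distortion (3 * A)))
    {n l l' : ℕ} (hin : NodeInside A F W n l) (hl : l' = 2 * l ∨ l' = 2 * l + 1)
    (hout : ¬ NodeInside A F W (n + 1) l') :
    ENNReal.ofReal (κ' * treeDist F Ω (n + 1) l') ≤
      μH[1] (frontier W ∩ F '' whitney (4 * A) (treePt (n + 1) l')) := by
  obtain ⟨hs, p, hp, hpW⟩ := hin
  have hs' : treeBox (n + 1) l' ⊆ treeBox 0 0 := (treeBox_child hl).trans hs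
  have h3A : (0 : ℝ) < 3 * A := by linarith
  set z := treePt (n + 1) l' with hz
  have hzu : z ∈ uhp := treePt_mem _ _
  have hzim : 0 < z.im := hzu
  have hzW : F z ∉ W := fun hcon => hout ⟨hs', z, mem_whitney_self hA hzu, hcon⟩
  have hsub3 := whitney_subset_uhp h3A hzu
  have hpre : IsPreconnected (F '' whitney (3 * A) z) :=
    (convex_whitney _ _).isPreconnected.image _ (h.diff.continuousOn.mono hsub3)
  have hmeet : ¬ F '' whitney (3 * A) z ⊆ (frontier W)ᶜ := fun hcon =>
    hzW (hpre.subset_of_disjoint_frontier hW.isOpen hcon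
      ⟨F p, ⟨p, whitney_parent hl hA hp, rfl⟩, hpW⟩
      ⟨z, mem_whitney_self (by linarith) hzu, rfl⟩)
  rw [not_subset] at hmeet
  obtain ⟨_, ⟨q, hq, rfl⟩, hqΓ⟩ := hmeet
  rw [notMem_compl_iff] at hqΓ
  have hqu : q ∈ uhp := hsub3 hq
  have hqim : 0 < q.im := hqu
  have hH := distortion_pos (3 * A)
  have hδ := h.treeDist_pos (n + 1) l'
  have hr : κ' * treeDist F Ω (n + 1) l' ≤ infDist (F q) (frontier Ω) / 9 := by
    have h1 := (h.whitney_infDist (by linarith) hzu hq).2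
    calc κ' * treeDist F Ω (n + 1) l' ≤ 1 / (9 * distortion (3 * A)) *
          (distortion (3 * A) * infDist (F q) (frontier Ω)) := by
          gcongr
          exact h1
      _ = _ := by field_simp
  refine (hW.le_measure_ball h hD hs' hκ hqΓ (by gcongr)).trans (measure_mono ?_)
  refine inter_subset_inter_right _ fun w hw => ?_
  have hwb : w ∈ ball (F q) (infDist (F q) (frontier Ω) / 9) := ball_subset_ball hr hw
  have hwΩ : w ∈ Ω := h.ball_subset (h.mem hqu) (ball_subset_ball (by
    have := h.pos (h.mem hqu); linarith) hwb)
  have hd := h.dist_le_of_mem_ball hqu hwb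
  rw [dist_eq_norm] at hd
  have h1 := (Complex.abs_re_le_norm (ψ w - q)).trans hd
  have h2 := (Complex.abs_im_le_norm (ψ w - q)).trans hd
  rw [Complex.sub_re, abs_le] at h1
  rw [Complex.sub_im, abs_le] at h2
  obtain ⟨h3, h4, h5⟩ := hq
  rw [abs_le] at h3
  refine ⟨ψ w, ⟨abs_le.2 ⟨?_, ?_⟩, ?_, ?_⟩, h.right hwΩ⟩
  · linarith
  · linarith
  · nlinarith
  · linarith

theorem survive (hW : ChordArcIn κ k F Ω W) (h : BoxMap C₁ lam L D₀ F ψ Ω) (hC₁ : 1 ≤ C₁)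
    (hD : 1 ≤ D₀) (hκ : 0 < κ) (hκ1 : κ ≤ 1) {A : ℝ} (hA : 1 ≤ A) (hAD : 5 * A ≤ D₀)
    {n l : ℕ} (hin : NodeInside A F W n l) :
    ENNReal.ofReal (κ * treeDist F Ω n l) ≤ μH[1] (frontier W ∩ closedBall (F (treePt n l))
      ((2 * C₁ * distortion (5 * A) + distortion A + 1) * treeDist F Ω n l)) := by
  obtain ⟨hs, p, hp, hpW⟩ := hin
  have hzu := treePt_mem n l
  have hpu : p ∈ uhp := whitney_subset_uhp (by linarith) hzu hp
  have hl := half_pow_pos n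
  have hδ := h.treeDist_pos n l
  have hpz : dist (F p) (F (treePt n l)) ≤ 2 * C₁ * distortion (5 * A) * treeDist F Ω n l := by
    refine h.dist_treePt_le_of_dist_lt hC₁ (by linarith) hAD hpu ?_
    have h1 := dist_le_of_mem_whitney hA hzu hp
    have h2 : dist (treePt n l) (treeX n l) = (1 / 2) ^ n := dist_add_mul_I_ofReal hl.le
    have h3 := dist_triangle p (treePt n l) (treeX n l)
    rw [treePt_im] at h1
    nlinarith
  obtain ⟨X, hX, hXd⟩ := h.exists_nearest (F p)
  have hXW : X ∉ W := fun hcon => disjoint_left.1 h.isOpen.disjoint_frontier (hW.subset hcon) hX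
  have hmeet : ¬ segment ℝ (F p) X ⊆ (frontier W)ᶜ := fun hcon =>
    hXW ((convex_segment (F p) X).isPreconnected.subset_of_disjoint_frontier hW.isOpen hcon
      ⟨F p, left_mem_segment _ _ _, hpW⟩ (right_mem_segment _ _ _))
  rw [not_subset] at hmeet
  obtain ⟨y, hy, hyΓ⟩ := hmeet
  rw [notMem_compl_iff] at hyΓ
  have hyp : dist y (F p) ≤ distortion A * treeDist F Ω n l := by
    have h1 : dist y (F p) ≤ dist (F p) X := by
      have := dist_add_dist_of_mem_segment hy
      rw [dist_comm y]
      linarith [dist_nonneg (x := y) (y := X)]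
    rw [hXd] at h1
    exact h1.trans (h.whitney_infDist hA hzu hp).1
  refine (hW.le_measure_ball h hD hs hκ hyΓ le_rfl).trans (measure_mono ?_)
  refine inter_subset_inter_right _ fun w hw => ?_
  rw [mem_ball] at hw
  rw [mem_closedBall]
  have h1 := dist_triangle4 w y (F p) (F (treePt n l))
  nlinarith

end ChordArcIn

/-- The reverse Jensen type bound for the sums of the lengths of the image boxes over the nodes
that leave a chord-arc subdomain. -/
theorem exists_treeSum_nodeInside_le {C₁ : ℝ} {lam : ℝ → ℝ} {L : ℕ → ℝ} (hC₁ : 1 ≤ C₁)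
    {κ k A : ℝ} (hκ : 0 < κ) (hκ1 : κ ≤ 1) (hk : 1 < k) (hA : 1 ≤ A) :
    ∃ Cr : ℝ, 1 ≤ Cr ∧ ∃ D₁ : ℕ, ∀ D₀ : ℕ, D₁ ≤ D₀ → ∀ F ψ Ω, BoxMap C₁ lam L D₀ F ψ Ω →
      ∀ W, ChordArcIn κ k F Ω W → ∀ d n l N, n + d = N → NodeInside A F W n l →
        treeSum (fun n l => ¬ NodeInside A F W n l)
          (fun n l => ‖deriv F (treePt n l)‖ * (1 / 2) ^ n) d n l ≤
            Cr * (‖deriv F (treePt n l)‖ * (1 / 2) ^ n) := by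
  set κ' := min κ (1 / (9 * distortion (3 * A))) with hκ'def
  have hκ' : 0 < κ' := lt_min hκ (by have := distortion_pos (3 * A); positivity)
  set C5 := 2 * C₁ * distortion (5 * A) + distortion A + 1 with hC5
  have hd5 := distortion_pos (5 * A)
  have hdA := distortion_pos A
  have hC50 : 0 < C5 := by positivity
  set C7 := 2 * C₁ * distortion (5 * A) + C₁ + C5 * (1 + C₁) with hC7
  have hC70 : 0 < C7 := by positivity
  obtain ⟨K₁, hK₁⟩ := exists_card_whitney_le (A := 4 * A) (by linarith)
  set D' : ℕ := ⌈2 * C5⌉₊ + 1 with hD'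
  set K₂ : ℕ := ⌈2 * L D'⌉₊ + 1 with hK₂
  set c := 96 * Real.pi / κ' with hc
  have hπ := Real.pi_pos
  have hc0 : 0 < c := by positivity
  refine ⟨c * ((K₁ + K₂) * (4 * (k + 1) * C7)) * 2 + 1, ?_, D' + ⌈5 * A⌉₊, ?_⟩
  · have : 0 ≤ c * ((K₁ + K₂) * (4 * (k + 1) * C7)) * 2 := by positivity
    linarith
  intro D₀ hD₀ F ψ Ω h W hW d n l N hN hin
  have hD1 : 1 ≤ D₀ := by omega
  have hD5 : 5 * A ≤ D₀ := (Nat.le_ceil _).trans (by exact_mod_cast (by omega : ⌈5 * A⌉₊ ≤ D₀))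
  set δ := treeDist F Ω n l with hδ
  have hδ0 : 0 < δ := h.treeDist_pos n l
  have hfin : ∀ B : Set ℂ, μH[1] (frontier W ∩ B) ≠ ∞ := fun B =>
    ((measure_mono inter_subset_left).trans_lt hW.arc.2.1).ne
  set B₁ : ℕ × ℕ → Set ℂ := fun t => F '' whitney (4 * A) (treePt t.1 t.2) with hB₁
  set B₂ : ℕ × ℕ → Set ℂ := fun t => if t.1 = N then
    closedBall (F (treePt t.1 t.2)) (C5 * treeDist F Ω t.1 t.2) else ∅ with hB₂
  have hkoebe : ∀ i j (B : Set ℂ), ENNReal.ofReal (κ' * treeDist F Ω i j) ≤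
      μH[1] (frontier W ∩ B) → ‖deriv F (treePt i j)‖ * (1 / 2) ^ i ≤
        c * (μH[1] (frontier W ∩ B)).toReal := by
    intro i j B hB
    have h1 := h.koebe (treePt_mem i j)
    rw [treePt_im] at h1
    have h2 := (ENNReal.ofReal_le_iff_le_toReal (hfin B)).1 hB
    calc ‖deriv F (treePt i j)‖ * (1 / 2) ^ i ≤ 96 * Real.pi * treeDist F Ω i j := by
          rw [mul_comm]; exact h1
      _ = c * (κ' * treeDist F Ω i j) := by rw [hc]; field_simp
      _ ≤ _ := by gcongr
  have hsum := treeSum_le_sum (inside := NodeInside A F W)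
    (w := fun n l => ‖deriv F (treePt n l)‖ * (1 / 2) ^ n)
    (g := fun t => c * (μH[1] (frontier W ∩ B₁ t)).toReal +
      c * (μH[1] (frontier W ∩ B₂ t)).toReal) (N := N) (fun t => by positivity) ?_ ?_ hN
    (fun hn => absurd hin hn)
  rotate_left
  · intro j hj
    have h1 := hkoebe N j (B₂ (N, j)) (by
      simp only [hB₂, if_true]
      refine le_trans (ENNReal.ofReal_le_ofReal ?_) (hW.survive h hC₁ hD1 hκ hκ1 hA hD5 hj)
      have := h.treeDist_pos N j
      gcongr
      exact min_le_left _ _)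
    exact h1.trans (le_add_of_nonneg_left (by positivity))
  · intro i j j' _ hin' hj' hout
    have h1 := hkoebe _ _ (B₁ (i + 1, j')) (hW.exit h hD1 hκ hA (min_le_left _ _)
      (min_le_right _ _) hin' hj' hout)
    exact h1.trans (le_add_of_nonneg_right (by positivity))
  have hR : 0 < C7 * δ := by positivity
  have hl := half_pow_pos n
  have hbox : ∀ t ∈ treeBelow d n l, treeBox t.1 t.2 ⊆ treeBox n l := fun t ht =>
    treeBox_subset_of_mem_treeBelow ht
  have hle : ∀ t ∈ treeBelow d n l, (1 / 2 : ℝ) ^ t.1 ≤ (1 / 2) ^ n := fun t ht =>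
    pow_le_pow_of_le_one (by norm_num) (by norm_num) (mem_treeBelow ht).1
  have hs₁ : ∑ t ∈ treeBelow d n l, (μH[1] (frontier W ∩ B₁ t)).toReal ≤
      K₁ * (4 * (k + 1) * (C7 * δ)) := by
    refine hW.arc.sum_measure_le hk (x := F (treePt n l)) hR (fun t _ => ?_) (fun t ht => ?_) ?_
    · exact ((isCompact_whitney (by linarith) (treePt_mem _ _)).image_of_continuousOn
        (h.diff.continuousOn.mono (whitney_subset_uhp (by linarith)
          (treePt_mem _ _)))).isClosed.measurableSet
    · rintro _ ⟨p, hp, rfl⟩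
      have hpu := whitney_subset_uhp (by linarith) (treePt_mem _ _) hp
      have h1 := dist_le_of_mem_whitney (by linarith) (treePt_mem _ _) hp
      have h2 := dist_treeX_lt (hbox t ht (treePt_mem_treeBox t.1 t.2))
      have h3 := dist_triangle p (treePt t.1 t.2) (treeX n l)
      have h4 := hle t ht
      rw [treePt_im] at h1
      have h5 := h.dist_treePt_le_of_dist_lt hC₁ (by linarith) hD5 hpu (n := n) (k := l)
        (by nlinarith)
      rw [mem_closedBall]
      refine h5.trans ?_
      have : 0 ≤ C₁ + C5 * (1 + C₁) := by positivity
      change 2 * C₁ * distortion (5 * A) * δ ≤ C7 * δ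
      gcongr
      linarith
    · intro z T hT hz
      refine hK₁ T (ψ z) fun t ht => ?_
      obtain ⟨p, hp, hpz⟩ := hz t ht
      have hpu := whitney_subset_uhp (by linarith) (treePt_mem _ _) hp
      rw [← hpz, h.left p hpu]
      exact hp
  have hs₂ : ∑ t ∈ treeBelow d n l, (μH[1] (frontier W ∩ B₂ t)).toReal ≤
      K₂ * (4 * (k + 1) * (C7 * δ)) := by
    refine hW.arc.sum_measure_le hk (x := F (treePt n l)) hR (fun t _ => ?_) (fun t ht => ?_) ?_
    · simp only [hB₂]
      split_ifs
      · exact measurableSet_closedBall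
      · exact MeasurableSet.empty
    · simp only [hB₂]
      split_ifs
      · have h1 := h.dist_treePt_le hD1 (hbox t ht (treePt_mem_treeBox t.1 t.2))
        have h2 := h.treeDist_le hD1 (hbox t ht)
        refine closedBall_subset_closedBall' ?_
        have h3 : C5 * treeDist F Ω t.1 t.2 ≤ C5 * ((1 + C₁) * δ) := by gcongr
        have h4 : 0 ≤ 2 * C₁ * distortion (5 * A) * δ := by positivity
        rw [hC7]
        linarith
      · exact empty_subset _
    · intro z T hT hz
      have hz' : ∀ t ∈ T, t.1 = N ∧ dist z (F (treePt t.1 t.2)) ≤ C5 * treeDist F Ω t.1 t.2 := by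
        intro t ht
        have := hz t ht
        simp only [hB₂] at this
        split_ifs at this with h0
        · exact ⟨h0, this⟩
        · exact absurd this (notMem_empty _)
      rcases T.eq_empty_or_nonempty with rfl | hTne
      · simp
      obtain ⟨t₀, ht₀, hmax⟩ := T.exists_max_image (fun t => treeDist F Ω t.1 t.2) hTne
      refine card_le_of_abs_sub_treeX_le (n := N) (x := treeX t₀.1 t₀.2) (fun t ht => (hz' t ht).1)
        fun t ht => ?_
      obtain ⟨e0, d0⟩ := hz' t₀ ht₀
      obtain ⟨e1, d1⟩ := hz' t ht
      have h1 : dist (F (treePt t.1 t.2)) (F (treePt t₀.1 t₀.2)) ≤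
          D' * treeDist F Ω t₀.1 t₀.2 := by
        have h2 := dist_triangle_left (F (treePt t.1 t.2)) (F (treePt t₀.1 t₀.2)) z
        have h3 : C5 * treeDist F Ω t.1 t.2 ≤ C5 * treeDist F Ω t₀.1 t₀.2 := by
          gcongr; exact hmax t ht
        have h4 : 2 * C5 ≤ D' := (Nat.le_ceil _).trans (by rw [hD']; push_cast; linarith)
        have h5 := h.treeDist_pos t₀.1 t₀.2
        nlinarith
      have h2 := h.joint D' (by omega) (by omega) (treeX t₀.1 t₀.2) ((1 / 2) ^ t₀.1)
        (half_pow_pos _) (half_pow_le_one _) _ (treePt_mem t.1 t.2) h1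
      rw [dist_eq_norm] at h2
      have h3 := (Complex.abs_re_le_norm _).trans h2
      rw [Complex.sub_re, treePt_re, Complex.ofReal_re, abs_sub_comm, e0, e1] at h3
      rw [e0]
      exact h3
  have hle' := h.le_deriv (treePt_mem n l)
  rw [treePt_im] at hle'
  change δ ≤ _ at hle'
  rw [Finset.sum_add_distrib, ← Finset.mul_sum, ← Finset.mul_sum] at hsum
  set P := ‖deriv F (treePt n l)‖ * (1 / 2) ^ n with hP
  have hP0 : 0 ≤ P := by positivity
  calc _ ≤ _ := hsum
    _ ≤ c * (K₁ * (4 * (k + 1) * (C7 * δ))) + c * (K₂ * (4 * (k + 1) * (C7 * δ))) := by gcongr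
    _ = c * ((K₁ + K₂) * (4 * (k + 1) * C7)) * δ := by ring
    _ ≤ c * ((K₁ + K₂) * (4 * (k + 1) * C7)) * (2 * P) := by
      gcongr
      rw [hP]
      linarith
    _ ≤ _ := by linarith

/-! ### Boxes with small derivative are not the whole of the interval -/

/-- The Bishop-Jones condition with given constants. -/
def BishopJonesWith (k c c₁ c₂ : ℝ) (Ω : Set ℂ) : Prop :=
  ∀ z ∈ Ω, ∃ Ωz : Set ℂ, Ωz ⊆ Ω ∧ z ∈ Ωz ∧ IsOpen Ωz ∧ IsConnected Ωz ∧
    IsChordArcWith (frontier Ωz) k ∧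
    c₁ * Metric.infDist z (frontier Ω) ≤ Metric.diam Ωz ∧
    Metric.diam Ωz ≤ c₂ * Metric.infDist z (frontier Ω) ∧
    ENNReal.ofReal (c * Metric.infDist z (frontier Ω)) ≤ μH[1] (frontier Ω ∩ frontier Ωz)

theorem exists_chordArcIn {C₁ : ℝ} {lam : ℝ → ℝ} {L : ℕ → ℝ} (hC₁ : 1 ≤ C₁)
    (hL : ∀ D', 1 ≤ D' → 1 ≤ L D') {k c c₁ c₂ : ℝ} (hc : 0 < c) (hc₁ : 0 < c₁) :
    ∃ κ : ℝ, 0 < κ ∧ κ ≤ 1 ∧ ∃ e : ℝ, 0 < e ∧ ∃ D₁ : ℕ, ∀ D₀ : ℕ, D₁ ≤ D₀ → ∀ F ψ Ω,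
      BoxMap C₁ lam L D₀ F ψ Ω → BishopJonesWith k c c₁ c₂ Ω →
        ∃ W, ChordArcIn κ k F Ω W ∧
          ENNReal.ofReal (e * treeDist F Ω 0 0) ≤ μH[1] (frontier Ω ∩ frontier W) := by
  set D' : ℕ := ⌈c₂⌉₊ + 1 with hD'
  have hΛ : 1 ≤ L D' := hL D' (by omega)
  set τ := 1 / (2 * L D') with hτ
  have hτ0 : 0 < τ := by positivity
  have hτ1 : τ ≤ 1 := by rw [hτ, div_le_one (by positivity)]; linarith
  have hLτ : L D' * τ = 1 / 2 := by rw [hτ]; field_simp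
  have hA : 1 ≤ 1 / τ := by rwa [le_div_iff₀ hτ0, one_mul]
  set H := distortion (1 / τ) with hH
  have hH0 : 0 < H := distortion_pos _
  refine ⟨min 1 (c₁ / (4 * (1 + C₁) * H)), lt_min one_pos (by positivity), min_le_left _ _,
    c / H, by positivity, D', ?_⟩
  intro D₀ hD₀ F ψ Ω h hBJ
  have hD1 : 1 ≤ D₀ := by omega
  set z : ℂ := ((1 / 2 : ℝ) : ℂ) + (τ : ℝ) * Complex.I with hz
  have hzu : z ∈ uhp := mem_uhp_add_mul_I hτ0
  have hzim : z.im = τ := im_add_mul_I _ _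
  have hzre : z.re = 1 / 2 := by
    rw [hz, Complex.add_re, Complex.re_ofReal_mul, Complex.ofReal_re, Complex.I_re, mul_zero,
      add_zero]
  have hx0 : treeX 0 0 = 1 / 2 := by simp [treeX]
  have hzw : z ∈ whitney (1 / τ) (treePt 0 0) := by
    refine ⟨?_, ?_, ?_⟩
    · rw [treePt_re, hx0, hzre, treePt_im]; simp; exact hτ0.le
    · rw [treePt_im, hzim, one_div_mul_cancel hτ0.ne']; simp
    · rw [treePt_im, hzim]; simp; exact hτ1.trans (by rwa [one_div] at hA)
  have hwh := h.whitney_infDist hA (treePt_mem 0 0) hzw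
  set δ := infDist (F z) (frontier Ω) with hδ
  have hδ0 : 0 < δ := h.pos (h.mem hzu)
  obtain ⟨W, hWΩ, hzW, hWo, hWc, hWk, hd1, hd2, hm⟩ := hBJ (F z) (h.mem hzu)
  have hWb : Bornology.IsBounded W := by
    by_contra hcon
    rw [diam_eq_zero_of_unbounded hcon] at hd1
    have : 0 < c₁ * δ := by positivity
    linarith
  have hδH : treeDist F Ω 0 0 ≤ H * δ := hwh.2
  refine ⟨W, ⟨hWo, hWc, hWΩ, hWk, ?_, ?_⟩, le_trans (ENNReal.ofReal_le_ofReal ?_) hm⟩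
  · intro p hp hpW
    have h1 : dist (F p) (F z) ≤ D' * δ := by
      refine (dist_le_diam_of_mem hWb hpW hzW).trans (hd2.trans ?_)
      have h2 : c₂ ≤ ⌈c₂⌉₊ := Nat.le_ceil _
      have h3 : ((D' : ℕ) : ℝ) = ⌈c₂⌉₊ + 1 := by rw [hD']; push_cast; ring
      rw [h3]
      exact mul_le_mul_of_nonneg_right (by linarith) hδ0.le
    have h2 := h.joint D' (by omega) hD₀ _ _ hτ0 hτ1 p hp h1
    rw [hLτ, dist_eq_norm] at h2
    have hre := (Complex.abs_re_le_norm _).trans h2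
    have him := (Complex.abs_im_le_norm _).trans h2
    simp only [Complex.sub_re, Complex.ofReal_re, Complex.sub_im, Complex.ofReal_im, sub_zero]
      at hre him
    have h3 := (le_abs_self _).trans him
    exact ⟨by rw [hx0]; simpa using hre, hp, by simp; linarith⟩
  · intro n l hs
    have h1 := h.treeDist_le hD1 hs
    have h2 : min 1 (c₁ / (4 * (1 + C₁) * H)) * ((1 + C₁) * (H * δ)) ≤
        c₁ / (4 * (1 + C₁) * H) * ((1 + C₁) * (H * δ)) :=
      mul_le_mul_of_nonneg_right (min_le_right _ _) (by positivity)
    have h3 : c₁ / (4 * (1 + C₁) * H) * ((1 + C₁) * (H * δ)) = c₁ * δ / 4 := by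
      field_simp
    have h4 : min 1 (c₁ / (4 * (1 + C₁) * H)) * treeDist F Ω n l ≤
        min 1 (c₁ / (4 * (1 + C₁) * H)) * ((1 + C₁) * (H * δ)) := by
      refine mul_le_mul_of_nonneg_left (h1.trans ?_) (le_min zero_le_one (by positivity))
      gcongr
    have : 0 < c₁ * δ := by positivity
    linarith
  · rw [div_mul_eq_mul_div, div_le_iff₀ hH0]
    nlinarith

/-- The derivative at the node is small compared with the derivative at the root. -/
def NodeLow (η : ℝ) (F : ℂ → ℂ) (n l : ℕ) : Prop :=
  ‖deriv F (treePt n l)‖ < η * ‖deriv F (treePt 0 0)‖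

/-- The closure of the image box meets the common boundary of the domain and the subdomain. -/
def NodeTouch (F : ℂ → ℂ) (Ω W : Set ℂ) (n l : ℕ) : Prop :=
  (frontier Ω ∩ frontier W ∩ closure (F '' treeBox n l)).Nonempty

theorem NodeTouch.parent {F : ℂ → ℂ} {Ω W : Set ℂ} {n l l' : ℕ} (h : NodeTouch F Ω W (n + 1) l')
    (hl : l' = 2 * l ∨ l' = 2 * l + 1) : NodeTouch F Ω W n l :=
  h.mono (inter_subset_inter_right _ (closure_mono (image_mono (treeBox_child hl))))

namespace ChordArcIn

variable {C₁ : ℝ} {lam : ℝ → ℝ} {L : ℕ → ℝ} {D₀ : ℕ} {F ψ : ℂ → ℂ} {Ω W : Set ℂ} {κ k : ℝ}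

theorem measure_node_le (hW : ChordArcIn κ k F Ω W) (h : BoxMap C₁ lam L D₀ F ψ Ω) (hC₁ : 1 ≤ C₁)
    (hD : 1 ≤ D₀) (hk : 1 < k) (n l : ℕ) :
    μH[1] (frontier Ω ∩ frontier W ∩ closure (F '' treeBox n l)) ≤
      ENNReal.ofReal (8 * (k + 1) * C₁ * (‖deriv F (treePt n l)‖ * (1 / 2) ^ n)) := by
  have hδ := h.treeDist_pos n l
  have h1 : frontier Ω ∩ frontier W ∩ closure (F '' treeBox n l) ⊆
      frontier W ∩ closedBall (F (treePt n l)) (C₁ * treeDist F Ω n l) := by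
    refine fun x hx => ⟨hx.1.2, closure_minimal ?_ isClosed_closedBall hx.2⟩
    rintro _ ⟨p, hp, rfl⟩
    exact h.dist_treePt_le hD hp
  refine (measure_mono h1).trans ((hW.arc.measure_closedBall_le hk _ (by positivity)).trans
    (ENNReal.ofReal_le_ofReal ?_))
  have h2 := h.le_deriv (treePt_mem n l)
  rw [treePt_im] at h2
  change treeDist F Ω n l ≤ _ at h2
  have h3 : 0 < 4 * (k + 1) * C₁ := by positivity
  nlinarith

open Classical in
theorem measure_le_treeSum (hW : ChordArcIn κ k F Ω W) (h : BoxMap C₁ lam L D₀ F ψ Ω)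
    (hC₁ : 1 ≤ C₁) (hD : 1 ≤ D₀) (hk : 1 < k) {η : ℝ} (d n l : ℕ) :
    μH[1] (frontier Ω ∩ frontier W ∩ closure (F '' treeBox n l)) ≤
      ENNReal.ofReal (treeSum (NodeLow η F) (fun n l => 8 * (k + 1) * C₁ *
        (if NodeLow η F n l then η * ‖deriv F (treePt 0 0)‖ * (1 / 2) ^ n else
          if NodeTouch F Ω W n l then ‖deriv F (treePt n l)‖ * (1 / 2) ^ n else 0)) d n l) := by
  set w : ℕ → ℕ → ℝ := fun n l => 8 * (k + 1) * C₁ *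
        (if NodeLow η F n l then η * ‖deriv F (treePt 0 0)‖ * (1 / 2) ^ n else
          if NodeTouch F Ω W n l then ‖deriv F (treePt n l)‖ * (1 / 2) ^ n else 0) with hw
  have hk0 : 0 < 8 * (k + 1) * C₁ := by positivity
  have hw0 : ∀ n l, 0 ≤ w n l := by
    intro n l
    have hl := half_pow_pos n
    simp only [hw]
    refine mul_nonneg hk0.le ?_
    split_ifs with h1 h2
    · exact mul_nonneg ((norm_nonneg _).trans h1.le) hl.le
    · positivity
    · exact le_rfl
  have hnode : ∀ n l, μH[1] (frontier Ω ∩ frontier W ∩ closure (F '' treeBox n l)) ≤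
      ENNReal.ofReal (w n l) := by
    intro n l
    by_cases ht : NodeTouch F Ω W n l
    · refine (hW.measure_node_le h hC₁ hD hk n l).trans (ENNReal.ofReal_le_ofReal ?_)
      simp only [hw]
      refine mul_le_mul_of_nonneg_left ?_ hk0.le
      split_ifs with h1
      · exact mul_le_mul_of_nonneg_right h1.le (half_pow_pos n).le
      · exact le_rfl
    · rw [NodeTouch, not_nonempty_iff_eq_empty] at ht
      rw [ht, measure_empty]
      exact zero_le
  induction d generalizing n l with
  | zero => exact hnode n l
  | succ d ih =>
    by_cases hlow : NodeLow η F n l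
    · rw [treeSum_of_halt hlow]; exact hnode n l
    · rw [treeSum_succ hlow, ENNReal.ofReal_add (treeSum_nonneg hw0 _ _ _)
        (treeSum_nonneg hw0 _ _ _)]
      refine le_trans (measure_mono ?_) ((measure_union_le _ _).trans (add_le_add (ih _ _) (ih _ _)))
      rintro x ⟨hxE, hx⟩
      have hcov : F '' treeBox n l ⊆ F '' whitney 2 (treePt n l) ∪
          (F '' treeBox (n + 1) (2 * l) ∪ F '' treeBox (n + 1) (2 * l + 1)) := by
        rintro _ ⟨p, hp, rfl⟩
        rcases mem_treeBox_cases hp with h1 | h1 | h1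
        · left
          refine ⟨p, ⟨?_, ?_, ?_⟩, rfl⟩
          · rw [treePt_re, treePt_im]; exact hp.1.trans (by linarith [half_pow_pos n])
          · rw [treePt_im]; linarith
          · rw [treePt_im]; exact hp.2.2.trans (by linarith [half_pow_pos n])
        · exact Or.inr (Or.inl ⟨p, h1, rfl⟩)
        · exact Or.inr (Or.inr ⟨p, h1, rfl⟩)
      have hx2 := closure_mono hcov hx
      have hsub : whitney 2 (treePt n l) ⊆ uhp := whitney_subset_uhp (by norm_num) (treePt_mem n l)
      have hcpt : IsCompact (F '' whitney 2 (treePt n l)) :=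
        (isCompact_whitney (by norm_num) (treePt_mem n l)).image_of_continuousOn
          (h.diff.continuousOn.mono hsub)
      rw [closure_union, closure_union, hcpt.isClosed.closure_eq] at hx2
      rcases hx2 with ⟨p, hp, rfl⟩ | hx2 | hx2
      · exact absurd (mem_image_of_mem F (hsub hp)) (h.not_mem hxE.1)
      · exact Or.inl ⟨hxE, hx2⟩
      · exact Or.inr ⟨hxE, hx2⟩

theorem subset_closure (hW : ChordArcIn κ k F Ω W) (h : BoxMap C₁ lam L D₀ F ψ Ω) :
    frontier W ⊆ closure (F '' treeBox 0 0) := by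
  refine frontier_subset_closure.trans (closure_mono fun w hw => ?_)
  have hwΩ := hW.subset hw
  exact ⟨ψ w, hW.sub_box _ (h.map_mem hwΩ) (by rwa [h.right hwΩ]), h.right hwΩ⟩

end ChordArcIn

open Classical in
/-- Sums over low nodes of weights supported on touching nodes are dominated by sums over the nodes
that leave the subdomain. -/
theorem treeSum_touch_le {F : ℂ → ℂ} {Ω W : Set ℂ} {A η : ℝ} {v : ℕ → ℕ → ℝ}
    (hv : ∀ n l, 0 ≤ v n l)
    (htouch : ∀ n l, treeBox n l ⊆ treeBox 0 0 → NodeTouch F Ω W n l → NodeInside A F W n l)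
    (d n l : ℕ) (hs : treeBox n l ⊆ treeBox 0 0) :
    treeSum (NodeLow η F) (fun n l => if ¬ NodeLow η F n l ∧ NodeTouch F Ω W n l then v n l else 0)
      d n l ≤ treeSum (fun n l => ¬ NodeInside A F W n l) v d n l := by
  set u : ℕ → ℕ → ℝ := fun n l => if ¬ NodeLow η F n l ∧ NodeTouch F Ω W n l then v n l else 0
    with hu
  have hle : ∀ n l, u n l ≤ v n l := by
    intro n l; simp only [hu]; split_ifs
    · exact le_rfl
    · exact hv n l
  have hz : ∀ d n l, ¬ NodeTouch F Ω W n l → treeSum (NodeLow η F) u d n l = 0 := by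
    intro d
    induction d with
    | zero => intro n l h; simp [treeSum_zero, hu, h]
    | succ d ih =>
      intro n l h
      by_cases hlow : NodeLow η F n l
      · rw [treeSum_of_halt hlow]; simp [hu, hlow]
      · rw [treeSum_succ hlow, ih _ _ fun h' => h (h'.parent (Or.inl rfl)),
          ih _ _ fun h' => h (h'.parent (Or.inr rfl)), add_zero]
  induction d generalizing n l with
  | zero => exact hle n l
  | succ d ih =>
    by_cases ht : NodeTouch F Ω W n l
    · have hin := htouch n l hs ht
      by_cases hlow : NodeLow η F n l
      · rw [treeSum_of_halt hlow]
        simp only [hu, hlow, not_true_eq_false, false_and, if_false]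
        exact treeSum_nonneg hv _ _ _
      · rw [treeSum_succ hlow, treeSum_succ (not_not.2 hin)]
        exact add_le_add (ih _ _ ((treeBox_child (Or.inl rfl)).trans hs))
          (ih _ _ ((treeBox_child (Or.inr rfl)).trans hs))
    · rw [hz _ _ _ ht]
      exact treeSum_nonneg hv _ _ _

open Classical in
/-- In a domain satisfying the Bishop-Jones condition, the intervals over which the derivative drops
by a fixed factor leave out a fixed proportion of the root interval. -/
theorem exists_treeSum_low_le {C₁ : ℝ} {lam : ℝ → ℝ} {L : ℕ → ℝ} (hC₁ : 1 ≤ C₁)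
    (hlam : ∀ ε, 0 < ε → 0 < lam ε) (hL : ∀ D', 1 ≤ D' → 1 ≤ L D') {k c c₁ c₂ : ℝ} (hk : 1 < k)
    (hc : 0 < c) (hc₁ : 0 < c₁) :
    ∃ η : ℝ, 0 < η ∧ ∃ c' : ℝ, 0 < c' ∧ ∃ D₁ : ℕ, ∀ D₀ : ℕ, D₁ ≤ D₀ → ∀ F ψ Ω,
      BoxMap C₁ lam L D₀ F ψ Ω → BishopJonesWith k c c₁ c₂ Ω → ∀ N,
        treeSum (NodeLow η F) (fun n l => if NodeLow η F n l then (1 / 2 : ℝ) ^ n else 0) N 0 0 ≤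
          1 - c' := by
  obtain ⟨κ, hκ, hκ1, e, he, Da, hW⟩ := exists_chordArcIn (k := k) (c₂ := c₂) hC₁ hL hc hc₁
  obtain ⟨A, hA, Db, hin⟩ := exists_nodeInside (C₁ := C₁) hlam hL hκ hκ1 hk
  obtain ⟨Cr, hCr, Dc, hsum⟩ := exists_treeSum_nodeInside_le (lam := lam) (L := L) hC₁ hκ hκ1 hk hA
  have hd2 := one_le_distortion 2
  have hd3 := one_le_distortion 3
  have hpi := Real.pi_gt_three
  obtain ⟨B, θ, hB, hθ0, hθ1, hdec⟩ := exists_treeSum_decay (C₀ := 3072 * Real.pi * distortion 2)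
    (Cc := 192 * Real.pi * 3 * distortion 3) (by positivity) (by nlinarith) hCr
  set Ce := 8 * (k + 1) * C₁ with hCe
  have hCe0 : 0 < Ce := by positivity
  set e' := e / (96 * Real.pi) with he'
  have he'0 : 0 < e' := by positivity
  obtain ⟨j, hj⟩ := exists_pow_lt_of_lt_one (show 0 < e' / (4 * Ce * Cr) by positivity) hθ1
  have hBj : 0 < B ^ j := by positivity
  refine ⟨e' / (2 * Ce), by positivity, e' / (4 * Ce * B ^ j), by positivity,
    max 1 (max Da (max Db Dc)), ?_⟩
  intro D₀ hD₀ F ψ Ω h hBJ N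
  simp only [max_le_iff] at hD₀
  obtain ⟨hD1, hDa, hDb, hDc⟩ := hD₀
  obtain ⟨W, hWin, hmeas⟩ := hW D₀ hDa F ψ Ω h hBJ
  set η := e' / (2 * Ce) with hη
  set M : ℕ → ℕ → ℝ := fun n l => ‖deriv F (treePt n l)‖ with hM
  have hM0 : ∀ n l, 0 < M n l := fun n l => h.norm_deriv_pos (treePt_mem n l)
  have hR := hM0 0 0
  have htouch : ∀ n l, treeBox n l ⊆ treeBox 0 0 → NodeTouch F Ω W n l → NodeInside A F W n l :=
    fun n l hs ht => hin D₀ hDb F ψ Ω h W hWin n l hs ht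
  have hδ := h.treeDist_pos 0 0
  have hEcl : frontier Ω ∩ frontier W ∩ closure (F '' treeBox 0 0) = frontier Ω ∩ frontier W :=
    inter_eq_left.2 (inter_subset_right.trans (hWin.subset_closure h))
  have hroot : NodeInside A F W 0 0 := by
    refine htouch 0 0 Subset.rfl ?_
    rw [NodeTouch, hEcl]
    refine nonempty_of_measure_ne_zero (μ := μH[1]) (ne_of_gt (lt_of_lt_of_le ?_ hmeas))
    exact ENNReal.ofReal_pos.2 (by positivity)
  obtain ⟨X, hX, hXM⟩ := h.exists_additive N
  have hCc : ∀ n l l', (l' = 2 * l ∨ l' = 2 * l + 1) →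
      M (n + 1) l' ≤ 192 * Real.pi * 3 * distortion 3 * M n l := by
    intro n l l' hl
    have hw := whitney_parent (n := n) hl le_rfl (mem_whitney_self le_rfl (treePt_mem n l))
    rw [mul_one] at hw
    exact (h.whitney_deriv (by norm_num) (treePt_mem _ _) hw).2
  have hT2 := hdec (fun n l => ¬ NodeInside A F W n l) M X N hM0 hX hXM
    (fun n l => ⟨hCc n l _ (Or.inl rfl), hCc n l _ (Or.inr rfl)⟩)
    (fun d n l hn hs => hsum D₀ hDc F ψ Ω h W hWin d n l N hn (not_not.1 hs)) j N 0 0 (by simp)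
  have hT2' := hsum D₀ hDc F ψ Ω h W hWin N 0 0 N (by simp) hroot
  have hbig := (hmeas.trans_eq (by rw [hEcl])).trans
    (hWin.measure_le_treeSum h hC₁ hD1 hk (η := η) N 0 0)
  set low := NodeLow η F with hlow
  set T1 := treeSum low (fun n l => if low n l then (1 / 2 : ℝ) ^ n else 0) N 0 0 with hT1
  set T3 := treeSum low (fun n l => if low n l then 0 else (1 / 2 : ℝ) ^ n) N 0 0 with hT3
  have h13 : T1 + T3 = 1 := by
    rw [hT1, hT3, ← treeSum_add]
    have : (fun n l => (if low n l then (1 / 2 : ℝ) ^ n else 0) +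
        (if low n l then 0 else (1 / 2 : ℝ) ^ n)) = fun n _ => (1 / 2 : ℝ) ^ n := by
      funext n l; split_ifs <;> simp
    rw [this, treeSum_half_pow, pow_zero]
  have hT30 : 0 ≤ T3 := treeSum_nonneg (fun n l => by split_ifs <;> positivity) _ _ _
  set v : ℕ → ℕ → ℝ := fun n l => if B ^ j * M 0 0 < M n l then M n l * (1 / 2) ^ n else 0 with hv
  have hv0 : ∀ n l, 0 ≤ v n l := by
    intro n l; have := hM0 n l; simp only [hv]; split_ifs <;> positivity
  have hcmp := treeSum_touch_le (η := η) hv0 htouch N 0 0 Subset.rfl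
  set T2 := treeSum low (fun n l => if ¬ low n l ∧ NodeTouch F Ω W n l then v n l else 0) N 0 0
    with hT2def
  have hup : treeSum low (fun n l => Ce *
        (if low n l then η * ‖deriv F (treePt 0 0)‖ * (1 / 2) ^ n else
          if NodeTouch F Ω W n l then ‖deriv F (treePt n l)‖ * (1 / 2) ^ n else 0)) N 0 0 ≤
      Ce * (η * M 0 0 * T1 + T2 + B ^ j * M 0 0 * T3) := by
    rw [treeSum_mul_left]
    refine mul_le_mul_of_nonneg_left ?_ hCe0.le
    rw [hT1, hT2def, hT3, ← treeSum_mul_left, ← treeSum_mul_left, ← treeSum_add, ← treeSum_add]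
    refine treeSum_mono (N := N) (by simp) fun n l _ => ?_
    have hl := half_pow_pos n
    have hMn := hM0 n l
    by_cases h1 : low n l
    · simp [h1, hM]
    · by_cases h2 : NodeTouch F Ω W n l
      · simp only [h1, h2, hv, if_true, if_false, not_false_eq_true, and_self, mul_zero, zero_add]
        split_ifs with h3
        · have : 0 ≤ B ^ j * M 0 0 * (1 / 2) ^ n := by positivity
          linarith
        · rw [zero_add]
          exact mul_le_mul_of_nonneg_right (not_lt.1 h3) hl.le
      · simp only [h1, h2, if_false, and_false, mul_zero, zero_add, add_zero]
        positivity
  have hT1le : T1 ≤ 1 := by linarith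
  have hkoebe := h.koebe (treePt_mem 0 0)
  rw [treePt_im, pow_zero, one_mul] at hkoebe
  have heM : e' * M 0 0 ≤ e * treeDist F Ω 0 0 := by
    rw [he', div_mul_eq_mul_div, div_le_iff₀ (by positivity)]
    have := mul_le_mul_of_nonneg_left hkoebe he.le
    change e * M 0 0 ≤ e * (96 * Real.pi * treeDist F Ω 0 0) at this
    linarith
  have hbig' := (ENNReal.ofReal_le_ofReal_iff' .. |>.1 hbig).resolve_right
    (not_le.2 (by positivity))
  have hT2le : T2 ≤ θ ^ j * (Cr * M 0 0) := by
    refine hcmp.trans (hT2.trans ?_)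
    refine mul_le_mul_of_nonneg_left ?_ (by positivity)
    rw [pow_zero, mul_one] at hT2'
    exact hT2'
  have hθj : Ce * (θ ^ j * (Cr * M 0 0)) ≤ e' / 4 * M 0 0 := by
    rw [lt_div_iff₀ (by positivity)] at hj
    nlinarith
  have hηe : Ce * (η * M 0 0 * T1) ≤ e' / 2 * M 0 0 := by
    have : Ce * (η * M 0 0 * T1) = e' / 2 * M 0 0 * T1 := by rw [hη]; field_simp
    rw [this]
    exact mul_le_of_le_one_right (by positivity) hT1le
  have hfin : e' / 4 * M 0 0 ≤ Ce * (B ^ j * T3) * M 0 0 := by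
    have := mul_le_mul_of_nonneg_left hT2le hCe0.le
    linarith
  have hfin' := le_of_mul_le_mul_right hfin hR
  have : e' / (4 * Ce * B ^ j) ≤ T3 := by
    rw [div_le_iff₀ (by positivity)]
    linarith
  linarith

/-! ### Pull-back of measures to the half-plane -/

/-- The image of every Carleson box of size at most one has small mass. -/
def SmallMass (ε : ℝ) (μ : Measure ℂ) (F : ℂ → ℂ) (Ω : Set ℂ) : Prop :=
  ∀ x y : ℝ, 0 < y → y ≤ 1 → μ (F '' {p | |p.re - x| ≤ y / 2 ∧ 0 < p.im ∧ p.im ≤ y}) ≤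
    ENNReal.ofReal (ε * infDist (F (x + y * Complex.I)) (frontier Ω))

/-- The mass of a set of the half-plane for the pull-back of a measure. -/
noncomputable def pullMass (μ : Measure ℂ) (ψ : ℂ → ℂ) (Ω A : Set ℂ) : ℝ≥0∞ :=
  ∫⁻ w in Ω ∩ ψ ⁻¹' A, (‖deriv ψ w‖₊ : ℝ≥0∞) ∂μ

theorem pullMass_mono {μ : Measure ℂ} {ψ : ℂ → ℂ} {Ω A B : Set ℂ} (h : A ⊆ B) :
    pullMass μ ψ Ω A ≤ pullMass μ ψ Ω B :=
  lintegral_mono_set (inter_subset_inter_right _ (preimage_mono h))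

theorem pullMass_union_le (μ : Measure ℂ) (ψ : ℂ → ℂ) (Ω A B : Set ℂ) :
    pullMass μ ψ Ω (A ∪ B) ≤ pullMass μ ψ Ω A + pullMass μ ψ Ω B := by
  unfold pullMass
  rw [preimage_union, inter_union_distrib_left]
  exact lintegral_union_le _ _ _

theorem pullMass_empty (μ : Measure ℂ) (ψ : ℂ → ℂ) (Ω : Set ℂ) : pullMass μ ψ Ω ∅ = 0 := by
  simp [pullMass]

theorem SmallMass.affine {ε : ℝ} {μ : Measure ℂ} {F : ℂ → ℂ} {Ω : Set ℂ} (h : SmallMass ε μ F Ω)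
    (a : ℝ) {s : ℝ} (hs : 0 < s) (hs1 : s ≤ 1) : SmallMass ε μ (fun z => F (a + s * z)) Ω := by
  intro x y hy hy1
  beta_reduce
  rw [affine_add_mul_I]
  refine (measure_mono ?_).trans (h (a + s * x) (s * y) (mul_pos hs hy) (by nlinarith))
  rintro _ ⟨p, ⟨h1, h2, h3⟩, rfl⟩
  refine ⟨a + s * p, ⟨?_, ?_, ?_⟩, rfl⟩
  · have e : ((a : ℂ) + s * p).re - (a + s * x) = s * (p.re - x) := by simp; ring
    rw [e, abs_mul, abs_of_pos hs]
    nlinarith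
  · simp; positivity
  · simpa using mul_le_mul_of_nonneg_left h3 hs.le

theorem pullMass_affine (μ : Measure ℂ) (ψ : ℂ → ℂ) (Ω A : Set ℂ) (a : ℝ) {s : ℝ} (hs : 0 < s) :
    pullMass μ ψ Ω ((fun z => (z - a) / s) ⁻¹' A) =
      ENNReal.ofReal s * pullMass μ (fun w => (ψ w - a) / s) Ω A := by
  unfold pullMass
  rw [← lintegral_const_mul' _ _ ENNReal.ofReal_ne_top]
  refine lintegral_congr fun w => ?_
  rw [← enorm_eq_nnnorm, ← enorm_eq_nnnorm, deriv_div_const, deriv_sub_const, ← ofReal_norm,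
    ← ofReal_norm, norm_div, Complex.norm_real, Real.norm_of_nonneg hs.le,
    ← ENNReal.ofReal_mul hs.le, mul_div_cancel₀ _ hs.ne']

theorem mem_treeBox_affine {n l : ℕ} {p : ℂ} :
    (p - (l * (1 / 2) ^ n : ℝ)) / ((1 / 2 : ℝ) ^ n : ℝ) ∈ treeBox 0 0 ↔ p ∈ treeBox n l := by
  have hs := half_pow_pos n
  set s : ℝ := (1 / 2) ^ n with hsdef
  have e : (p.re - l * s) / s - treeX 0 0 = (p.re - treeX n l) / s := by
    rw [treeX, treeX, ← hsdef]; field_simp; push_cast; ring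
  simp only [treeBox, mem_ofPred_eq, Complex.div_ofReal_re, Complex.div_ofReal_im, Complex.sub_re,
    Complex.sub_im, Complex.ofReal_re, Complex.ofReal_im, sub_zero, e, pow_zero, abs_div,
    abs_of_pos hs, div_le_iff₀ hs, div_pos_iff_of_pos_right hs, ← hsdef]
  rw [one_mul, one_div_mul_eq_div]

/-- A conformal map with small box masses satisfies an explicit estimate for the part of the mass
where the derivative is not small. -/
theorem pullMass_le_of_le_deriv {F ψ : ℂ → ℂ} {Ω : Set ℂ} (h : ConformalUHP F ψ Ω) {ε : ℝ}
    {μ : Measure ℂ} (hμ : SmallMass ε μ F Ω) (hε : 0 ≤ ε) {m : ℝ} (hm : 0 < m) :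
    pullMass μ ψ Ω (treeBox 0 0 ∩ {p | m * ‖deriv F (treePt 0 0)‖ ≤ ‖deriv F p‖}) ≤
      ENNReal.ofReal (2 * ε / m) := by
  have hR := h.norm_deriv_pos (treePt_mem 0 0)
  set M := ‖deriv F (treePt 0 0)‖ with hM
  have h1 : pullMass μ ψ Ω (treeBox 0 0 ∩ {p | m * M ≤ ‖deriv F p‖}) ≤
      ∫⁻ w in F '' treeBox 0 0, ENNReal.ofReal (m * M)⁻¹ ∂μ := by
    refine le_trans (setLIntegral_mono (g := fun _ => ENNReal.ofReal (m * M)⁻¹)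
      measurable_const ?_) (lintegral_mono_set ?_)
    · rintro w ⟨hwΩ, hw1, hw2⟩
      have hd := (h.hasDerivAt_inv (h.map_mem hwΩ)).deriv
      rw [h.right hwΩ] at hd
      rw [hd, ← enorm_eq_nnnorm, ← ofReal_norm, norm_inv]
      exact ENNReal.ofReal_le_ofReal (inv_anti₀ (by positivity) hw2)
    · rintro w ⟨hwΩ, hw1, hw2⟩
      exact ⟨ψ w, hw1, h.right hwΩ⟩
  rw [lintegral_const, Measure.restrict_apply_univ] at h1
  have h2 := hμ (1 / 2) 1 one_pos le_rfl
  have e1 : {p : ℂ | |p.re - 1 / 2| ≤ 1 / 2 ∧ 0 < p.im ∧ p.im ≤ 1} = treeBox 0 0 := by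
    simp [treeBox, treeX]
  have e2 : (((1 / 2 : ℝ) : ℂ) + (1 : ℝ) * Complex.I) = treePt 0 0 := by simp [treePt, treeX]
  rw [e1, e2] at h2
  refine h1.trans ((mul_le_mul_right h2 _).trans ?_)
  rw [← ENNReal.ofReal_mul (by positivity)]
  refine ENNReal.ofReal_le_ofReal ?_
  have h3 := h.le_deriv (treePt_mem 0 0)
  rw [treePt_im, pow_zero, mul_one] at h3
  rw [inv_mul_le_iff₀ (by positivity)]
  have : m * M * (2 * ε / m) = ε * (2 * M) := by field_simp
  rw [this]
  exact mul_le_mul_of_nonneg_left h3 hε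

open Classical in
/-- If each low box carries a mass proportional to its length, then the part of the root box where
the derivative is small has its mass controlled by the sum over the low boxes. -/
theorem pullMass_le_treeSum {F ψ : ℂ → ℂ} {Ω : Set ℂ} (h : ConformalUHP F ψ Ω) {μ : Measure ℂ}
    {η K : ℝ} (hK : 0 ≤ K) {N : ℕ}
    (hlow : ∀ n l, n ≤ N → (n = 0 → l = 0) → NodeLow η F n l →
      pullMass μ ψ Ω (treeBox n l ∩ {p | (1 / 2) ^ N ≤ p.im}) ≤ ENNReal.ofReal (K * (1 / 2) ^ n))
    (d n l : ℕ) (hd : n + d = N) (h0 : n = 0 → l = 0) :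
    pullMass μ ψ Ω (treeBox n l ∩ {p | (1 / 2) ^ N ≤ p.im} ∩
      {p | ‖deriv F p‖ < η / (384 * Real.pi * distortion 2) * ‖deriv F (treePt 0 0)‖}) ≤
        ENNReal.ofReal (treeSum (NodeLow η F)
          (fun n l => if NodeLow η F n l then K * (1 / 2) ^ n else 0) d n l) := by
  have hd2 := distortion_pos 2
  have hpi := Real.pi_pos
  set w : ℕ → ℕ → ℝ := fun n l => if NodeLow η F n l then K * (1 / 2) ^ n else 0 with hw
  have hw0 : ∀ n l, 0 ≤ w n l := by
    intro n l; simp only [hw]; split_ifs <;> positivity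
  set U : Set ℂ := {p | ‖deriv F p‖ < η / (384 * Real.pi * distortion 2) *
    ‖deriv F (treePt 0 0)‖} with hU
  have htop : ∀ n l p, ¬ NodeLow η F n l → p ∈ treeBox n l → (1 / 2) ^ n / 2 ≤ p.im → p ∉ U := by
    intro n l p hnl hp hpim hpU
    have hl := half_pow_pos n
    have hpw : p ∈ whitney 2 (treePt n l) := by
      refine ⟨?_, ?_, ?_⟩
      · rw [treePt_re, treePt_im]; exact hp.1.trans (by linarith)
      · rw [treePt_im]; linarith
      · rw [treePt_im]; exact hp.2.2.trans (by linarith)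
    have h1 := (h.whitney_deriv (by norm_num) (treePt_mem n l) hpw).2
    rw [NodeLow, not_lt] at hnl
    simp only [hU, mem_ofPred_eq] at hpU
    rw [div_mul_eq_mul_div, lt_div_iff₀ (by positivity)] at hpU
    linarith
  induction d generalizing n l with
  | zero =>
    by_cases hl : NodeLow η F n l
    · refine (pullMass_mono inter_subset_left).trans ((hlow n l (by omega) h0 hl).trans ?_)
      rw [treeSum_of_halt hl]; simp [hw, hl]
    · obtain rfl : n = N := by omega
      have : treeBox n l ∩ {p | (1 / 2) ^ n ≤ p.im} ∩ U = ∅ := by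
        rw [eq_empty_iff_forall_notMem]
        rintro p ⟨⟨hp, hpN⟩, hpU⟩
        refine htop n l p hl hp ?_ hpU
        have h1 : (1 / 2 : ℝ) ^ n ≤ p.im := hpN
        linarith [half_pow_pos n]
      rw [this, pullMass_empty]
      exact zero_le
  | succ d ih =>
    by_cases hl : NodeLow η F n l
    · refine (pullMass_mono inter_subset_left).trans ((hlow n l (by omega) h0 hl).trans ?_)
      rw [treeSum_of_halt hl]; simp [hw, hl]
    · rw [treeSum_succ hl, ENNReal.ofReal_add (treeSum_nonneg hw0 _ _ _)
        (treeSum_nonneg hw0 _ _ _)]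
      refine le_trans (pullMass_mono ?_) ((pullMass_union_le _ _ _ _ _).trans
        (add_le_add (ih (n + 1) (2 * l) (by omega) (by omega))
        (ih (n + 1) (2 * l + 1) (by omega) (by omega))))
      rintro p ⟨⟨hp, hpN⟩, hpU⟩
      rcases mem_treeBox_cases hp with h1 | h1 | h1
      · exact absurd hpU (htop n l p hl hp h1.le)
      · exact Or.inl ⟨⟨h1, hpN⟩, hpU⟩
      · exact Or.inr ⟨⟨h1, hpN⟩, hpU⟩

/-- Small masses of the image boxes imply a small mass of the root box for the pull-back. -/
theorem exists_pullMass_le {C₁ : ℝ} {lam : ℝ → ℝ} {L : ℕ → ℝ} (hC₁ : 1 ≤ C₁)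
    (hlam : ∀ ε, 0 < ε → 0 < lam ε) (hL : ∀ D', 1 ≤ D' → 1 ≤ L D') {k c c₁ c₂ : ℝ} (hk : 1 < k)
    (hc : 0 < c) (hc₁ : 0 < c₁) :
    ∃ K : ℝ, 0 < K ∧ ∃ D₁ : ℕ, ∀ D₀ : ℕ, D₁ ≤ D₀ → ∀ F ψ Ω, BoxMap C₁ lam L D₀ F ψ Ω →
      BishopJonesWith k c c₁ c₂ Ω → ∀ μ ε, 0 < ε → SmallMass ε μ F Ω →
        pullMass μ ψ Ω (treeBox 0 0) ≤ ENNReal.ofReal (K * ε) := by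
  classical
  obtain ⟨η, hη, c', hc', D₁, hmain⟩ := exists_treeSum_low_le (c₂ := c₂) hC₁ hlam hL hk hc hc₁
  have hd2 := distortion_pos 2
  have hpi := Real.pi_pos
  set m := η / (384 * Real.pi * distortion 2) with hm
  have hm0 : 0 < m := by positivity
  refine ⟨2 / (m * c'), by positivity, D₁, fun D₀ hD₀ => ?_⟩
  set K := 2 / (m * c') with hK
  have hK0 : 0 < K := by positivity
  have hstep : ∀ N : ℕ, ∀ F ψ Ω, BoxMap C₁ lam L D₀ F ψ Ω →
      BishopJonesWith k c c₁ c₂ Ω → ∀ μ ε, 0 < ε → SmallMass ε μ F Ω →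
        pullMass μ ψ Ω (treeBox 0 0 ∩ {p | (1 / 2) ^ N ≤ p.im}) ≤ ENNReal.ofReal (K * ε) := by
    intro N
    induction N using Nat.strong_induction_on with
    | _ N ih =>
    intro F ψ Ω h hBJ μ ε hε hμ
    have hc := hmain D₀ hD₀ F ψ Ω h hBJ
    have hroot : ¬ NodeLow η F 0 0 := by
      intro hlow
      have := hc 0
      rw [treeSum_zero, if_pos hlow, pow_zero] at this
      linarith
    have hlow : ∀ n l, n ≤ N → (n = 0 → l = 0) → NodeLow η F n l →
        pullMass μ ψ Ω (treeBox n l ∩ {p | (1 / 2) ^ N ≤ p.im}) ≤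
          ENNReal.ofReal (K * ε * (1 / 2) ^ n) := by
      intro n l hn h0 hnl
      have hs := half_pow_pos n
      have hs1 := half_pow_le_one n
      have hn0 : n ≠ 0 := by
        rintro rfl
        rw [h0 rfl] at hnl
        exact hroot hnl
      have h1 := ih (N - n) (by omega) _ _ Ω (h.affine (l * (1 / 2) ^ n) hs hs1) hBJ μ ε hε
        (hμ.affine (l * (1 / 2) ^ n) hs hs1)
      have e : (fun z : ℂ => (z - (l * (1 / 2) ^ n : ℝ)) / ((1 / 2 : ℝ) ^ n : ℝ)) ⁻¹'
          (treeBox 0 0 ∩ {p | (1 / 2) ^ (N - n) ≤ p.im}) =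
          treeBox n l ∩ {p | (1 / 2) ^ N ≤ p.im} := by
        ext p
        rw [mem_preimage, mem_inter_iff, mem_inter_iff, mem_treeBox_affine]
        refine and_congr_right fun _ => ?_
        rw [mem_ofPred_eq, mem_ofPred_eq, Complex.div_ofReal_im, Complex.sub_im, Complex.ofReal_im,
          sub_zero, le_div_iff₀ hs, ← pow_add, Nat.sub_add_cancel hn]
      rw [← e, pullMass_affine μ ψ Ω _ _ hs, mul_comm (K * ε), ENNReal.ofReal_mul hs.le]
      gcongr
    have h1 := pullMass_le_treeSum (μ := μ) h.toConformalUHP (K := K * ε) (by positivity) hlow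
      N 0 0 (by simp) (by simp)
    have h2 := pullMass_le_of_le_deriv h.toConformalUHP hμ hε.le hm0
    have h3 : treeSum (NodeLow η F)
        (fun n l => if NodeLow η F n l then K * ε * (1 / 2 : ℝ) ^ n else 0) N 0 0 ≤
          K * ε * (1 - c') := by
      refine le_trans (le_of_eq ?_) (mul_le_mul_of_nonneg_left (hc N) (by positivity))
      rw [← treeSum_mul_left]
      congr 1
      funext n l
      split_ifs <;> simp
    have hcov : treeBox 0 0 ∩ {p : ℂ | (1 / 2 : ℝ) ^ N ≤ p.im} ⊆
        (treeBox 0 0 ∩ {p | m * ‖deriv F (treePt 0 0)‖ ≤ ‖deriv F p‖}) ∪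
        (treeBox 0 0 ∩ {p | (1 / 2) ^ N ≤ p.im} ∩
          {p | ‖deriv F p‖ < m * ‖deriv F (treePt 0 0)‖}) := by
      rintro p ⟨hp, hpN⟩
      rcases le_or_gt (m * ‖deriv F (treePt 0 0)‖) ‖deriv F p‖ with h4 | h4
      · exact Or.inl ⟨hp, h4⟩
      · exact Or.inr ⟨⟨hp, hpN⟩, h4⟩
    have hKc : 2 * ε / m = K * ε * c' := by rw [hK]; field_simp
    have hc1 : 0 ≤ K * ε * (1 - c') := (treeSum_nonneg (fun n l => by split_ifs <;> positivity)
      _ _ _).trans h3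
    calc _ ≤ _ := (pullMass_mono hcov).trans (pullMass_union_le _ _ _ _ _)
      _ ≤ ENNReal.ofReal (K * ε * c') + ENNReal.ofReal (K * ε * (1 - c')) :=
          add_le_add (hKc ▸ h2) (h1.trans (ENNReal.ofReal_le_ofReal h3))
      _ = _ := by rw [← ENNReal.ofReal_add (by positivity) hc1]; congr 1; ring
  intro F ψ Ω h hBJ μ ε hε hμ
  have hun : Ω ∩ ψ ⁻¹' treeBox 0 0 =
      ⋃ N : ℕ, Ω ∩ ψ ⁻¹' (treeBox 0 0 ∩ {p | (1 / 2) ^ N ≤ p.im}) := by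
    ext w
    simp only [mem_iUnion, mem_inter_iff, mem_preimage]
    constructor
    · rintro ⟨hw, hp⟩
      obtain ⟨N, hN⟩ := exists_pow_lt_of_lt_one hp.2.1 (show (1 / 2 : ℝ) < 1 by norm_num)
      exact ⟨N, hw, hp, hN.le⟩
    · rintro ⟨N, hw, hp, -⟩
      exact ⟨hw, hp⟩
  unfold pullMass
  rw [hun, setLIntegral_iUnion_of_directed]
  · exact iSup_le fun N => hstep N F ψ Ω h hBJ μ ε hε hμ
  · refine Monotone.directed_le fun a b hab => ?_
    rintro w ⟨hw, hp, hpa⟩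
    have h1 : (1 / 2 : ℝ) ^ b ≤ (1 / 2) ^ a :=
      pow_le_pow_of_le_one (by norm_num) (by norm_num) hab
    exact ⟨hw, hp, h1.trans hpa⟩

/-! ### Measures on bounded domains -/

theorem pushForward_apply {Ω : Set ℂ} {ψ : ℂ → ℂ} (hΩ : IsOpen Ω) (hψ : ContinuousOn ψ Ω)
    (μ : Measure ℂ) {A : Set ℂ} (hA : MeasurableSet A) :
    pushForward Ω ψ μ A = pullMass μ ψ Ω A := by
  classical
  have hm : Measurable (Ω.piecewise ψ 0) :=
    hψ.measurable_piecewise continuousOn_const hΩ.measurableSet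
  have hae : ψ =ᵐ[(μ.restrict Ω).withDensity fun z => (‖deriv ψ z‖₊ : ℝ≥0∞)]
      Ω.piecewise ψ 0 := by
    refine (withDensity_absolutelyContinuous _ _).ae_eq ?_
    filter_upwards [ae_restrict_mem hΩ.measurableSet] with w hw
    rw [piecewise_eq_of_mem _ _ _ hw]
  rw [pushForward, Measure.map_congr hae, Measure.map_apply hm hA, withDensity_apply _ (hm hA),
    Measure.restrict_restrict (hm hA), pullMass]
  congr 2
  ext w
  simp only [mem_inter_iff, mem_preimage]
  constructor
  · rintro ⟨h1, h2⟩
    rw [piecewise_eq_of_mem _ _ _ h2] at h1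
    exact ⟨h2, h1⟩
  · rintro ⟨h1, h2⟩
    rw [piecewise_eq_of_mem _ _ _ h1]
    exact ⟨h2, h1⟩

theorem exists_add_mul_mem_frontier {W : Set ℂ} (hW : IsOpen W) (hb : Bornology.IsBounded W)
    {w u : ℂ} (hw : w ∈ W) (hu : ‖u‖ = 1) : ∃ t : ℝ, 0 ≤ t ∧ w + t * u ∈ frontier W := by
  by_contra! hcon
  have hray : IsPreconnected ((fun t : ℝ => w + t * u) '' Ici 0) :=
    isPreconnected_Ici.image _ (by fun_prop)
  have hWs := hray.subset_of_disjoint_frontier hW ?_ ⟨w, ⟨0, by simp, by simp⟩, hw⟩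
  · obtain ⟨R, hR0, hR⟩ := hb.subset_ball_lt 0 w
    have h2 := hR (hWs ⟨R, hR0.le, rfl⟩)
    rw [mem_ball, dist_eq_norm, add_sub_cancel_left, norm_mul, hu, Complex.norm_real,
      Real.norm_of_nonneg hR0.le, mul_one] at h2
    exact lt_irrefl _ h2
  · rintro z ⟨t, ht, rfl⟩ hz
    exact hcon t ht hz

theorem two_mul_infDist_le_diam {W : Set ℂ} (hW : IsOpen W) (hb : Bornology.IsBounded W)
    {w : ℂ} (hw : w ∈ W) : 2 * infDist w (frontier W) ≤ diam (frontier W) := by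
  obtain ⟨s, hs, h1⟩ := exists_add_mul_mem_frontier hW hb hw (u := 1) (by simp)
  obtain ⟨t, ht, h2⟩ := exists_add_mul_mem_frontier hW hb hw (u := -1) (by simp)
  have h3 := dist_le_diam_of_mem (hb.closure.subset frontier_subset_closure) h1 h2
  have h4 := infDist_le_dist_of_mem (x := w) h1
  have h5 := infDist_le_dist_of_mem (x := w) h2
  rw [dist_self_add_right, norm_mul, Complex.norm_real, Real.norm_of_nonneg hs, norm_one,
    mul_one] at h4
  rw [dist_self_add_right, norm_mul, Complex.norm_real, Real.norm_of_nonneg ht, norm_neg, norm_one,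
    mul_one] at h5
  rw [dist_add_left, dist_eq_norm,
    show (s : ℂ) * 1 - t * -1 = ((s + t : ℝ) : ℂ) by push_cast; ring, Complex.norm_real,
    Real.norm_of_nonneg (by positivity)] at h3
  linarith

theorem IsCarleson.measure_inter_ball_lt_top {Ω : Set ℂ} {μ : Measure ℂ} (hμ : IsCarleson Ω μ)
    (hb : Bornology.IsBounded (frontier Ω)) {z : ℂ} (hz : z ∈ frontier Ω) {r : ℝ} (hr : 0 < r)
    (hrd : r < diam (frontier Ω)) : μ (Ω ∩ ball z r) < ⊤ := by
  have h1 : ENNReal.ofReal r < Metric.ediam (frontier Ω) :=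
    (ENNReal.ofReal_lt_iff_lt_toReal hr.le hb.ediam_ne_top).2 hrd
  have h2 : μ (Ω ∩ ball z r) / ENNReal.ofReal r ≤ carlesonNorm Ω μ :=
    le_iSup₂_of_le z hz (le_iSup₂_of_le r ⟨hr, h1⟩ le_rfl)
  have h3 := h2.trans_lt hμ
  rw [ENNReal.div_lt_iff (Or.inl (ENNReal.ofReal_pos.2 hr).ne') (Or.inl ENNReal.ofReal_ne_top)] at h3
  exact h3.trans_le le_top

theorem IsCarleson.measure_lt_top {Ω : Set ℂ} {μ : Measure ℂ} (hμ : IsCarleson Ω μ)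
    (hΩ : IsOpen Ω) (hb : Bornology.IsBounded Ω) (hne : (frontier Ω).Nonempty)
    (hd : 0 < diam (frontier Ω)) : μ Ω < ⊤ := by
  have hcl : IsCompact (closure Ω) := hb.isCompact_closure
  have hbf : Bornology.IsBounded (frontier Ω) := hb.closure.subset frontier_subset_closure
  set r := 3 / 4 * diam (frontier Ω) with hr
  have hr0 : 0 < r := by positivity
  obtain ⟨t, ht⟩ := hcl.elim_finite_subcover (fun z : frontier Ω => ball (z : ℂ) r)
    (fun _ => isOpen_ball) (by
      intro w hw
      rw [mem_iUnion]
      by_cases hwΩ : w ∈ Ω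
      · obtain ⟨x, hx, e⟩ := isClosed_frontier.exists_infDist_eq_dist hne w
        refine ⟨⟨x, hx⟩, ?_⟩
        have := two_mul_infDist_le_diam hΩ hb hwΩ
        rw [mem_ball, ← e, hr]
        linarith
      · refine ⟨⟨w, hw, ?_⟩, mem_ball_self hr0⟩
        rwa [hΩ.interior_eq])
  have hsub : Ω ⊆ ⋃ z ∈ t, Ω ∩ ball (z : ℂ) r := by
    intro w hw
    obtain ⟨z, hz, hwz⟩ := mem_iUnion₂.1 (ht (subset_closure hw))
    exact mem_iUnion₂.2 ⟨z, hz, hw, hwz⟩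
  refine (measure_mono hsub).trans_lt ((measure_biUnion_finset_le t _).trans_lt ?_)
  exact ENNReal.sum_lt_top.2 fun z _ =>
    hμ.measure_inter_ball_lt_top hbf z.2 hr0 (by rw [hr]; linarith)

/-- A conformal map sends points close to the circle to points close to the boundary. -/
theorem exists_infDist_lt {φ ψ : ℂ → ℂ} {Ω : Set ℂ} (hΩ : IsOpen Ω) (hb : Bornology.IsBounded Ω)
    (hψ : ContinuousOn ψ Ω) (hmaps : ∀ w ∈ Ω, ψ w ∈ unitDisk) (hφ : ∀ z ∈ unitDisk, φ z ∈ Ω)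
    (hψφ : ∀ z ∈ unitDisk, ψ (φ z) = z) {t : ℝ} (ht : 0 < t) :
    ∃ ρ : ℝ, 0 ≤ ρ ∧ ρ < 1 ∧ ∀ z ∈ unitDisk, ρ < ‖z‖ → infDist (φ z) (frontier Ω) < t := by
  set S : Set ℂ := closure Ω ∩ {w | t ≤ infDist w (frontier Ω)} with hS
  have hSc : IsCompact S := hb.isCompact_closure.inter_right
    (isClosed_le continuous_const (continuous_infDist_pt _))
  have hSΩ : S ⊆ Ω := by
    rintro w ⟨hw, hwt⟩
    by_contra hwΩ
    have h0 : infDist w (frontier Ω) = 0 := infDist_zero_of_mem ⟨hw, by rwa [hΩ.interior_eq]⟩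
    have h1 : t ≤ infDist w (frontier Ω) := hwt
    linarith
  have hmem : ∀ z ∈ unitDisk, t ≤ infDist (φ z) (frontier Ω) → φ z ∈ S :=
    fun z hz h => ⟨subset_closure (hφ z hz), h⟩
  rcases S.eq_empty_or_nonempty with h0 | hne
  · refine ⟨0, le_rfl, one_pos, fun z hz _ => ?_⟩
    by_contra! hcon
    have := hmem z hz hcon
    rw [h0] at this
    exact this
  · obtain ⟨w, hw, hmax⟩ := hSc.exists_isMaxOn hne ((hψ.mono hSΩ).norm)
    refine ⟨‖ψ w‖, norm_nonneg _, by simpa [unitDisk] using hmaps w (hSΩ hw), fun z hz hzn => ?_⟩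
    by_contra! hcon
    have := hmax (hmem z hz hcon)
    simp only [mem_ofPred_eq, hψφ z hz] at this
    linarith

/-! ### Transfer between the disk and the half-plane -/

/-- The Möbius map of the upper half-plane onto the unit disk with `0 ↦ ξ` and `i ↦ 0`. -/
noncomputable def cayley (ξ z : ℂ) : ℂ := ξ * ((Complex.I - z) / (Complex.I + z))

/-- The inverse of `cayley ξ`. -/
noncomputable def cayleyInv (ξ ζ : ℂ) : ℂ := Complex.I * ((1 - ζ / ξ) / (1 + ζ / ξ))

theorem I_add_ne_zero {z : ℂ} (hz : z ∈ uhp) : Complex.I + z ≠ 0 := by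
  intro h
  have h1 := congrArg Complex.im h
  rw [mem_uhp] at hz
  simp at h1
  linarith

theorem norm_cayley_sq {ξ z : ℂ} (hξ : ‖ξ‖ = 1) (hz : z ∈ uhp) :
    ‖cayley ξ z‖ ^ 2 = 1 - 4 * z.im / (z.re ^ 2 + (1 + z.im) ^ 2) := by
  rw [mem_uhp] at hz
  have h : 0 < z.re ^ 2 + (1 + z.im) ^ 2 := by positivity
  rw [cayley, norm_mul, norm_div, hξ, one_mul, div_pow, ← Complex.normSq_eq_norm_sq,
    ← Complex.normSq_eq_norm_sq, Complex.normSq_apply, Complex.normSq_apply]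
  simp only [Complex.sub_re, Complex.sub_im, Complex.add_re, Complex.add_im, Complex.I_re,
    Complex.I_im, zero_sub, zero_add]
  rw [show z.re * z.re + (1 + z.im) * (1 + z.im) = z.re ^ 2 + (1 + z.im) ^ 2 by ring]
  field_simp
  ring

theorem mem_unitDisk {z : ℂ} : z ∈ unitDisk ↔ ‖z‖ < 1 := by simp [unitDisk]

theorem cayley_mem {ξ z : ℂ} (hξ : ‖ξ‖ = 1) (hz : z ∈ uhp) : cayley ξ z ∈ unitDisk := by
  rw [mem_unitDisk, ← sq_lt_one_iff₀ (norm_nonneg _), norm_cayley_sq hξ hz]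
  rw [mem_uhp] at hz
  have : 0 < 4 * z.im / (z.re ^ 2 + (1 + z.im) ^ 2) := by positivity
  linarith

theorem one_add_div_ne_zero {ξ ζ : ℂ} (hξ : ‖ξ‖ = 1) (hζ : ζ ∈ unitDisk) : 1 + ζ / ξ ≠ 0 := by
  intro h
  rw [mem_unitDisk] at hζ
  have h1 : ‖ζ / ξ‖ = 1 := by rw [eq_neg_of_add_eq_zero_right h, norm_neg, norm_one]
  rw [norm_div, hξ, div_one] at h1
  linarith

theorem cayleyInv_mem {ξ ζ : ℂ} (hξ : ‖ξ‖ = 1) (hζ : ζ ∈ unitDisk) : cayleyInv ξ ζ ∈ uhp := by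
  have hne := one_add_div_ne_zero hξ hζ
  rw [mem_unitDisk] at hζ
  have hu : ‖ζ / ξ‖ < 1 := by rwa [norm_div, hξ, div_one]
  rw [cayleyInv]
  set u := ζ / ξ
  have h2 : u.re * u.re + u.im * u.im < 1 := by
    rw [← Complex.normSq_apply, Complex.normSq_eq_norm_sq]
    exact (sq_lt_one_iff₀ (norm_nonneg _)).2 hu
  have h1 := Complex.normSq_pos.2 hne
  rw [mem_uhp, Complex.I_mul_im, Complex.div_re, ← add_div]
  refine div_pos ?_ h1
  simp
  nlinarith

theorem cayleyInv_cayley {ξ z : ℂ} (hξ : ‖ξ‖ = 1) (hz : z ∈ uhp) :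
    cayleyInv ξ (cayley ξ z) = z := by
  have h0 : ξ ≠ 0 := by rw [← norm_pos_iff, hξ]; exact one_pos
  have h1 := I_add_ne_zero hz
  rw [cayleyInv, cayley, mul_div_cancel_left₀ _ h0]
  have h2 : 1 + (Complex.I - z) / (Complex.I + z) = 2 * Complex.I / (Complex.I + z) := by
    field_simp; ring
  have h3 : 1 - (Complex.I - z) / (Complex.I + z) = 2 * z / (Complex.I + z) := by
    field_simp; ring
  rw [h2, h3, div_div_div_cancel_right₀ h1]
  field_simp

theorem cayley_cayleyInv {ξ ζ : ℂ} (hξ : ‖ξ‖ = 1) (hζ : ζ ∈ unitDisk) :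
    cayley ξ (cayleyInv ξ ζ) = ζ := by
  have h0 : ξ ≠ 0 := by rw [← norm_pos_iff, hξ]; exact one_pos
  have h1 := one_add_div_ne_zero hξ hζ
  have e : ξ * (ζ / ξ) = ζ := by field_simp
  rw [cayley, cayleyInv]
  set u := ζ / ξ
  have h2 : Complex.I - Complex.I * ((1 - u) / (1 + u)) = 2 * Complex.I * u / (1 + u) := by
    field_simp; ring
  have h3 : Complex.I + Complex.I * ((1 - u) / (1 + u)) = 2 * Complex.I / (1 + u) := by
    field_simp; ring
  rw [h2, h3, div_div_div_cancel_right₀ h1, mul_div_cancel_left₀ _ (by simp), e]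

theorem hasDerivAt_cayleyInv {ξ ζ : ℂ} (hξ : ‖ξ‖ = 1) (hζ : ζ ∈ unitDisk) :
    ∃ d : ℂ, 1 / 2 ≤ ‖d‖ ∧ HasDerivAt (cayleyInv ξ) d ζ := by
  have h1 := one_add_div_ne_zero hξ hζ
  have h2 : HasDerivAt (fun ζ : ℂ => ζ / ξ) (1 / ξ) ζ := (hasDerivAt_id ζ).div_const ξ
  refine ⟨_, ?_, ((h2.const_sub 1).div (h2.const_add 1) h1).const_mul Complex.I⟩
  have hu : ‖1 + ζ / ξ‖ ≤ 2 := by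
    rw [mem_unitDisk] at hζ
    refine (norm_add_le _ _).trans ?_
    rw [norm_one, norm_div, hξ, div_one]
    linarith
  rw [show -(1 / ξ) * (1 + ζ / ξ) - (1 - ζ / ξ) * (1 / ξ) = -2 / ξ by ring, norm_mul, norm_div,
    norm_div, norm_neg, hξ, norm_pow, Complex.norm_I, one_mul, div_one, RCLike.norm_ofNat]
  rw [div_le_div_iff₀ two_pos (pow_pos (norm_pos_iff.2 h1) 2)]
  nlinarith [norm_nonneg (1 + ζ / ξ)]

theorem norm_cayleyInv_lt {ξ ζ : ℂ} (hξ : ‖ξ‖ = 1) {r : ℝ} (hr : r ≤ 1 / 2)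
    (hζ : ζ ∈ ball ξ r) : ‖cayleyInv ξ ζ‖ < r := by
  have h0 : ξ ≠ 0 := by rw [← norm_pos_iff, hξ]; exact one_pos
  have h1 : ‖1 - ζ / ξ‖ < r := by
    rw [show 1 - ζ / ξ = (ξ - ζ) / ξ by field_simp, norm_div, hξ, div_one, ← dist_eq_norm,
      dist_comm]
    exact hζ
  have h2 : 3 / 2 ≤ ‖1 + ζ / ξ‖ := by
    have := norm_sub_norm_le (2 : ℂ) (1 - ζ / ξ)
    rw [show (2 : ℂ) - (1 - ζ / ξ) = 1 + ζ / ξ by ring, RCLike.norm_ofNat] at this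
    linarith
  rw [cayleyInv, norm_mul, norm_div, Complex.norm_I, one_mul, div_lt_iff₀ (by linarith)]
  nlinarith [norm_nonneg (1 - ζ / ξ)]

theorem conformalUHP_cayley {φ ψ : ℂ → ℂ} {Ω : Set ℂ} (hdiff : DifferentiableOn ℂ φ unitDisk)
    (honto : φ '' unitDisk = Ω) (hψφ : ∀ z ∈ unitDisk, ψ (φ z) = z) (hne : (frontier Ω).Nonempty)
    {ξ : ℂ} (hξ : ‖ξ‖ = 1) :
    ConformalUHP (fun z => φ (cayley ξ z)) (fun w => cayleyInv ξ (ψ w)) Ω where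
  diff := by
    refine hdiff.comp ?_ fun z hz => cayley_mem hξ hz
    intro z hz
    refine DifferentiableAt.differentiableWithinAt ?_
    unfold cayley
    exact ((differentiableAt_id.const_sub _).div (differentiableAt_id.const_add _)
      (I_add_ne_zero hz)).const_mul _
  img := by
    rw [← honto]
    ext w
    constructor
    · rintro ⟨z, hz, rfl⟩
      exact ⟨_, cayley_mem hξ hz, rfl⟩
    · rintro ⟨ζ, hζ, rfl⟩
      exact ⟨cayleyInv ξ ζ, cayleyInv_mem hξ hζ, by beta_reduce; rw [cayley_cayleyInv hξ hζ]⟩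
  left z hz := by
    rw [hψφ _ (cayley_mem hξ hz), cayleyInv_cayley hξ hz]
  ne := hne

theorem BoxMap.smallMass {C₁ : ℝ} {lam : ℝ → ℝ} {L : ℕ → ℝ} {D₀ : ℕ} {F ψ : ℂ → ℂ} {Ω : Set ℂ}
    (h : BoxMap C₁ lam L D₀ F ψ Ω) (hC₁ : 0 ≤ C₁) (hD₀ : 1 ≤ D₀) {μ : Measure ℂ} {ε δ : ℝ}
    (hμ : ∀ z ∈ frontier Ω, ∀ r : ℝ, 0 < r → r < δ → μ (Ω ∩ ball z r) ≤
      ENNReal.ofReal (ε / (C₁ + 2) * r))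
    (hδ : ∀ x y : ℝ, 0 < y → y ≤ 1 →
      (C₁ + 2) * infDist (F (x + y * Complex.I)) (frontier Ω) < δ) : SmallMass ε μ F Ω := by
  intro x y hy hy1
  have hq := mem_uhp_add_mul_I (x := x) hy
  set q : ℂ := x + y * Complex.I with hqdef
  set d := infDist (F q) (frontier Ω) with hd
  have hd0 : 0 < d := h.pos (h.mem hq)
  obtain ⟨w, hw, e⟩ := h.exists_nearest (F q)
  have h1 := hμ w hw ((C₁ + 2) * d) (by positivity) (hδ x y hy hy1)
  rw [show ε / (C₁ + 2) * ((C₁ + 2) * d) = ε * d by field_simp] at h1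
  refine (measure_mono ?_).trans h1
  rintro _ ⟨p, ⟨hp1, hp2, hp3⟩, rfl⟩
  have hp : p ∈ uhp := hp2
  refine ⟨h.mem hp, ?_⟩
  have hpx : dist p x < 2 * y := by
    rw [dist_eq_norm]
    refine (Complex.norm_le_abs_re_add_abs_im _).trans_lt ?_
    simp only [Complex.sub_re, Complex.sub_im, Complex.ofReal_re, Complex.ofReal_im, sub_zero]
    rw [abs_of_pos hp2]
    linarith
  have h2 := h.box x y hy (hy1.trans (by exact_mod_cast hD₀)) p hp hpx
  rw [← hqdef, ← hd] at h2
  rw [mem_ball]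
  have := dist_triangle (F p) (F q) w
  rw [e, ← hd] at this
  nlinarith

/-! ### The pull-back of a vanishing Carleson measure -/

theorem pullMass_ball_le {ψ : ℂ → ℂ} {Ω : Set ℂ} (hΩ : IsOpen Ω)
    (hψd : DifferentiableOn ℂ ψ Ω) (hmaps : ∀ w ∈ Ω, ψ w ∈ unitDisk) (μ : Measure ℂ) {ξ : ℂ}
    (hξ : ‖ξ‖ = 1) {r : ℝ} (hr : 0 < r) (hr2 : r ≤ 1 / 2) :
    pullMass μ ψ Ω (unitDisk ∩ ball ξ r) ≤ ENNReal.ofReal (4 * r) *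
      pullMass μ (fun w => (cayleyInv ξ (ψ w) - ((-r : ℝ) : ℂ)) / ((2 * r : ℝ) : ℂ)) Ω
        (treeBox 0 0) := by
  have hmeas : MeasurableSet (Ω ∩ ψ ⁻¹' (unitDisk ∩ ball ξ r)) :=
    (hψd.continuousOn.isOpen_inter_preimage hΩ (isOpen_ball.inter isOpen_ball)).measurableSet
  have h1 : pullMass μ ψ Ω (unitDisk ∩ ball ξ r) ≤
      2 * pullMass μ (fun w => cayleyInv ξ (ψ w)) Ω (unitDisk ∩ ball ξ r |>.image (cayleyInv ξ)) := by
    unfold pullMass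
    rw [← lintegral_const_mul' _ _ ENNReal.ofNat_ne_top]
    refine (setLIntegral_mono' hmeas (g := fun w =>
      2 * (‖deriv (fun w => cayleyInv ξ (ψ w)) w‖₊ : ℝ≥0∞)) ?_).trans (lintegral_mono_set ?_)
    · rintro w ⟨hw, -⟩
      obtain ⟨d, hd, hder⟩ := hasDerivAt_cayleyInv hξ (hmaps w hw)
      have hψw := (hψd.differentiableAt (hΩ.mem_nhds hw)).hasDerivAt
      rw [show deriv (fun w => cayleyInv ξ (ψ w)) w = d * deriv ψ w from (hder.comp w hψw).deriv]
      have : ‖deriv ψ w‖₊ ≤ 2 * ‖d * deriv ψ w‖₊ := by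
        rw [← NNReal.coe_le_coe]
        push_cast
        rw [norm_mul]
        nlinarith [norm_nonneg (deriv ψ w)]
      exact_mod_cast this
    · rintro w ⟨hw, hw2⟩
      exact ⟨hw, _, hw2, rfl⟩
  refine h1.trans ?_
  have h2 : (unitDisk ∩ ball ξ r).image (cayleyInv ξ) ⊆
      (fun z => (z - ((-r : ℝ) : ℂ)) / ((2 * r : ℝ) : ℂ)) ⁻¹' treeBox 0 0 := by
    rintro _ ⟨ζ, ⟨hζ, hζr⟩, rfl⟩
    have h3 := norm_cayleyInv_lt hξ hr2 hζr
    have h4 : 0 < (cayleyInv ξ ζ).im := cayleyInv_mem hξ hζ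
    have h5 := (Complex.abs_re_le_norm (cayleyInv ξ ζ)).trans h3.le
    have h6 := ((le_abs_self _).trans (Complex.abs_im_le_norm (cayleyInv ξ ζ))).trans h3.le
    rw [abs_le] at h5
    have hr' : 0 < 2 * r := by positivity
    simp only [mem_preimage, treeBox, mem_ofPred_eq, Complex.div_ofReal_re, Complex.div_ofReal_im,
      Complex.sub_re, Complex.sub_im, Complex.ofReal_re, Complex.ofReal_im, sub_zero, pow_zero,
      treeX, CharP.cast_eq_zero, zero_add, mul_one]
    refine ⟨?_, by positivity, by rw [div_le_one hr']; linarith⟩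
    have h7 : 0 ≤ ((cayleyInv ξ ζ).re - -r) / (2 * r) := div_nonneg (by linarith) hr'.le
    have h8 : ((cayleyInv ξ ζ).re - -r) / (2 * r) ≤ 1 := by rw [div_le_one hr']; linarith
    rw [abs_le]
    constructor <;> linarith
  refine (mul_le_mul_right (pullMass_mono h2) 2).trans ?_
  rw [pullMass_affine _ _ _ _ _ (by positivity : 0 < 2 * r), ← mul_assoc,
    show (2 : ℝ≥0∞) = ENNReal.ofReal 2 by simp, ← ENNReal.ofReal_mul two_pos.le]
  rw [← mul_assoc]
  norm_num

theorem exists_pullMass_ball_le {φ ψ : ℂ → ℂ} {Ω : Set ℂ}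
    (hJordan : IsJordanCurve (frontier Ω)) (hbd : Bornology.IsBounded (frontier Ω))
    (hdiff : DifferentiableOn ℂ φ unitDisk) (honto : φ '' unitDisk = Ω)
    (hψφ : ∀ z ∈ unitDisk, ψ (φ z) = z) (hquasi : AhlforsThreePoint (frontier Ω))
    (hBJ : BishopJones Ω) {μ : Measure ℂ} (hμ : IsVanishingCarleson Ω μ) {ε : ℝ} (hε : 0 < ε) :
    ∃ δ : ℝ, 0 < δ ∧ ∀ ξ : ℂ, ‖ξ‖ = 1 → ∀ r : ℝ, 0 < r → r < δ →
      pullMass μ ψ Ω (unitDisk ∩ ball ξ r) ≤ ENNReal.ofReal (ε * r) := by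
  have hconf : ∀ ξ : ℂ, ‖ξ‖ = 1 →
      ConformalUHP (fun z => φ (cayley ξ z)) (fun w => cayleyInv ξ (ψ w)) Ω :=
    fun ξ hξ => conformalUHP_cayley hdiff honto hψφ hJordan.nonempty hξ
  have h1 := hconf 1 norm_one
  have hΩ := h1.isOpen
  have hb := h1.isBounded hbd
  have hφ : ∀ z ∈ unitDisk, φ z ∈ Ω := fun z hz => honto ▸ mem_image_of_mem φ hz
  have hmaps : ∀ w ∈ Ω, ψ w ∈ unitDisk := by
    rw [← honto]
    rintro _ ⟨z, hz, rfl⟩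
    rwa [hψφ z hz]
  have hψd : DifferentiableOn ℂ ψ Ω := by
    rw [← honto]
    rintro _ ⟨z, hz, rfl⟩
    exact (hasDerivAt_leftInverse isOpen_ball hdiff hψφ hz).differentiableAt.differentiableWithinAt
  obtain ⟨C, hC, hturn⟩ := hquasi.exists_boundedTurning hJordan
  have h0 : (0 : ℂ) ∈ unitDisk := by simp [unitDisk]
  have hd₀ := h1.pos (hφ 0 h0)
  set d₀ := infDist (φ 0) (frontier Ω) with hd₀def
  have hnorm : ∀ ξ : ℂ, ‖ξ‖ = 1 → NormalizedUHP C d₀ (diam Ω) (fun z => φ (cayley ξ z))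
      (fun w => cayleyInv ξ (ψ w)) Ω := fun ξ hξ =>
    { toConformalUHP := hconf ξ hξ
      jordan := hJordan
      turning := hturn
      base := by simp [cayley, hd₀def]
      diam := fun a ha b hb' => dist_le_diam_of_mem hb ha hb' }
  obtain ⟨C₁, lam, L, hC₁, hlam, hL, hbox⟩ := exists_boxMap (diam Ω) hC hd₀
  obtain ⟨k, hk, c, hc, c₁, hc₁, c₂, -, hBJ⟩ := hBJ
  obtain ⟨K, hK, D₁, hmain⟩ := exists_pullMass_le (c₂ := c₂) hC₁ hlam hL hk hc hc₁
  obtain ⟨s₀, hs₀, hbox⟩ := hbox (max D₁ 1)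
  obtain ⟨δ, hδ, hμδ⟩ := hμ.2 (ε / (4 * K) / (C₁ + 2)) (by positivity)
  obtain ⟨ρ, hρ0, hρ1, hρ⟩ := exists_infDist_lt hΩ hb hψd.continuousOn hmaps hφ hψφ
    (div_pos hδ (by linarith : 0 < C₁ + 2))
  have hρ2 : 0 < 1 - ρ ^ 2 := by nlinarith
  refine ⟨min (s₀ / 2) (min (1 / 2) ((1 - ρ ^ 2) / 8)), by positivity, fun ξ hξ r hr hrδ => ?_⟩
  obtain ⟨hr1, hr2, hr3⟩ : r < s₀ / 2 ∧ r < 1 / 2 ∧ r < (1 - ρ ^ 2) / 8 := by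
    simpa only [lt_min_iff] using hrδ
  have hB := hbox _ _ _ (hnorm ξ hξ) (-r) (2 * r) (by positivity) (by linarith)
  have hS := hB.smallMass (by linarith) (le_max_right _ _) hμδ (fun x y hy hy1 => by
    rw [affine_add_mul_I]
    have hy' : 0 < 2 * r * y := by positivity
    have hq := mem_uhp_add_mul_I (x := -r + 2 * r * x) hy'
    have hn : ρ < ‖cayley ξ (((-r + 2 * r * x : ℝ) : ℂ) + ((2 * r * y : ℝ) : ℂ) * Complex.I)‖ := by
      refine lt_of_pow_lt_pow_left₀ 2 (norm_nonneg _) ?_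
      rw [norm_cayley_sq hξ hq, im_add_mul_I]
      set x' := (((-r + 2 * r * x : ℝ) : ℂ) + ((2 * r * y : ℝ) : ℂ) * Complex.I).re
      have h2 : 4 * (2 * r * y) / (x' ^ 2 + (1 + 2 * r * y) ^ 2) ≤ 4 * (2 * r * y) :=
        div_le_self (by positivity) (by nlinarith [sq_nonneg x'])
      nlinarith
    have := hρ _ (cayley_mem hξ hq) hn
    rwa [lt_div_iff₀ (by linarith), mul_comm] at this)
  have hP := hmain _ (le_max_left _ _) _ _ _ hB hBJ μ _ (by positivity) hS
  refine (pullMass_ball_le hΩ hψd hmaps μ hξ hr hr2.le).trans ?_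
  refine (mul_le_mul_right hP _).trans_eq ?_
  rw [← ENNReal.ofReal_mul (by positivity)]
  congr 1
  field_simp

theorem pullMass_lt_top_of_isCompact {φ ψ : ℂ → ℂ} {Ω : Set ℂ}
    (hdiff : DifferentiableOn ℂ φ unitDisk) (honto : φ '' unitDisk = Ω)
    (hψφ : ∀ z ∈ unitDisk, ψ (φ z) = z) {μ : Measure ℂ} (hμ : μ Ω < ⊤) {S : Set ℂ}
    (hS : IsCompact S) (hSD : S ⊆ unitDisk) : pullMass μ ψ Ω S < ⊤ := by
  have hinj : InjOn φ unitDisk := fun a ha b hb e => by rw [← hψφ a ha, e, hψφ b hb]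
  have hcont : ContinuousOn (fun z => ‖(deriv φ z)⁻¹‖) S :=
    ((((hdiff.deriv isOpen_ball).continuousOn.mono hSD).inv₀ fun z hz =>
      deriv_ne_zero_of_injOn isOpen_ball hdiff hinj (hSD hz))).norm
  obtain ⟨M, hM⟩ := hS.bddAbove_image hcont
  refine lt_of_le_of_lt (b := ∫⁻ _ in Ω, ENNReal.ofReal M ∂μ) ?_ ?_
  · refine (setLIntegral_mono (g := fun _ => ENNReal.ofReal M) measurable_const ?_).trans
      (lintegral_mono_set inter_subset_left)
    rw [← honto]
    rintro _ ⟨⟨z, hz, rfl⟩, hzS⟩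
    rw [mem_preimage, hψφ z hz] at hzS
    rw [(hasDerivAt_leftInverse isOpen_ball hdiff hψφ hz).deriv, ← enorm_eq_nnnorm, ← ofReal_norm]
    exact ENNReal.ofReal_le_ofReal (hM ⟨z, hzS, rfl⟩)
  · rw [setLIntegral_const]
    exact ENNReal.mul_lt_top ENNReal.ofReal_lt_top hμ

theorem frontier_unitDisk : frontier unitDisk = sphere (0 : ℂ) 1 :=
  frontier_ball _ one_ne_zero

theorem measure_unitDisk_lt_top {ν : Measure ℂ} {δ : ℝ} (hδ : 0 < δ)
    (hball : ∀ ξ : ℂ, ‖ξ‖ = 1 → ν (unitDisk ∩ ball ξ δ) < ⊤)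
    (hcpt : ∀ S, IsCompact S → S ⊆ unitDisk → ν S < ⊤) : ν unitDisk < ⊤ := by
  obtain ⟨t, ht⟩ := (isCompact_sphere (0 : ℂ) 1).elim_finite_subcover
    (fun ξ : sphere (0 : ℂ) 1 => ball (ξ : ℂ) δ) (fun _ => isOpen_ball)
    fun w hw => mem_iUnion.2 ⟨⟨w, hw⟩, mem_ball_self hδ⟩
  set S : Set ℂ := closedBall 0 1 \ ⋃ ξ ∈ t, ball (ξ : ℂ) δ with hS
  have hSc : IsCompact S :=
    (isCompact_closedBall _ _).diff (isOpen_biUnion fun _ _ => isOpen_ball)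
  have hSD : S ⊆ unitDisk := by
    rintro w ⟨hw, hwt⟩
    rw [mem_closedBall] at hw
    exact hw.lt_of_ne fun e => hwt (ht e)
  have hsub : unitDisk ⊆ S ∪ ⋃ ξ ∈ t, unitDisk ∩ ball (ξ : ℂ) δ := by
    intro w hw
    by_cases h : w ∈ ⋃ ξ ∈ t, ball (ξ : ℂ) δ
    · right
      obtain ⟨ξ, hξ, hwξ⟩ := mem_iUnion₂.1 h
      exact mem_iUnion₂.2 ⟨ξ, hξ, hw, hwξ⟩
    · exact Or.inl ⟨ball_subset_closedBall hw, h⟩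
  refine (measure_mono hsub).trans_lt ((measure_union_le _ _).trans_lt
    (ENNReal.add_lt_top.2 ⟨hcpt S hSc hSD, ?_⟩))
  refine (measure_biUnion_finset_le t _).trans_lt (ENNReal.sum_lt_top.2 fun ξ _ => hball ξ ?_)
  simp

theorem isCarleson_unitDisk {ν : Measure ℂ} (hν : ν unitDisk < ⊤) {δ : ℝ} (hδ : 0 < δ)
    (h : ∀ ξ : ℂ, ‖ξ‖ = 1 → ∀ r : ℝ, 0 < r → r < δ →
      ν (unitDisk ∩ ball ξ r) ≤ ENNReal.ofReal r) : IsCarleson unitDisk ν := by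
  refine lt_of_le_of_lt (b := max 1 (ν unitDisk / ENNReal.ofReal δ)) ?_ ?_
  · refine iSup₂_le fun ξ hξ => iSup₂_le fun r hr => ?_
    rw [frontier_unitDisk, mem_sphere_zero_iff_norm] at hξ
    rcases lt_or_ge r δ with hrδ | hrδ
    · refine le_max_of_le_left (ENNReal.div_le_of_le_mul ?_)
      rw [one_mul]
      exact h ξ hξ r hr.1 hrδ
    · exact le_max_of_le_right (ENNReal.div_le_div (measure_mono inter_subset_left)
        (ENNReal.ofReal_le_ofReal hrδ))
  · exact max_lt ENNReal.one_lt_top (ENNReal.div_lt_top hν.ne (ENNReal.ofReal_pos.2 hδ).ne')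

theorem IsJordanCurve.diam_pos {Γ : Set ℂ} (hΓ : IsJordanCurve Γ) : 0 < diam Γ := by
  have hb := hΓ.isCompact.isBounded
  obtain ⟨f, -, hinj, rfl⟩ := hΓ
  have h1 : (1 : ℂ) ∈ sphere (0 : ℂ) 1 := by simp
  have h2 : (-1 : ℂ) ∈ sphere (0 : ℂ) 1 := by simp
  refine (dist_pos.2 fun e => ?_).trans_le
    (dist_le_diam_of_mem hb (mem_image_of_mem f h1) (mem_image_of_mem f h2))
  have := hinj h1 h2 e
  norm_num [Complex.ext_iff] at this

/-- Let `φ` be a conformal map of the unit disk onto a Jordan domain `Ω`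
whose boundary is a quasicircle, and assume `Ω` satisfies the Bishop–Jones condition.
Then the pull-back operator `φ*` (push-forward along the inverse map `ψ = φ⁻¹`) is
well-defined from `CM₀(Ω)` to `CM₀(Δ)`. -/
theorem stmt_4 (φ ψ : ℂ → ℂ) (Ω : Set ℂ)
    (hΩopen : IsOpen Ω) (hΩne : Ω.Nonempty) (hΩconn : IsConnected Ω)
    (hJordan : IsJordanCurve (frontier Ω)) (hbd : Bornology.IsBounded (frontier Ω))
    (hdiff : DifferentiableOn ℂ φ unitDisk)
    (hinj : Set.InjOn φ unitDisk)
    (honto : φ '' unitDisk = Ω)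
    (hψφ : ∀ z ∈ unitDisk, ψ (φ z) = z)
    (hφψ : ∀ w ∈ Ω, φ (ψ w) = w)
    (hquasi : AhlforsThreePoint (frontier Ω))
    (hBJ : BishopJones Ω) :
    ∀ μ : Measure ℂ, IsVanishingCarleson Ω μ →
      IsVanishingCarleson unitDisk (pushForward Ω ψ μ) := by
  intro μ hμ
  have hψc : ContinuousOn ψ Ω := by
    rw [← honto]
    rintro _ ⟨z, hz, rfl⟩
    exact (hasDerivAt_leftInverse isOpen_ball hdiff hψφ hz).continuousAt.continuousWithinAt
  have hball : ∀ ε : ℝ, 0 < ε → ∃ δ : ℝ, 0 < δ ∧ ∀ ξ : ℂ, ‖ξ‖ = 1 → ∀ r : ℝ, 0 < r → r < δ →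
      pushForward Ω ψ μ (unitDisk ∩ ball ξ r) ≤ ENNReal.ofReal (ε * r) := by
    intro ε hε
    obtain ⟨δ, hδ, h⟩ := exists_pullMass_ball_le hJordan hbd hdiff honto hψφ hquasi hBJ hμ hε
    refine ⟨δ, hδ, fun ξ hξ r hr hrδ => ?_⟩
    have hm : MeasurableSet (unitDisk ∩ ball ξ r) := measurableSet_ball.inter measurableSet_ball
    rw [pushForward_apply hΩopen hψc μ hm]
    exact h ξ hξ r hr hrδ
  obtain ⟨δ, hδ, h⟩ := hball 1 one_pos
  simp only [one_mul] at h
  have hμΩ : μ Ω < ⊤ := hμ.1.measure_lt_top hΩopen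
    ((conformalUHP_cayley hdiff honto hψφ hJordan.nonempty norm_one).isBounded hbd)
    hJordan.nonempty hJordan.diam_pos
  have hfin : pushForward Ω ψ μ unitDisk < ⊤ := by
    refine measure_unitDisk_lt_top (half_pos hδ)
      (fun ξ hξ => (h ξ hξ _ (half_pos hδ) (half_lt_self hδ)).trans_lt ENNReal.ofReal_lt_top)
      fun S hS hSD => ?_
    rw [pushForward_apply hΩopen hψc μ hS.measurableSet]
    exact pullMass_lt_top_of_isCompact hdiff honto hψφ hμΩ hS hSD
  refine ⟨isCarleson_unitDisk hfin hδ h, fun ε hε => ?_⟩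
  obtain ⟨δ, hδ, h⟩ := hball ε hε
  refine ⟨δ, hδ, fun ξ hξ r hr hrδ => h ξ ?_ r hr hrδ⟩
  rwa [frontier_unitDisk, mem_sphere_zero_iff_norm] at hξ
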